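/- arXiv:2506.17737 — 2 statements merged into one kernel-verified Lean document; each statement's English description precedes it below -/
import Mathlib

section
/- Let a = 1/2, k ≥ 1, and s := log₃2. For 0 ≤ l ≤ k, let F^∞_{k,l} := {x ∈ [0,1] : the ternary expansion of x contains exactly l ones, and M_{k,1/2} has an infinite derivative at x}. Then dim_H F^∞_{k,l} = s for every l ≤ k; the s-dimensional Hausdorff measure satisfies ℋ^s(F^∞_{k,l}) = 0 for l < k and ℋ^s(F^∞_{k,k}) > 0. Consequently, ℋ^s(D^{+∞}_{k,1/2}) > 0 and ℋ^s(D^{−∞}_{k,1/2}) = 0 when k is even, whereas ℋ^s(D^{−∞}_{k,1/2}) > 0 and ℋ^s(D^{+∞}_{k,1/2}) = 0 when k is odd. -/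
open Filter Topology MeasureTheory Set
open scoped ENNReal

/-- The `(n+1)`-th ternary digit of `x` (choosing the expansion ending in all `0`s
when two expansions exist, and the all-`2`s expansion for `x = 1`). -/
noncomputable def tDigit (x : ℝ) (n : ℕ) : ℕ :=
  if x = 1 then 2 else (⌊(3:ℝ) ^ (n + 1) * x⌋ - 3 * ⌊(3:ℝ) ^ n * x⌋).toNat

/-- `l_n(x)`: the number of `1`s among the first `n` ternary digits of `x`. -/
noncomputable def lCount (x : ℝ) (n : ℕ) : ℕ :=
  ((Finset.range n).filter (fun i => tDigit x i = 1)).card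

/-- `q_a(d)` with `q_a(0)=0`, `q_a(1)=a`, `q_a(2)=1-a`. -/
noncomputable def qDig (a : ℝ) (d : ℕ) : ℝ :=
  if d = 0 then 0 else if d = 1 then a else 1 - a

/-- Okamoto's function `F_a`. -/
noncomputable def Okamoto (a x : ℝ) : ℝ :=
  ∑' n : ℕ, a ^ (n - lCount x n) * (1 - 2 * a) ^ lCount x n * qDig a (tDigit x n)

/-- `M_{k,a}(x)`: the `k`-th partial derivative of `F_a(x)` with respect to `a`. -/
noncomputable def Mfun (k : ℕ) (a x : ℝ) : ℝ :=
  iteratedDeriv k (fun b => Okamoto b x) a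

/-- `f` has derivative `+∞` at `x` (difference quotients over `y ∈ [0,1] \ {x}`). -/
def derivPInf (f : ℝ → ℝ) (x : ℝ) : Prop :=
  Tendsto (fun y => (f y - f x) / (y - x)) (𝓝[Set.Icc 0 1 \ {x}] x) atTop

/-- `f` has derivative `-∞` at `x`. -/
def derivMInf (f : ℝ → ℝ) (x : ℝ) : Prop :=
  Tendsto (fun y => (f y - f x) / (y - x)) (𝓝[Set.Icc 0 1 \ {x}] x) atBot

noncomputable def phiOk (a : ℝ) : ℝ :=
  if a = 1/3 then 1/3 else if a = 1/2 then 0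
  else Real.log (3 * a) / (Real.log a - Real.log |1 - 2 * a|)

noncomputable def C0 (a : ℝ) : ℝ := 1 / (Real.log a - Real.log |1 - 2 * a|)

noncomputable def hEnt (p : ℝ) : ℝ :=
  (-(p * Real.log p) - (1 - p) * Real.log (1 - p) + (1 - p) * Real.log 2) / Real.log 3

noncomputable def dOk (a : ℝ) : ℝ := hEnt (phiOk a)

noncomputable def dTilde (a : ℝ) : ℝ := hEnt (1 - 2 * a)

/-- `F^∞_{k,l}`: points of `[0,1]` whose ternary expansion contains exactly `l` ones and
at which `M_{k,1/2}` has an infinite derivative. -/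
def FInf (k l : ℕ) : Set ℝ :=
  {x ∈ Set.Icc (0:ℝ) 1 | (⨆ n, (lCount x n : ℝ≥0∞)) = (l : ℝ≥0∞) ∧
    (derivPInf (Mfun k (1/2)) x ∨ derivMInf (Mfun k (1/2)) x)}

/-- Complex version of the `n`-th summand of Okamoto's function. -/
noncomputable def okTermC (x : ℝ) (n : ℕ) (z : ℂ) : ℂ :=
  z ^ (n - lCount x n) * (1 - 2 * z) ^ lCount x n *
    (if tDigit x n = 0 then 0 else if tDigit x n = 1 then z else 1 - z)

theorem lCount_le (x : ℝ) (n : ℕ) : lCount x n ≤ n := by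
  unfold lCount
  exact (Finset.card_filter_le _ _).trans (by simp)

theorem lCount_succ (x : ℝ) (n : ℕ) :
    lCount x (n + 1) = lCount x n + if tDigit x n = 1 then 1 else 0 := by
  unfold lCount
  rw [Finset.range_add_one, Finset.filter_insert]
  split_ifs <;> simp

theorem lCount_mono (x : ℝ) : Monotone (lCount x) :=
  monotone_nat_of_le_succ fun n => by rw [lCount_succ]; omega

@[simp]
theorem lCount_zero (x : ℝ) : lCount x 0 = 0 := by simp [lCount]

theorem norm_okTermC_le (x : ℝ) (n : ℕ) {z : ℂ} (hz : ‖z - 1 / 2‖ ≤ 1 / 8) :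
    ‖okTermC x n z‖ ≤ (5 / 8 : ℝ) ^ n := by
  have h1 : ‖z‖ ≤ 5 / 8 := by
    calc ‖z‖ = ‖(z - 1 / 2) + 1 / 2‖ := by ring_nf
      _ ≤ ‖z - 1 / 2‖ + ‖(1 / 2 : ℂ)‖ := norm_add_le _ _
      _ ≤ 5 / 8 := by norm_num at hz ⊢; linarith
  have h2 : ‖1 - z‖ ≤ 5 / 8 := by
    calc ‖1 - z‖ = ‖1 / 2 - (z - 1 / 2)‖ := by ring_nf
      _ ≤ ‖(1 / 2 : ℂ)‖ + ‖z - 1 / 2‖ := norm_sub_le _ _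
      _ ≤ 5 / 8 := by norm_num at hz ⊢; linarith
  have h3 : ‖1 - 2 * z‖ ≤ 5 / 8 := by
    calc ‖1 - 2 * z‖ = ‖(-2 : ℂ) * (z - 1 / 2)‖ := by ring_nf
      _ = 2 * ‖z - 1 / 2‖ := by rw [norm_mul]; norm_num
      _ ≤ 5 / 8 := by linarith
  unfold okTermC
  rw [norm_mul, norm_mul, norm_pow, norm_pow]
  have h4 : ‖(if tDigit x n = 0 then (0 : ℂ) else if tDigit x n = 1 then z else 1 - z)‖ ≤ 1 := by
    split_ifs
    · simp
    · linarith
    · linarith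
  calc ‖z‖ ^ (n - lCount x n) * ‖1 - 2 * z‖ ^ lCount x n *
        ‖(if tDigit x n = 0 then (0 : ℂ) else if tDigit x n = 1 then z else 1 - z)‖
      ≤ (5 / 8) ^ (n - lCount x n) * (5 / 8) ^ lCount x n * 1 := by gcongr
    _ = (5 / 8) ^ n := by rw [mul_one, ← pow_add, Nat.sub_add_cancel (lCount_le x n)]

/-- Complex extension of `a ↦ F_a(x)` near `1/2`. -/
noncomputable def okC (x : ℝ) (z : ℂ) : ℂ := ∑' n, okTermC x n z

theorem summable_five_eighths : Summable fun n : ℕ => (5 / 8 : ℝ) ^ n :=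
  summable_geometric_of_lt_one (by norm_num) (by norm_num)

theorem norm_okC_le (x : ℝ) {z : ℂ} (hz : ‖z - 1 / 2‖ ≤ 1 / 8) : ‖okC x z‖ ≤ 8 / 3 := by
  unfold okC
  refine tsum_of_norm_bounded ?_ fun n => norm_okTermC_le x n hz
  convert hasSum_geometric_of_lt_one (r := (5 / 8 : ℝ)) (by norm_num) (by norm_num) using 1
  norm_num

theorem differentiableOn_okC (x : ℝ) :
    DifferentiableOn ℂ (okC x) (Metric.ball (1 / 2 : ℂ) (1 / 8)) := by
  refine Complex.differentiableOn_tsum_of_summable_norm summable_five_eighths ?_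
    Metric.isOpen_ball ?_
  · intro n
    unfold okTermC
    split_ifs <;> fun_prop
  · intro n z hz
    exact norm_okTermC_le x n (by rw [Metric.mem_ball, dist_eq_norm] at hz; exact hz.le)

theorem ofReal_okTerm (x a : ℝ) (n : ℕ) :
    okTermC x n a =
      ((a ^ (n - lCount x n) * (1 - 2 * a) ^ lCount x n * qDig a (tDigit x n) : ℝ) : ℂ) := by
  unfold okTermC qDig
  split_ifs <;> push_cast <;> rfl

theorem okC_ofReal (x a : ℝ) : okC x a = (Okamoto a x : ℂ) := by
  unfold okC Okamoto
  simp_rw [ofReal_okTerm]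
  rw [Complex.ofReal_tsum]

theorem norm_ofReal_sub_half {a : ℝ} : ‖(a : ℂ) - 1 / 2‖ = |a - 1 / 2| := by
  have : (a : ℂ) - 1 / 2 = ((a - 1 / 2 : ℝ) : ℂ) := by push_cast; ring
  rw [this, Complex.norm_real, Real.norm_eq_abs]

theorem summable_okTerm (x : ℝ) {a : ℝ} (ha : |a - 1 / 2| ≤ 1 / 8) :
    Summable fun n => a ^ (n - lCount x n) * (1 - 2 * a) ^ lCount x n * qDig a (tDigit x n) := by
  refine Summable.of_norm_bounded summable_five_eighths fun n => ?_
  have h := norm_okTermC_le x n (z := (a : ℂ)) (by rwa [norm_ofReal_sub_half])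
  rwa [ofReal_okTerm, Complex.norm_real] at h

theorem iteratedDeriv_okamoto (x : ℝ) (k : ℕ) :
    ∀ a : ℝ, |a - 1 / 2| < 1 / 8 →
      iteratedDeriv k (fun b => Okamoto b x) a = (iteratedDeriv k (okC x) (a : ℂ)).re := by
  have hop : AnalyticOnNhd ℂ (okC x) (Metric.ball (1 / 2 : ℂ) (1 / 8)) :=
    (differentiableOn_okC x).analyticOnNhd Metric.isOpen_ball
  induction k with
  | zero =>
    intro a _
    simp only [iteratedDeriv_zero, okC_ofReal, Complex.ofReal_re]
  | succ k ih =>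
    intro a ha
    have hmem : (a : ℂ) ∈ Metric.ball (1 / 2 : ℂ) (1 / 8) := by
      rw [Metric.mem_ball, dist_eq_norm, norm_ofReal_sub_half]; exact ha
    rw [iteratedDeriv_succ, iteratedDeriv_succ]
    have hev : iteratedDeriv k (fun b => Okamoto b x) =ᶠ[𝓝 a]
        fun b : ℝ => (iteratedDeriv k (okC x) (b : ℂ)).re := by
      have : ∀ᶠ b in 𝓝 a, |b - 1 / 2| < 1 / 8 :=
        (continuous_abs.comp (continuous_id.sub continuous_const)).continuousAt.eventually_lt
          continuousAt_const ha
      filter_upwards [this] with b hb using ih b hb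
    rw [hev.deriv_eq]
    have hd : DifferentiableAt ℂ (iteratedDeriv k (okC x)) (a : ℂ) := by
      rw [iteratedDeriv_eq_iterate]
      exact (hop.iterated_deriv k _ hmem).differentiableAt
    exact (hd.hasDerivAt.real_of_complex).deriv

theorem analyticAt_okamoto (x : ℝ) : AnalyticAt ℝ (fun b => Okamoto b x) (1 / 2) := by
  have hop : AnalyticAt ℂ (okC x) ((1 / 2 : ℝ) : ℂ) := by
    refine (differentiableOn_okC x).analyticAt (Metric.isOpen_ball.mem_nhds ?_)
    simp
  have := hop.re_ofReal
  refine this.congr (Eventually.of_forall fun b => ?_)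
  simp [okC_ofReal]

/-- Uniform bound for the partial derivatives of Okamoto's function at `a = 1/2`. -/
theorem exists_abs_Mfun_le (k : ℕ) : ∃ A, 0 ≤ A ∧ ∀ x, |Mfun k (1 / 2) x| ≤ A := by
  refine ⟨k.factorial * (8 / 3) / (1 / 16) ^ k, by positivity, fun x => ?_⟩
  unfold Mfun
  rw [iteratedDeriv_okamoto x k _ (by norm_num)]
  refine (Complex.abs_re_le_norm _).trans ?_
  refine Complex.norm_iteratedDeriv_le_of_forall_mem_sphere_norm_le k (by norm_num) ?_ ?_
  · refine DifferentiableOn.diffContOnCl_ball (U := Metric.ball (1 / 2 : ℂ) (1 / 8))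
      (differentiableOn_okC x) ?_
    intro z hz
    simp only [Metric.mem_closedBall, Metric.mem_ball] at hz ⊢
    norm_num at hz ⊢
    linarith
  · intro z hz
    refine norm_okC_le x ?_
    rw [mem_sphere_iff_norm] at hz
    norm_num at hz ⊢
    linarith

theorem tDigit_branch_zero {x : ℝ} (h0 : 0 ≤ x) (h1 : x < 1) {d : ℕ} (hd : d < 3) :
    tDigit ((d + x) / 3) 0 = d := by
  have hd' : (d : ℝ) ≤ 2 := by exact_mod_cast Nat.le_of_lt_succ hd
  have hd0 : (0 : ℝ) ≤ d := by positivity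
  unfold tDigit
  rw [if_neg (by intro h; linarith)]
  have e1 : ⌊(3 : ℝ) ^ (0 + 1) * ((d + x) / 3)⌋ = d := by
    rw [Int.floor_eq_iff]; push_cast; constructor <;> linarith
  have e2 : ⌊(3 : ℝ) ^ 0 * ((d + x) / 3)⌋ = 0 := by
    rw [Int.floor_eq_iff]; push_cast; constructor <;> linarith
  rw [e1, e2]; simp

theorem tDigit_branch_succ {x : ℝ} (h1 : x < 1) {d : ℕ} (hd : d < 3) (n : ℕ) :
    tDigit ((d + x) / 3) (n + 1) = tDigit x n := by
  have hd' : (d : ℝ) ≤ 2 := by exact_mod_cast Nat.le_of_lt_succ hd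
  unfold tDigit
  rw [if_neg (by intro h; linarith), if_neg h1.ne]
  have key : ∀ m : ℕ, ⌊(3 : ℝ) ^ (m + 1) * ((d + x) / 3)⌋ = ⌊(3 : ℝ) ^ m * x⌋ + 3 ^ m * d := by
    intro m
    have : (3 : ℝ) ^ (m + 1) * ((d + x) / 3) = 3 ^ m * x + ((3 ^ m * d : ℤ) : ℝ) := by
      push_cast; ring
    rw [this, Int.floor_add_intCast]
  rw [key, key]
  congr 1
  ring

theorem lCount_branch {x : ℝ} (h0 : 0 ≤ x) (h1 : x < 1) {d : ℕ} (hd : d < 3) (n : ℕ) :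
    lCount ((d + x) / 3) (n + 1) = lCount x n + if d = 1 then 1 else 0 := by
  induction n with
  | zero => simp [lCount_succ, tDigit_branch_zero h0 h1 hd]
  | succ n ih =>
    rw [lCount_succ, ih, lCount_succ x n, tDigit_branch_succ h1 hd]
    omega

theorem Okamoto_branch {x a : ℝ} (h0 : 0 ≤ x) (h1 : x < 1) {d : ℕ} (hd : d < 3)
    (ha : |a - 1 / 2| ≤ 1 / 8) :
    Okamoto a ((d + x) / 3) = qDig a d + (if d = 1 then 1 - 2 * a else a) * Okamoto a x := by
  unfold Okamoto
  rw [(summable_okTerm _ ha).tsum_eq_zero_add, ← tsum_mul_left]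
  congr 1
  · simp [tDigit_branch_zero h0 h1 hd]
  · refine tsum_congr fun n => ?_
    rw [lCount_branch h0 h1 hd, tDigit_branch_succ h1 hd]
    have hl := lCount_le x n
    split_ifs with h
    · rw [Nat.add_sub_add_right]; ring
    · rw [add_zero, Nat.sub_add_comm hl]; ring

theorem tDigit_one (n : ℕ) : tDigit 1 n = 2 := by simp [tDigit]

theorem tDigit_zero (n : ℕ) : tDigit 0 n = 0 := by simp [tDigit]

theorem Okamoto_zero (a : ℝ) : Okamoto a 0 = 0 := by
  simp [Okamoto, tDigit_zero, qDig]

theorem Okamoto_one {a : ℝ} (ha : |a - 1 / 2| ≤ 1 / 8) : Okamoto a 1 = 1 := by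
  have hl : ∀ n, lCount 1 n = 0 := fun n => by simp [lCount, tDigit_one]
  have := abs_le.1 ha
  simp only [Okamoto, tDigit_one, qDig, hl, Nat.sub_zero, pow_zero, mul_one]
  norm_num
  rw [tsum_mul_right, tsum_geometric_of_lt_one (by linarith) (by linarith)]
  have : 1 - a ≠ 0 := by linarith
  field_simp

open PowerSeries in
/-- The Taylor series at `1/2`. -/
noncomputable def taylorHalf (f : ℝ → ℝ) : PowerSeries ℝ :=
  PowerSeries.mk fun n => iteratedDeriv n f (1 / 2) / n.factorial

theorem taylorHalf_congr {f g : ℝ → ℝ} (h : f =ᶠ[𝓝 (1 / 2)] g) : taylorHalf f = taylorHalf g := by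
  ext n
  simp only [taylorHalf, PowerSeries.coeff_mk, h.iteratedDeriv_eq n]

theorem taylorHalf_add {f g : ℝ → ℝ} (hf : AnalyticAt ℝ f (1 / 2)) (hg : AnalyticAt ℝ g (1 / 2)) :
    taylorHalf (fun b => f b + g b) = taylorHalf f + taylorHalf g := by
  ext n
  simp only [taylorHalf, PowerSeries.coeff_mk, map_add]
  rw [iteratedDeriv_fun_add hf.contDiffAt hg.contDiffAt]
  ring

theorem taylorHalf_mul {f g : ℝ → ℝ} (hf : AnalyticAt ℝ f (1 / 2)) (hg : AnalyticAt ℝ g (1 / 2)) :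
    taylorHalf (fun b => f b * g b) = taylorHalf f * taylorHalf g := by
  ext n
  rw [PowerSeries.coeff_mul, Finset.Nat.sum_antidiagonal_eq_sum_range_succ_mk]
  simp only [taylorHalf, PowerSeries.coeff_mk]
  rw [iteratedDeriv_fun_mul hf.contDiffAt hg.contDiffAt, Finset.sum_div]
  refine Finset.sum_congr rfl fun i hi => ?_
  have hi' : i ≤ n := Nat.lt_succ_iff.1 (Finset.mem_range.1 hi)
  rw [Nat.cast_choose ℝ hi']
  have h1 : (n.factorial : ℝ) ≠ 0 := by positivity
  field_simp

theorem taylorHalf_const (c : ℝ) : taylorHalf (fun _ => c) = PowerSeries.C c := by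
  ext n
  simp only [taylorHalf, PowerSeries.coeff_mk, PowerSeries.coeff_C, iteratedDeriv_const]
  split_ifs with h <;> simp [h]

theorem taylorHalf_id : taylorHalf (fun b => b) = PowerSeries.C (1 / 2) + PowerSeries.X := by
  ext n
  simp only [taylorHalf, PowerSeries.coeff_mk, map_add, PowerSeries.coeff_C, PowerSeries.coeff_X]
  match n with
  | 0 => simp
  | 1 => simp [iteratedDeriv_one]
  | n + 2 =>
    rw [iteratedDeriv_succ', iteratedDeriv_succ']
    simp

/-- The series of the partial derivatives of `F_a(x)` at `a = 1/2`. -/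
noncomputable def phi (x : ℝ) : PowerSeries ℝ := taylorHalf fun b => Okamoto b x

theorem coeff_phi (k : ℕ) (x : ℝ) :
    PowerSeries.coeff k (phi x) = Mfun k (1 / 2) x / k.factorial := by
  simp [phi, taylorHalf, Mfun]

/-- The Taylor series of `a` at `1/2`. -/
noncomputable def wa : PowerSeries ℝ := PowerSeries.C (1 / 2) + PowerSeries.X

/-- The Taylor series of `1 - 2a` at `1/2`. -/
noncomputable def wb : PowerSeries ℝ := PowerSeries.C (-2) * PowerSeries.X

theorem eventually_near_half : ∀ᶠ b : ℝ in 𝓝 (1 / 2), |b - 1 / 2| ≤ 1 / 8 := by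
  have := Metric.closedBall_mem_nhds (1 / 2 : ℝ) (ε := 1 / 8) (by norm_num)
  filter_upwards [this] with b hb
  rwa [Metric.mem_closedBall, Real.dist_eq] at hb

theorem phi_zero : phi 0 = 0 := by
  have : (fun b => Okamoto b 0) = fun _ => (0 : ℝ) := funext Okamoto_zero
  rw [phi, this, taylorHalf_const]; simp

theorem phi_one : phi 1 = 1 := by
  have : (fun b => Okamoto b 1) =ᶠ[𝓝 (1 / 2)] fun _ => (1 : ℝ) := by
    filter_upwards [eventually_near_half] with b hb using Okamoto_one hb
  rw [phi, taylorHalf_congr this, taylorHalf_const]; simp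

theorem taylorHalf_one_sub_two_mul : taylorHalf (fun b => 1 - 2 * b) = wb := by
  have : (fun b : ℝ => 1 - 2 * b) = fun b => (1 : ℝ) + (-2) * b := by ext; ring
  rw [this, taylorHalf_add (by fun_prop) (by fun_prop), taylorHalf_mul (by fun_prop) (by fun_prop),
    taylorHalf_const, taylorHalf_const, taylorHalf_id, wb, mul_add, ← map_mul, ← add_assoc,
    ← map_add]
  norm_num

theorem taylorHalf_one_sub : taylorHalf (fun b => 1 - b) = wa + wb := by
  have : (fun b : ℝ => 1 - b) = fun b => b + (1 - 2 * b) := by ext; ring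
  rw [this, taylorHalf_add (by fun_prop) (by fun_prop), taylorHalf_one_sub_two_mul,
    taylorHalf_id, wa]

/-- The Taylor series of `q_a(d)` at `1/2`. -/
noncomputable def qSer (d : ℕ) : PowerSeries ℝ := if d = 0 then 0 else if d = 1 then wa else wa + wb

theorem taylorHalf_qDig (d : ℕ) : taylorHalf (fun b => qDig b d) = qSer d := by
  unfold qDig qSer
  split_ifs
  · rw [taylorHalf_const]; simp
  · exact taylorHalf_id
  · exact taylorHalf_one_sub

theorem analyticAt_qDig (d : ℕ) : AnalyticAt ℝ (fun b => qDig b d) (1 / 2) := by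
  unfold qDig
  split_ifs <;> fun_prop

theorem wa_add_wa_add_wb : wa + (wa + wb) = 1 := by
  unfold wa wb
  ext n
  simp [PowerSeries.coeff_X, PowerSeries.coeff_C, PowerSeries.coeff_one]
  split_ifs <;> first | omega | norm_num

theorem phi_branch_aux {x : ℝ} (h0 : 0 ≤ x) (h1 : x < 1) {d : ℕ} (hd : d < 3) :
    phi ((d + x) / 3) = qSer d + (if d = 1 then wb else wa) * phi x := by
  have hev : (fun b => Okamoto b ((d + x) / 3)) =ᶠ[𝓝 (1 / 2)]
      fun b => qDig b d + (if d = 1 then 1 - 2 * b else b) * Okamoto b x := by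
    filter_upwards [eventually_near_half] with b hb using Okamoto_branch h0 h1 hd hb
  have hw : AnalyticAt ℝ (fun b : ℝ => if d = 1 then 1 - 2 * b else b) (1 / 2) := by
    split_ifs <;> fun_prop
  unfold phi
  rw [taylorHalf_congr hev, taylorHalf_add (analyticAt_qDig d)
    (hw.fun_mul (analyticAt_okamoto x)), taylorHalf_mul hw (analyticAt_okamoto x), taylorHalf_qDig]
  congr 2
  split_ifs
  · exact taylorHalf_one_sub_two_mul
  · exact taylorHalf_id

/-- The functional equation of `phi`. -/
theorem phi_branch {x : ℝ} (h0 : 0 ≤ x) (h1 : x ≤ 1) {d : ℕ} (hd : d < 3) :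
    phi ((d + x) / 3) = qSer d + (if d = 1 then wb else wa) * phi x := by
  rcases h1.lt_or_eq with h | rfl
  · exact phi_branch_aux h0 h hd
  have e : ∀ d' : ℕ, d' < 3 → phi (d' / 3) = qSer d' := fun d' hd' => by
    have := phi_branch_aux le_rfl one_pos hd'
    simpa [phi_zero] using this
  have hs := wa_add_wa_add_wb
  rw [phi_one]
  interval_cases d
  · have := e 1 (by norm_num)
    norm_num at this ⊢
    rw [this]; simp [qSer]
  · have := e 2 (by norm_num)
    norm_num at this ⊢
    rw [this]; simp [qSer]
  · norm_num
    rw [phi_one]; simp [qSer]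
    rw [← hs]; ring

theorem phi_branch_left {x : ℝ} (h0 : 0 ≤ x) (h1 : x ≤ 1) : phi (x / 3) = wa * phi x := by
  simpa [qSer] using phi_branch h0 h1 (d := 0) (by norm_num)

theorem phi_branch_mid {x : ℝ} (h0 : 0 ≤ x) (h1 : x ≤ 1) :
    phi ((1 + x) / 3) = wa + wb * phi x := by
  simpa [qSer] using phi_branch h0 h1 (d := 1) (by norm_num)

theorem phi_branch_right {x : ℝ} (h0 : 0 ≤ x) (h1 : x ≤ 1) :
    phi ((2 + x) / 3) = wa + wb + wa * phi x := by
  simpa [qSer] using phi_branch h0 h1 (d := 2) (by norm_num)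

theorem coeff_wa_mul_zero (U : PowerSeries ℝ) :
    PowerSeries.coeff 0 (wa * U) = PowerSeries.coeff 0 U / 2 := by
  simp [wa]; ring

theorem coeff_wa_mul_succ (n : ℕ) (U : PowerSeries ℝ) :
    PowerSeries.coeff (n + 1) (wa * U) =
      PowerSeries.coeff (n + 1) U / 2 + PowerSeries.coeff n U := by
  simp only [wa, add_mul, map_add, PowerSeries.coeff_C_mul, PowerSeries.coeff_succ_X_mul]
  ring

theorem coeff_wb_mul_zero (U : PowerSeries ℝ) : PowerSeries.coeff 0 (wb * U) = 0 := by
  simp [wb]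

theorem coeff_wb_mul_succ (n : ℕ) (U : PowerSeries ℝ) :
    PowerSeries.coeff (n + 1) (wb * U) = -2 * PowerSeries.coeff n U := by
  simp only [wb, mul_assoc, PowerSeries.coeff_C_mul, PowerSeries.coeff_succ_X_mul]

theorem exists_abs_coeff_phi_le (k : ℕ) :
    ∃ A, 0 ≤ A ∧ ∀ i ≤ k, ∀ x, |PowerSeries.coeff i (phi x)| ≤ A := by
  choose A hA0 hA using exists_abs_Mfun_le
  refine ⟨∑ i ∈ Finset.range (k + 1), A i, Finset.sum_nonneg fun i _ => hA0 i, fun i hi x => ?_⟩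
  rw [coeff_phi, abs_div]
  calc |Mfun i (1 / 2) x| / |(i.factorial : ℝ)| ≤ |Mfun i (1 / 2) x| / 1 := by
        gcongr
        rw [Nat.abs_cast]; exact_mod_cast Nat.one_le_iff_ne_zero.2 (Nat.factorial_ne_zero i)
    _ ≤ A i := by rw [div_one]; exact hA i x
    _ ≤ _ := Finset.single_le_sum (f := A) (fun i _ => hA0 i) (Finset.mem_range.2 (by omega))

/-- Every point of `[0,1]` lies in one of the three branches. -/
theorem exists_branch {x : ℝ} (h0 : 0 ≤ x) (h1 : x ≤ 1) :
    ∃ y, 0 ≤ y ∧ y ≤ 1 ∧ (x = y / 3 ∨ x = (1 + y) / 3 ∨ x = (2 + y) / 3) := by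
  rcases le_total x (1 / 3) with h | h
  · exact ⟨3 * x, by linarith, by linarith, Or.inl (by ring)⟩
  rcases le_total x (2 / 3) with h' | h'
  · exact ⟨3 * x - 1, by linarith, by linarith, Or.inr (Or.inl (by ring))⟩
  · exact ⟨3 * x - 2, by linarith, by linarith, Or.inr (Or.inr (by ring))⟩

theorem le_zero_of_le_div_two_pow {t A : ℝ} (h : ∀ n : ℕ, t ≤ A / 2 ^ n) : t ≤ 0 := by
  have hl : Tendsto (fun n : ℕ => A / 2 ^ n) atTop (𝓝 0) :=
    tendsto_const_nhds.div_atTop (tendsto_pow_atTop_atTop_of_one_lt one_lt_two)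
  exact ge_of_tendsto' hl h

/-- A bounded solution of the homogeneous functional equation vanishes. -/
theorem eq_zero_of_branch {E : ℝ → PowerSeries ℝ}
    (hb : ∀ k, ∃ A, ∀ x, |PowerSeries.coeff k (E x)| ≤ A)
    (hl : ∀ x, 0 ≤ x → x ≤ 1 → E (x / 3) = wa * E x)
    (hm : ∀ x, 0 ≤ x → x ≤ 1 → E ((1 + x) / 3) = wb * E x)
    (hr : ∀ x, 0 ≤ x → x ≤ 1 → E ((2 + x) / 3) = wa * E x) :
    ∀ x, 0 ≤ x → x ≤ 1 → E x = 0 := by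
  have key : ∀ k, ∀ x, 0 ≤ x → x ≤ 1 → PowerSeries.coeff k (E x) = 0 := by
    intro k
    induction k with
    | zero =>
      obtain ⟨A, hA⟩ := hb 0
      have h : ∀ n : ℕ, ∀ x, 0 ≤ x → x ≤ 1 → |PowerSeries.coeff 0 (E x)| ≤ A / 2 ^ n := by
        intro n
        induction n with
        | zero => intro x _ _; simpa using hA x
        | succ n ih =>
          intro x h0 h1
          have hA0 : 0 ≤ A := (abs_nonneg _).trans (hA 0)
          obtain ⟨y, hy0, hy1, rfl | rfl | rfl⟩ := exists_branch h0 h1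
          · rw [hl y hy0 hy1, coeff_wa_mul_zero, abs_div, abs_two, pow_succ, ← div_div]
            exact div_le_div_of_nonneg_right (ih y hy0 hy1) zero_le_two
          · rw [hm y hy0 hy1, coeff_wb_mul_zero, abs_zero]; positivity
          · rw [hr y hy0 hy1, coeff_wa_mul_zero, abs_div, abs_two, pow_succ, ← div_div]
            exact div_le_div_of_nonneg_right (ih y hy0 hy1) zero_le_two
      intro x h0 h1
      exact abs_nonpos_iff.1 (le_zero_of_le_div_two_pow fun n => h n x h0 h1)
    | succ k ihk =>
      obtain ⟨A, hA⟩ := hb (k + 1)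
      have h : ∀ n : ℕ, ∀ x, 0 ≤ x → x ≤ 1 → |PowerSeries.coeff (k + 1) (E x)| ≤ A / 2 ^ n := by
        intro n
        induction n with
        | zero => intro x _ _; simpa using hA x
        | succ n ih =>
          intro x h0 h1
          have hA0 : 0 ≤ A := (abs_nonneg _).trans (hA 0)
          obtain ⟨y, hy0, hy1, rfl | rfl | rfl⟩ := exists_branch h0 h1
          · rw [hl y hy0 hy1, coeff_wa_mul_succ, ihk y hy0 hy1, add_zero, abs_div, abs_two,
              pow_succ, ← div_div]
            exact div_le_div_of_nonneg_right (ih y hy0 hy1) zero_le_two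
          · rw [hm y hy0 hy1, coeff_wb_mul_succ, ihk y hy0 hy1, mul_zero, abs_zero]; positivity
          · rw [hr y hy0 hy1, coeff_wa_mul_succ, ihk y hy0 hy1, add_zero, abs_div, abs_two,
              pow_succ, ← div_div]
            exact div_le_div_of_nonneg_right (ih y hy0 hy1) zero_le_two
      intro x h0 h1
      exact abs_nonpos_iff.1 (le_zero_of_le_div_two_pow fun n => h n x h0 h1)
  intro x h0 h1
  ext k
  simpa using key k x h0 h1

theorem phi_one_sub {x : ℝ} (h0 : 0 ≤ x) (h1 : x ≤ 1) : phi (1 - x) = 1 - phi x := by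
  have hs := wa_add_wa_add_wb
  have key := eq_zero_of_branch (E := fun x => phi (1 - x) + phi x - 1) ?_ ?_ ?_ ?_ x h0 h1
  · linear_combination key
  · intro k
    obtain ⟨A, hA0, hA⟩ := exists_abs_coeff_phi_le k
    refine ⟨A + A + 1, fun x => ?_⟩
    have e1 := abs_le.1 (hA k le_rfl x)
    have e2 := abs_le.1 (hA k le_rfl (1 - x))
    rw [map_sub, map_add, PowerSeries.coeff_one, abs_le]
    split_ifs <;> constructor <;> linarith
  · intro x h0 h1
    have e : 1 - x / 3 = (2 + (1 - x)) / 3 := by ring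
    simp only [e]
    rw [phi_branch_right (by linarith) (by linarith), phi_branch_left h0 h1]
    linear_combination hs
  · intro x h0 h1
    have e : 1 - (1 + x) / 3 = (1 + (1 - x)) / 3 := by ring
    simp only [e]
    rw [phi_branch_mid (by linarith) (by linarith), phi_branch_mid h0 h1]
    linear_combination hs
  · intro x h0 h1
    have e : 1 - (2 + x) / 3 = (1 - x) / 3 := by ring
    simp only [e]
    rw [phi_branch_left (by linarith) (by linarith), phi_branch_right h0 h1]
    linear_combination hs

theorem coeff_zero_phi_nonneg {x : ℝ} (h0 : 0 ≤ x) (h1 : x ≤ 1) :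
    0 ≤ PowerSeries.coeff 0 (phi x) := by
  obtain ⟨A, hA0, hA⟩ := exists_abs_coeff_phi_le 0
  have hwa : PowerSeries.coeff 0 wa = 1 / 2 := by simp [wa]
  have hwb : PowerSeries.coeff 0 wb = 0 := by simp [wb]
  have h : ∀ n : ℕ, ∀ x, 0 ≤ x → x ≤ 1 → -PowerSeries.coeff 0 (phi x) ≤ A / 2 ^ n := by
    intro n
    induction n with
    | zero =>
      intro x _ _
      have := abs_le.1 (hA 0 le_rfl x)
      simp only [pow_zero, div_one]; linarith
    | succ n ih =>
      intro x h0 h1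
      have e : A / 2 ^ (n + 1) = A / 2 ^ n / 2 := by rw [pow_succ, div_div]
      have hp : 0 ≤ A / 2 ^ n := by positivity
      obtain ⟨y, hy0, hy1, rfl | rfl | rfl⟩ := exists_branch h0 h1
      · have := ih y hy0 hy1
        rw [phi_branch_left hy0 hy1, coeff_wa_mul_zero]; linarith
      · rw [phi_branch_mid hy0 hy1, map_add, coeff_wb_mul_zero, hwa]; linarith
      · have := ih y hy0 hy1
        rw [phi_branch_right hy0 hy1, map_add, map_add, coeff_wa_mul_zero, hwa, hwb]; linarith
  have := le_zero_of_le_div_two_pow fun n => h n x h0 h1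
  linarith

theorem coeff_zero_phi_le_one {x : ℝ} (h0 : 0 ≤ x) (h1 : x ≤ 1) :
    PowerSeries.coeff 0 (phi x) ≤ 1 := by
  have h := coeff_zero_phi_nonneg (x := 1 - x) (by linarith) (by linarith)
  rw [phi_one_sub h0 h1, map_sub, PowerSeries.coeff_one, if_pos rfl] at h
  linarith

theorem two_pow_mul_coeff_wa_pow (M i : ℕ) :
    2 ^ M * PowerSeries.coeff i (wa ^ M) = M.choose i * 2 ^ i := by
  induction M generalizing i with
  | zero => cases i <;> simp [PowerSeries.coeff_one]
  | succ M ih =>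
    rw [pow_succ' wa]
    cases i with
    | zero =>
      have := ih 0
      rw [coeff_wa_mul_zero]
      simp only [Nat.choose_zero_right, Nat.cast_one, pow_zero, mul_one] at this ⊢
      rw [pow_succ]; linarith
    | succ i =>
      rw [coeff_wa_mul_succ, Nat.choose_succ_succ]
      push_cast
      have h1 := ih i
      have h2 := ih (i + 1)
      rw [pow_succ, pow_succ 2 i]
      rw [pow_succ 2 i] at h2
      linear_combination 2 * h1 + h2

theorem two_pow_mul_coeff_wa_pow_mul (M j : ℕ) (U : PowerSeries ℝ) :
    2 ^ M * PowerSeries.coeff j (wa ^ M * U) =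
      ∑ p ∈ Finset.HasAntidiagonal.antidiagonal j, M.choose p.1 * 2 ^ p.1 * PowerSeries.coeff p.2 U := by
  rw [PowerSeries.coeff_mul, Finset.mul_sum]
  refine Finset.sum_congr rfl fun p _ => ?_
  rw [← mul_assoc, two_pow_mul_coeff_wa_pow]

theorem abs_sum_choose_mul_le {M j : ℕ} (hM : 1 ≤ M) {u : ℕ → ℝ} {A : ℝ}
    (hu : ∀ i ≤ j, |u i| ≤ A) :
    |∑ p ∈ Finset.HasAntidiagonal.antidiagonal j, M.choose p.1 * 2 ^ p.1 * u p.2| ≤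
      (j + 1) * 2 ^ j * A * M ^ j := by
  have hM' : (1 : ℝ) ≤ M := by exact_mod_cast hM
  have hA : 0 ≤ A := (abs_nonneg _).trans (hu 0 (Nat.zero_le _))
  refine (Finset.abs_sum_le_sum_abs _ _).trans ?_
  have : ∀ p ∈ Finset.HasAntidiagonal.antidiagonal j,
      |(M.choose p.1 * 2 ^ p.1 * u p.2 : ℝ)| ≤ 2 ^ j * A * M ^ j := by
    intro p hp
    have hp' := Finset.HasAntidiagonal.mem_antidiagonal.1 hp
    rw [abs_mul, abs_of_nonneg (by positivity)]
    have h1 : (M.choose p.1 : ℝ) ≤ M ^ j := by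
      calc (M.choose p.1 : ℝ) ≤ M ^ p.1 := by exact_mod_cast Nat.choose_le_pow M p.1
        _ ≤ M ^ j := pow_le_pow_right₀ hM' (by omega)
    have h2 : (2 : ℝ) ^ p.1 ≤ 2 ^ j := pow_le_pow_right₀ one_le_two (by omega)
    calc (M.choose p.1 * 2 ^ p.1 * |u p.2| : ℝ) ≤ M ^ j * 2 ^ j * A := by
          gcongr; exact hu _ (by omega)
      _ = _ := by ring
  refine (Finset.sum_le_card_nsmul _ _ _ this).trans_eq ?_
  rw [Finset.Nat.card_antidiagonal, nsmul_eq_mul]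
  push_cast; ring

theorem abs_coeff_wa_pow_mul_le {M j : ℕ} (hM : 1 ≤ M) {U : PowerSeries ℝ} {A : ℝ}
    (hU : ∀ i ≤ j, |PowerSeries.coeff i U| ≤ A) :
    |2 ^ M * PowerSeries.coeff j (wa ^ M * U)| ≤ (j + 1) * 2 ^ j * A * M ^ j := by
  rw [two_pow_mul_coeff_wa_pow_mul]
  exact abs_sum_choose_mul_le hM (u := fun i => PowerSeries.coeff i U) hU

theorem le_coeff_wa_pow_mul {M j : ℕ} (hM : 1 ≤ M) {U : PowerSeries ℝ} {A : ℝ}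
    (hU : ∀ i ≤ j + 1, |PowerSeries.coeff i U| ≤ A) :
    2 ^ (j + 1) * M.choose (j + 1) * PowerSeries.coeff 0 U - (j + 1) * 2 ^ j * A * M ^ j ≤
      2 ^ M * PowerSeries.coeff (j + 1) (wa ^ M * U) := by
  rw [two_pow_mul_coeff_wa_pow_mul, Finset.Nat.sum_antidiagonal_succ']
  have := abs_sum_choose_mul_le (j := j) hM (u := fun i => PowerSeries.coeff (i + 1) U)
    (fun i hi => hU (i + 1) (by omega))
  have := (abs_le.1 this).1
  simp only at this ⊢
  linarith

theorem half_pow_div_factorial_le_choose {n j : ℕ} (h : 2 * j ≤ n) :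
    ((n : ℝ) / 2) ^ j / j.factorial ≤ n.choose j := by
  refine le_trans ?_ (Nat.pow_le_choose (α := ℝ) j n)
  have : (n : ℝ) / 2 ≤ (n + 1 - j : ℕ) := by
    rw [Nat.cast_sub (by omega)]
    have : (2 * j : ℝ) ≤ n := by exact_mod_cast h
    push_cast; linarith
  gcongr

theorem tendsto_choose_sub (j R : ℕ) {c : ℝ} (hc : 0 < c) (K B : ℝ) (hK : 0 ≤ K) :
    ∀ᶠ n : ℕ in atTop, B ≤ c * n.choose (j + 1) - K * (n + R) ^ j := by
  have hlin : Tendsto (fun n : ℕ => c / (2 ^ (j + 1) * (j + 1).factorial) * (n : ℝ) - K * 2 ^ j)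
      atTop atTop :=
    tendsto_atTop_add_const_right _ _
      (Tendsto.const_mul_atTop (by positivity) tendsto_natCast_atTop_atTop)
  filter_upwards [hlin.eventually_ge_atTop (max B 0), eventually_ge_atTop (2 * (j + 1)),
    eventually_ge_atTop R, eventually_ge_atTop 1] with n h1 h2 h3 h4
  have h4' : (1 : ℝ) ≤ n := by exact_mod_cast h4
  have h3' : (R : ℝ) ≤ n := by exact_mod_cast h3
  have hb := half_pow_div_factorial_le_choose h2
  have hx0 := (le_max_right B 0).trans h1
  calc B ≤ c / (2 ^ (j + 1) * (j + 1).factorial) * (n : ℝ) - K * 2 ^ j :=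
        (le_max_left _ _).trans h1
    _ ≤ (n : ℝ) ^ j * (c / (2 ^ (j + 1) * (j + 1).factorial) * (n : ℝ) - K * 2 ^ j) :=
        le_mul_of_one_le_left hx0 (one_le_pow₀ h4')
    _ = c * (((n : ℝ) / 2) ^ (j + 1) / (j + 1).factorial) - K * (2 * n) ^ j := by
        rw [div_pow, mul_pow, pow_succ (n : ℝ)]; field_simp
    _ ≤ c * n.choose (j + 1) - K * (n + R) ^ j := by
        gcongr
        linarith

/-- The growth property making the `j`-th coefficient of the slope tend to `+∞`, provided that the
run at level `n` has length at most `ρ n`. -/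
def SlopeGrows (j : ℕ) (ρ : ℕ → ℕ) : Prop :=
  ∀ A B : ℝ, ∀ᶠ n in atTop, ∀ r ≤ ρ n, ∀ ψ τ : PowerSeries ℝ,
    (∀ i ≤ j, |PowerSeries.coeff i ψ| ≤ A) → (∀ i ≤ j, |PowerSeries.coeff i τ| ≤ A) →
    1 / 2 ≤ PowerSeries.coeff 0 ψ → 0 ≤ PowerSeries.coeff 0 τ →
    B ≤ 3 ^ n * PowerSeries.coeff j (wa ^ n * (wa ^ (r + 1) * ψ + τ))

theorem slopeGrows_succ (j R : ℕ) : SlopeGrows (j + 1) fun _ => R := by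
  intro A B
  rcases lt_or_ge A 0 with hA | hA
  · refine Eventually.of_forall fun n r _ ψ τ h => ?_
    exact absurd ((abs_nonneg _).trans (h 0 (Nat.zero_le _))) (not_le.2 hA)
  have hK : (0 : ℝ) ≤ 2 * ((j + 1) * 2 ^ j * A) := by positivity
  filter_upwards [tendsto_choose_sub j (R + 1) (c := 2 ^ j / 2 ^ (R + 1)) (by positivity) _
    (max B 0) hK, eventually_ge_atTop 1] with n hn hn1 r hr ψ τ hψ hτ hψ0 hτ0
  have hr' : (r : ℝ) ≤ R := by exact_mod_cast hr
  have e1 := le_coeff_wa_pow_mul (M := n + (r + 1)) (by omega) hψ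
  have e2 := le_coeff_wa_pow_mul hn1 hτ
  have e3 : wa ^ n * (wa ^ (r + 1) * ψ + τ) = wa ^ (n + (r + 1)) * ψ + wa ^ n * τ := by ring
  rw [e3, map_add]
  set a := PowerSeries.coeff (j + 1) (wa ^ (n + (r + 1)) * ψ)
  set b := PowerSeries.coeff (j + 1) (wa ^ n * τ)
  have hch : (n.choose (j + 1) : ℝ) ≤ (n + (r + 1)).choose (j + 1) := by
    exact_mod_cast Nat.choose_le_choose _ (by omega)
  have f1 : 2 ^ j * (n.choose (j + 1) : ℝ) - (j + 1) * 2 ^ j * A * (n + (R + 1 : ℕ)) ^ j ≤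
      2 ^ (n + (r + 1)) * a := by
    refine le_trans ?_ e1
    have g1 : 2 ^ j * (n.choose (j + 1) : ℝ) ≤
        2 ^ (j + 1) * ((n + (r + 1)).choose (j + 1)) * PowerSeries.coeff 0 ψ := by
      calc 2 ^ j * (n.choose (j + 1) : ℝ) ≤ 2 ^ j * (n + (r + 1)).choose (j + 1) := by gcongr
        _ = 2 ^ (j + 1) * ((n + (r + 1)).choose (j + 1)) * (1 / 2) := by rw [pow_succ]; ring
        _ ≤ _ := by gcongr
    have g2 : (j + 1) * 2 ^ j * A * ((n + (r + 1) : ℕ) : ℝ) ^ j ≤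
        (j + 1) * 2 ^ j * A * (n + (R + 1 : ℕ)) ^ j := by
      push_cast; gcongr
    linarith
  have f2 : - ((j + 1) * 2 ^ j * A * (n + (R + 1 : ℕ)) ^ j) ≤ 2 ^ n * b := by
    refine le_trans ?_ e2
    have g1 : 0 ≤ 2 ^ (j + 1) * (n.choose (j + 1) : ℝ) * PowerSeries.coeff 0 τ := by positivity
    have g2 : (j + 1) * 2 ^ j * A * (n : ℝ) ^ j ≤
        (j + 1) * 2 ^ j * A * (n + (R + 1 : ℕ)) ^ j := by
      gcongr; linarith [(Nat.cast_nonneg (R + 1) : (0 : ℝ) ≤ ((R + 1 : ℕ) : ℝ))]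
    linarith
  have f3 : 2 ^ j / 2 ^ (R + 1) * (n.choose (j + 1) : ℝ) -
      (j + 1) * 2 ^ j * A * (n + (R + 1 : ℕ)) ^ j ≤ 2 ^ n * a := by
    have g0 : (2 : ℝ) ^ n * a = 2 ^ (n + (r + 1)) * a / 2 ^ (r + 1) := by
      rw [pow_add]; field_simp
    have hp : (0 : ℝ) ≤ (j + 1) * 2 ^ j * A * (n + (R + 1 : ℕ)) ^ j := by positivity
    have g1 : (2 : ℝ) ^ j / 2 ^ (R + 1) * (n.choose (j + 1) : ℝ) ≤
        2 ^ j / 2 ^ (r + 1) * (n.choose (j + 1) : ℝ) := by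
      gcongr; exact one_le_two
    have g2 : (j + 1) * 2 ^ j * A * (n + (R + 1 : ℕ)) ^ j / 2 ^ (r + 1) ≤
        (j + 1) * 2 ^ j * A * (n + (R + 1 : ℕ)) ^ j :=
      div_le_self hp (one_le_pow₀ one_le_two)
    rw [g0]
    have := div_le_div_of_nonneg_right f1 (c := (2 : ℝ) ^ (r + 1)) (by positivity)
    rw [sub_div] at this
    have g3 : (2 : ℝ) ^ j * (n.choose (j + 1) : ℝ) / 2 ^ (r + 1) =
      2 ^ j / 2 ^ (r + 1) * (n.choose (j + 1) : ℝ) := by ring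
    linarith
  have f4 : max B 0 ≤ 2 ^ n * (a + b) := by rw [mul_add]; linarith
  have f5 : 0 ≤ a + b := by
    have := (le_max_right B 0).trans f4
    exact nonneg_of_mul_nonneg_right this (by positivity)
  calc B ≤ 2 ^ n * (a + b) := (le_max_left _ _).trans f4
    _ ≤ 3 ^ n * (a + b) := by gcongr; norm_num

theorem slopeGrows_zero : SlopeGrows 0 fun n => n / 4 := by
  intro A B
  have hlin : Tendsto (fun n : ℕ => (1 / 4 : ℝ) * (3 / 2) ^ (n / 2)) atTop atTop := by
    refine Tendsto.const_mul_atTop (by norm_num) ?_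
    refine (tendsto_pow_atTop_atTop_of_one_lt (by norm_num)).comp ?_
    exact Nat.tendsto_div_const_atTop two_ne_zero
  filter_upwards [hlin.eventually_ge_atTop B] with n hn r hr ψ τ _ _ hψ0 hτ0
  refine hn.trans ?_
  have c0 : ∀ (M : ℕ) (U : PowerSeries ℝ), PowerSeries.coeff 0 (wa ^ M * U) =
      PowerSeries.coeff 0 U / 2 ^ M := by
    intro M U
    simp [wa]; ring
  rw [c0, map_add, c0]
  have h1 : (3 / 2 : ℝ) ^ (n / 2) * 2 ^ r ≤ (3 / 2) ^ n := by
    have e : n / 2 + 2 * r ≤ n := by omega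
    calc (3 / 2 : ℝ) ^ (n / 2) * 2 ^ r ≤ (3 / 2 : ℝ) ^ (n / 2) * ((3 / 2) ^ 2) ^ r := by
          gcongr; norm_num
      _ = (3 / 2 : ℝ) ^ (n / 2 + 2 * r) := by rw [pow_add, pow_mul]
      _ ≤ _ := pow_le_pow_right₀ (by norm_num) e
  have h2 : (1 / 4 : ℝ) / 2 ^ r ≤ PowerSeries.coeff 0 ψ / 2 ^ (r + 1) + PowerSeries.coeff 0 τ := by
    have : (1 / 4 : ℝ) / 2 ^ r = (1 / 2) / 2 ^ (r + 1) := by rw [pow_succ]; field_simp; norm_num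
    rw [this]
    have : (1 / 2 : ℝ) / 2 ^ (r + 1) ≤ PowerSeries.coeff 0 ψ / 2 ^ (r + 1) := by gcongr
    linarith
  calc (1 / 4 : ℝ) * (3 / 2) ^ (n / 2) = (1 / 4) / 2 ^ r * ((3 / 2) ^ (n / 2) * 2 ^ r) := by
        field_simp
    _ ≤ (1 / 4) / 2 ^ r * (3 / 2) ^ n := by gcongr
    _ ≤ (PowerSeries.coeff 0 ψ / 2 ^ (r + 1) + PowerSeries.coeff 0 τ) * (3 / 2) ^ n := by gcongr
    _ = _ := by rw [div_pow]; ring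

/-- A run of length about `log₂ M` makes the slope into the neighbouring gap negative. -/
theorem exists_coeff_gap_neg (j : ℕ) {A : ℝ} (hA : 0 ≤ A) :
    ∃ c : ℕ, ∀ M r : ℕ, 2 * j + 1 ≤ M → r + 1 ≤ M → 2 ^ c * M ≤ 2 ^ (r + 1) →
      ∀ ψ : PowerSeries ℝ, (∀ i ≤ j + 1, |PowerSeries.coeff i ψ| ≤ A) →
        PowerSeries.coeff (j + 1) (wa ^ M * (wb + wa ^ (r + 1) * ψ)) < 0 := by
  obtain ⟨c, hc⟩ := pow_unbounded_of_one_lt (j.factorial * ((j + 2) * 4 ^ (j + 1) * A)) one_lt_two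
  refine ⟨c, fun M r hM hr hcM ψ hψ => ?_⟩
  have hM' : (1 : ℝ) ≤ M := by exact_mod_cast (by omega : 1 ≤ M)
  have hr' : ((r + 1 : ℕ) : ℝ) ≤ M := by exact_mod_cast hr
  have hcM' : (2 : ℝ) ^ c * M ≤ 2 ^ (r + 1) := by exact_mod_cast hcM
  have e1 := abs_coeff_wa_pow_mul_le (M := M + (r + 1)) (by omega) hψ
  have e3 : wa ^ M * (wb + wa ^ (r + 1) * ψ) = wb * wa ^ M + wa ^ (M + (r + 1)) * ψ := by ring
  rw [e3, map_add, coeff_wb_mul_succ]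
  set b := PowerSeries.coeff (j + 1) (wa ^ (M + (r + 1)) * ψ)
  have e2 := two_pow_mul_coeff_wa_pow M j
  have e4 := half_pow_div_factorial_le_choose (n := M) (j := j) (by omega)
  have g1 : (M : ℝ) ^ j / j.factorial ≤ 2 ^ M * PowerSeries.coeff j (wa ^ M) := by
    rw [e2]
    calc (M : ℝ) ^ j / j.factorial = ((M : ℝ) / 2) ^ j / j.factorial * 2 ^ j := by
          rw [div_pow]; field_simp
      _ ≤ _ := by gcongr
  have g2 : 2 ^ M * b ≤ (j + 2) * 4 ^ (j + 1) * A * M ^ j / 2 ^ c := by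
    have h1 : 2 ^ (M + (r + 1)) * b ≤ (j + 2) * 2 ^ (j + 1) * A * (2 * M) ^ (j + 1) := by
      refine (le_abs_self _).trans (e1.trans ?_)
      have : ((M + (r + 1) : ℕ) : ℝ) ≤ 2 * M := by push_cast at hr' ⊢; linarith
      calc _ ≤ (((j + 1 : ℕ) : ℝ) + 1) * 2 ^ (j + 1) * A * (2 * M) ^ (j + 1) := by gcongr
        _ = _ := by push_cast; ring
    have h2 : 2 ^ M * b = 2 ^ (M + (r + 1)) * b / 2 ^ (r + 1) := by rw [pow_add]; field_simp
    rw [h2]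
    calc 2 ^ (M + (r + 1)) * b / 2 ^ (r + 1)
        ≤ (j + 2) * 2 ^ (j + 1) * A * (2 * M) ^ (j + 1) / 2 ^ (r + 1) := by gcongr
      _ ≤ (j + 2) * 2 ^ (j + 1) * A * (2 * M) ^ (j + 1) / (2 ^ c * M) := by gcongr
      _ = _ := by
        have : (4 : ℝ) = 2 * 2 := by norm_num
        rw [this, mul_pow, mul_pow, pow_succ (M : ℝ)]; field_simp
  have g3 : (j + 2) * 4 ^ (j + 1) * A * M ^ j / 2 ^ c < 2 * ((M : ℝ) ^ j / j.factorial) := by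
    have hp : (0 : ℝ) < M ^ j / j.factorial := by positivity
    calc (j + 2) * 4 ^ (j + 1) * A * M ^ j / 2 ^ c
        = (j.factorial * ((j + 2) * 4 ^ (j + 1) * A)) / 2 ^ c * (M ^ j / j.factorial) := by
          field_simp
      _ ≤ 1 * (M ^ j / j.factorial) := by
          gcongr
          rw [div_le_one (by positivity)]; exact hc.le
      _ < _ := by linarith
  have : 2 ^ M * (-2 * PowerSeries.coeff j (wa ^ M) + b) < 0 := by linarith
  exact neg_of_mul_neg_right this (by positivity)

/-- The sum `∑ d_n (b-1) b^{-(n+1)}`, with `d_n` read as `0` or `1`. -/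
noncomputable def bsum (b : ℝ) (d : ℕ → Bool) : ℝ :=
  ∑' n, (if d n then b - 1 else 0) / b ^ (n + 1)

/-- Partial sums of `bsum`. -/
noncomputable def bpre (b : ℝ) (d : ℕ → Bool) (n : ℕ) : ℝ :=
  ∑ i ∈ Finset.range n, (if d i then b - 1 else 0) / b ^ (i + 1)

theorem hasSum_geometric_sub_one {b : ℝ} (hb : 1 < b) :
    HasSum (fun n : ℕ => (b - 1) / b ^ (n + 1)) 1 := by
  have h := (hasSum_geometric_of_lt_one (r := b⁻¹) (by positivity) (inv_lt_one_of_one_lt₀ hb)).mul_left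
    ((b - 1) / b)
  have hb1 : b - 1 ≠ 0 := by linarith
  have hb0 : b ≠ 0 := by linarith
  have e1 : (fun n : ℕ => (b - 1) / b ^ (n + 1)) = fun n : ℕ => (b - 1) / b * b⁻¹ ^ n := by
    ext n
    rw [inv_pow, pow_succ]
    field_simp
  have e2 : (b - 1) / b * (1 - b⁻¹)⁻¹ = 1 := by
    have : 1 - b⁻¹ = (b - 1) / b := by field_simp
    rw [this]
    exact mul_inv_cancel₀ (div_ne_zero hb1 hb0)
  rw [e1]
  rwa [e2] at h

theorem bsum_term_nonneg {b : ℝ} (hb : 1 < b) (d : ℕ → Bool) (n : ℕ) :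
    0 ≤ (if d n then b - 1 else 0) / b ^ (n + 1) := by
  have : 0 ≤ b - 1 := by linarith
  split_ifs <;> positivity

theorem bsum_term_le {b : ℝ} (hb : 1 < b) (d : ℕ → Bool) (n : ℕ) :
    (if d n then b - 1 else 0) / b ^ (n + 1) ≤ (b - 1) / b ^ (n + 1) := by
  have : 0 ≤ b - 1 := by linarith
  gcongr
  split_ifs <;> linarith

theorem summable_bsum {b : ℝ} (hb : 1 < b) (d : ℕ → Bool) :
    Summable fun n => (if d n then b - 1 else 0) / b ^ (n + 1) :=
  Summable.of_nonneg_of_le (bsum_term_nonneg hb d) (bsum_term_le hb d)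
    (hasSum_geometric_sub_one hb).summable

theorem bsum_nonneg {b : ℝ} (hb : 1 < b) (d : ℕ → Bool) : 0 ≤ bsum b d :=
  tsum_nonneg (bsum_term_nonneg hb d)

theorem bsum_le_one {b : ℝ} (hb : 1 < b) (d : ℕ → Bool) : bsum b d ≤ 1 :=
  ((summable_bsum hb d).tsum_le_tsum (bsum_term_le hb d)
    (hasSum_geometric_sub_one hb).summable).trans_eq (hasSum_geometric_sub_one hb).tsum_eq

theorem bsum_not {b : ℝ} (hb : 1 < b) (d : ℕ → Bool) : bsum b (fun i => !d i) = 1 - bsum b d := by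
  rw [eq_sub_iff_add_eq, ← (hasSum_geometric_sub_one hb).tsum_eq]
  unfold bsum
  rw [← (summable_bsum hb _).tsum_add (summable_bsum hb d)]
  refine tsum_congr fun n => ?_
  cases d n <;> simp

theorem bsum_eq_bpre_add {b : ℝ} (hb : 1 < b) (d : ℕ → Bool) (n : ℕ) :
    bsum b d = bpre b d n + bsum b (fun i => d (n + i)) / b ^ n := by
  unfold bsum bpre
  rw [← (summable_bsum hb d).sum_add_tsum_nat_add n, ← tsum_div_const]
  congr 1
  refine tsum_congr fun i => ?_
  rw [add_comm i n, div_div, add_assoc, pow_add, pow_succ, mul_comm (b ^ n)]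

theorem bpre_succ (b : ℝ) (d : ℕ → Bool) (n : ℕ) :
    bpre b d (n + 1) = bpre b d n + (if d n then b - 1 else 0) / b ^ (n + 1) := by
  unfold bpre; rw [Finset.sum_range_succ]

@[simp]
theorem bpre_zero (b : ℝ) (d : ℕ → Bool) : bpre b d 0 = 0 := by simp [bpre]

theorem bpre_congr {b : ℝ} {d d' : ℕ → Bool} {n : ℕ} (h : ∀ i < n, d i = d' i) :
    bpre b d n = bpre b d' n :=
  Finset.sum_congr rfl fun i hi => by rw [h i (Finset.mem_range.1 hi)]

theorem bsum_succ {b : ℝ} (hb : 1 < b) (d : ℕ → Bool) :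
    bsum b d = ((if d 0 then b - 1 else 0) + bsum b (fun i => d (i + 1))) / b := by
  rw [bsum_eq_bpre_add hb d 1, bpre_succ, bpre_zero]
  simp only [zero_add, pow_one, add_div, add_comm 1]

theorem bsum_lt_one {b : ℝ} (hb : 1 < b) {d : ℕ → Bool} {i : ℕ} (h : d i = false) :
    bsum b d < 1 := by
  induction i generalizing d with
  | zero =>
    rw [bsum_succ hb, h, div_lt_one (by linarith)]
    have := bsum_le_one hb fun i => d (i + 1)
    simp only [Bool.false_eq_true, if_false]; linarith
  | succ i ih =>
    have := ih (d := fun i => d (i + 1)) h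
    rw [bsum_succ hb, div_lt_one (by linarith)]
    split_ifs <;> linarith

theorem abs_bsum_sub_le {b : ℝ} (hb : 1 < b) {d d' : ℕ → Bool} {n : ℕ} (h : ∀ i < n, d i = d' i) :
    |bsum b d - bsum b d'| ≤ 1 / b ^ n := by
  have hp : 0 < b ^ n := by positivity
  rw [bsum_eq_bpre_add hb d n, bsum_eq_bpre_add hb d' n, bpre_congr h, add_sub_add_left_eq_sub,
    ← sub_div, abs_div, abs_of_pos hp]
  gcongr
  have h1 := bsum_nonneg hb fun i => d (n + i)
  have h2 := bsum_le_one hb fun i => d (n + i)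
  have h3 := bsum_nonneg hb fun i => d' (n + i)
  have h4 := bsum_le_one hb fun i => d' (n + i)
  rw [abs_le]; constructor <;> linarith

theorem one_div_le_abs_bsum_sub {d d' : ℕ → Bool} {n : ℕ} (h : ∀ i < n, d i = d' i)
    (hn : d n ≠ d' n) : 1 / 3 ^ (n + 1) ≤ |bsum 3 d - bsum 3 d'| := by
  have hb : (1 : ℝ) < 3 := by norm_num
  have hp : (0 : ℝ) < 3 ^ (n + 1) := by positivity
  rw [bsum_eq_bpre_add hb d (n + 1), bsum_eq_bpre_add hb d' (n + 1), bpre_succ, bpre_succ,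
    bpre_congr h, add_assoc, add_assoc, add_sub_add_left_eq_sub, ← add_div, ← add_div,
    ← sub_div, abs_div, abs_of_pos hp]
  gcongr
  have h1 := bsum_nonneg hb fun i => d (n + 1 + i)
  have h2 := bsum_le_one hb fun i => d (n + 1 + i)
  have h3 := bsum_nonneg hb fun i => d' (n + 1 + i)
  have h4 := bsum_le_one hb fun i => d' (n + 1 + i)
  cases hd : d n <;> cases hd' : d' n
  · simp [hd, hd'] at hn
  · simp only [Bool.false_eq_true, if_false, if_true]
    rw [abs_of_nonpos (by linarith)]; linarith
  · simp only [Bool.false_eq_true, if_false, if_true]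
    rw [abs_of_nonneg (by linarith)]; linarith
  · simp [hd, hd'] at hn

theorem surjOn_bsum_two {t : ℝ} (ht : t ∈ Icc (0 : ℝ) 1) : ∃ d, bsum 2 d = t := by
  obtain ⟨f, -, hf⟩ := Real.ofDigits_SurjOn (b := 2) one_lt_two ht
  refine ⟨fun i => f i = 1, ?_⟩
  rw [← hf]
  unfold bsum Real.ofDigits Real.ofDigitsTerm
  refine tsum_congr fun i => ?_
  have : f i = 0 ∨ f i = 1 := by omega
  rcases this with h | h
  · simp [h]
  · simp [h]; norm_num

/-- Cylinder formula for prefixes with digits `0` and `2`. -/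
theorem phi_bpre_add (d : ℕ → Bool) (n : ℕ) :
    ∀ v : ℝ, 0 ≤ v → v ≤ 1 →
      phi (bpre 3 d n + v / 3 ^ n) = phi (bpre 3 d n) + wa ^ n * phi v := by
  induction n with
  | zero => intro v _ _; simp [phi_zero]
  | succ n ih =>
    intro v h0 h1
    rw [bpre_succ]
    have e : ∀ c v : ℝ, bpre 3 d n + c / 3 ^ (n + 1) + v / 3 ^ (n + 1) =
        bpre 3 d n + ((c + v) / 3) / 3 ^ n := by
      intro c v; rw [pow_succ]; field_simp; ring
    have e' : ∀ c : ℝ, bpre 3 d n + c / 3 ^ (n + 1) =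
        bpre 3 d n + ((c + 0) / 3) / 3 ^ n := by
      intro c; rw [← e, zero_div, add_zero]
    rw [e, e']
    cases d n
    · simp only [Bool.false_eq_true, if_false, zero_add]
      rw [ih _ (by positivity) (by linarith), ih _ (by positivity) (by linarith),
        phi_branch_left h0 h1, zero_div, phi_zero, pow_succ]
      ring
    · have h2 : (3 : ℝ) - 1 = 2 := by norm_num
      simp only [if_true, h2]
      rw [ih _ (by positivity) (by linarith), ih _ (by positivity) (by linarith),
        phi_branch_right h0 h1, phi_branch_right le_rfl zero_le_one, phi_zero, pow_succ]
      ring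

theorem one_sub_phi_bsum_run {d : ℕ → Bool} {r : ℕ} (h : ∀ i < r, d i = true) :
    1 - phi (bsum 3 d) = wa ^ r * (1 - phi (bsum 3 fun i => d (r + i))) := by
  have hb : (1 : ℝ) < 3 := by norm_num
  induction r generalizing d with
  | zero => simp
  | succ r ih =>
    have h' := ih (d := fun i => d (i + 1)) (fun i hi => h (i + 1) (by omega))
    have h2 : (3 : ℝ) - 1 = 2 := by norm_num
    rw [bsum_succ hb d, h 0 (by omega), if_pos rfl, h2,
      phi_branch_right (bsum_nonneg hb _) (bsum_le_one hb _)]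
    have e : (fun i => d (r + 1 + i)) = fun i => d (r + i + 1) := by
      ext i; congr 1; omega
    rw [e]
    have hs := wa_add_wa_add_wb
    rw [pow_succ']
    linear_combination wa * h' - hs

theorem abs_coeff_wa_mul_le {U : PowerSeries ℝ} {A : ℝ} {k : ℕ}
    (h : ∀ i ≤ k, |PowerSeries.coeff i U| ≤ A) :
    ∀ i ≤ k, |PowerSeries.coeff i (wa * U)| ≤ 2 * A := by
  intro i hi
  have hA : 0 ≤ A := (abs_nonneg _).trans (h 0 (Nat.zero_le _))
  cases i with
  | zero =>
    have := abs_le.1 (h 0 hi)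
    rw [coeff_wa_mul_zero, abs_le]; constructor <;> linarith
  | succ i =>
    have h1 := abs_le.1 (h (i + 1) hi)
    have h2 := abs_le.1 (h i (by omega))
    rw [coeff_wa_mul_succ, abs_le]; constructor <;> linarith

theorem abs_coeff_wb_mul_le {U : PowerSeries ℝ} {A : ℝ} {k : ℕ}
    (h : ∀ i ≤ k, |PowerSeries.coeff i U| ≤ A) :
    ∀ i ≤ k, |PowerSeries.coeff i (wb * U)| ≤ 2 * A := by
  intro i hi
  have hA : 0 ≤ A := (abs_nonneg _).trans (h 0 (Nat.zero_le _))
  cases i with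
  | zero => rw [coeff_wb_mul_zero, abs_zero]; linarith
  | succ i =>
    have h2 := abs_le.1 (h i (by omega))
    rw [coeff_wb_mul_succ, abs_le]; constructor <;> linarith

theorem abs_coeff_one_le (i : ℕ) : |PowerSeries.coeff i (1 : PowerSeries ℝ)| ≤ 1 := by
  rw [PowerSeries.coeff_one]; split_ifs <;> simp

theorem phi_sub_phi_of_gap {d : ℕ → Bool} {j r : ℕ} {A : ℝ}
    (hA : ∀ i ≤ j, ∀ x, |PowerSeries.coeff i (phi x)| ≤ A)
    (h0 : d 0 = false) (h1 : ∀ i < r, d (i + 1) = true) (h2 : d (r + 1) = false)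
    {y : ℝ} (hy : 1 / 3 ≤ y) (hy1 : y ≤ 1) :
    ∃ ψ τ : PowerSeries ℝ, phi y - phi (bsum 3 d) = wa ^ (r + 1) * ψ + τ ∧
      (∀ i ≤ j, |PowerSeries.coeff i ψ| ≤ 2 + 4 * A) ∧
      (∀ i ≤ j, |PowerSeries.coeff i τ| ≤ 2 + 4 * A) ∧
      1 / 2 ≤ PowerSeries.coeff 0 ψ ∧ 0 ≤ PowerSeries.coeff 0 τ := by
  have hb : (1 : ℝ) < 3 := by norm_num
  have hA0 : 0 ≤ A := (abs_nonneg _).trans (hA 0 (Nat.zero_le _) 0)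
  have hz := one_sub_phi_bsum_run (d := fun i => d (i + 1)) h1
  set z' := bsum 3 (fun i => d (r + i + 1 + 1)) with hz'
  have hz0 : 0 ≤ z' := bsum_nonneg hb _
  have hz1 : z' ≤ 1 := bsum_le_one hb _
  have e1 : bsum 3 (fun i => d (r + i + 1)) = z' / 3 := by
    rw [bsum_succ hb]; simp [h2, hz']; congr 1
  have e2 : phi (bsum 3 d) = wa * phi (bsum 3 fun i => d (i + 1)) := by
    rw [bsum_succ hb d, h0]
    simp only [Bool.false_eq_true, if_false, zero_add]
    exact phi_branch_left (bsum_nonneg hb _) (bsum_le_one hb _)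
  rw [e1, phi_branch_left hz0 hz1] at hz
  have hψ : ∀ i ≤ j, |PowerSeries.coeff i (1 - wa * phi z')| ≤ 2 + 4 * A := by
    intro i hi
    have g1 := abs_le.1 (abs_coeff_one_le i)
    have g2 := abs_le.1 (abs_coeff_wa_mul_le (fun i hi => hA i hi z') i hi)
    rw [map_sub, abs_le]; constructor <;> linarith
  have hψ0 : 1 / 2 ≤ PowerSeries.coeff 0 (1 - wa * phi z') := by
    have := coeff_zero_phi_le_one hz0 hz1
    rw [map_sub, coeff_wa_mul_zero, PowerSeries.coeff_one, if_pos rfl]; linarith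
  rcases le_total y (2 / 3) with h | h
  · refine ⟨1 - wa * phi z', wb * phi (3 * y - 1), ?_, hψ, ?_, hψ0, ?_⟩
    · have : y = (1 + (3 * y - 1)) / 3 := by ring
      rw [e2]
      conv_lhs => rw [this, phi_branch_mid (by linarith) (by linarith)]
      linear_combination wa * hz
    · intro i hi
      have g2 := abs_coeff_wb_mul_le (fun i hi => hA i hi (3 * y - 1)) i hi
      linarith
    · rw [coeff_wb_mul_zero]
  · refine ⟨1 - wa * phi z', wb * 1 + wa * phi (3 * y - 2), ?_, hψ, ?_, hψ0, ?_⟩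
    · have : y = (2 + (3 * y - 2)) / 3 := by ring
      rw [e2]
      conv_lhs => rw [this, phi_branch_right (by linarith) (by linarith)]
      linear_combination wa * hz
    · intro i hi
      have g1 := abs_le.1 (abs_coeff_wb_mul_le (k := j) (fun i _ => abs_coeff_one_le i) i hi)
      have g2 := abs_le.1 (abs_coeff_wa_mul_le (fun i hi => hA i hi (3 * y - 2)) i hi)
      rw [map_add, abs_le]; constructor <;> linarith
    · rw [map_add, coeff_wb_mul_zero, coeff_wa_mul_zero]
      have := coeff_zero_phi_nonneg (x := 3 * y - 2) (by linarith) (by linarith)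
      linarith

theorem bsum_lt_bpre_add {d : ℕ → Bool} (hd : ∃ᶠ n in atTop, d n = false) (n : ℕ) :
    bsum 3 d < bpre 3 d n + 1 / 3 ^ n := by
  obtain ⟨m, hm, hdm⟩ := (frequently_atTop.1 hd) n
  rw [bsum_eq_bpre_add (by norm_num) d n]
  have : bsum 3 (fun i => d (n + i)) < 1 :=
    bsum_lt_one (by norm_num) (i := m - n) (by rw [Nat.add_sub_cancel' hm]; exact hdm)
  gcongr

theorem bpre_le_bsum {b : ℝ} (hb : 1 < b) (d : ℕ → Bool) (n : ℕ) : bpre b d n ≤ bsum b d := by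
  rw [bsum_eq_bpre_add hb d n]
  have := bsum_nonneg hb fun i => d (n + i)
  have : 0 ≤ bsum b (fun i => d (n + i)) / b ^ n := by positivity
  linarith

theorem antitone_bpre_add (d : ℕ → Bool) : Antitone fun n => bpre 3 d n + 1 / 3 ^ n := by
  refine antitone_nat_of_succ_le fun n => ?_
  rw [bpre_succ]
  have e : (1 : ℝ) / 3 ^ n = 3 / 3 ^ (n + 1) := by rw [pow_succ]; field_simp
  rw [e, add_assoc, ← add_div]
  gcongr
  split_ifs <;> norm_num

theorem eventually_le_coeff_phi_sub {j : ℕ} {ρ : ℕ → ℕ} (hS : SlopeGrows j ρ) {d : ℕ → Bool}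
    (hd : ∀ᶠ n in atTop, ∃ i ≤ ρ n, d (n + 1 + i) = false) (B : ℝ) :
    ∀ᶠ y in 𝓝[>] (bsum 3 d),
      B * (y - bsum 3 d) ≤
        PowerSeries.coeff j (phi y) - PowerSeries.coeff j (phi (bsum 3 d)) := by
  have hb : (1 : ℝ) < 3 := by norm_num
  obtain ⟨A, hA0, hA⟩ := exists_abs_coeff_phi_le j
  have hfr : ∃ᶠ n in atTop, d n = false := by
    refine frequently_atTop.2 fun n => ?_
    obtain ⟨m, hm, i, -, hi⟩ := ((eventually_ge_atTop n).and hd).exists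
    exact ⟨m + 1 + i, by omega, hi⟩
  obtain ⟨n0, hn0⟩ := eventually_atTop.1 (hd.and (hS (2 + 4 * A) (max B 0)))
  set z := bsum 3 d with hz
  filter_upwards [Ioo_mem_nhdsGT (bsum_lt_bpre_add hfr n0)] with y hy
  have hex : ∃ n, bpre 3 d n + 1 / 3 ^ n < y := by
    have ht : Tendsto (fun n : ℕ => z + (1 / 3 : ℝ) ^ n) atTop (𝓝 (z + 0)) :=
      (tendsto_pow_atTop_nhds_zero_of_lt_one (by norm_num) (by norm_num)).const_add _
    rw [add_zero] at ht
    obtain ⟨n, hn⟩ := (ht.eventually_lt_const hy.1).exists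
    refine ⟨n, lt_of_le_of_lt ?_ hn⟩
    rw [one_div_pow]
    gcongr
    exact bpre_le_bsum hb d n
  classical
  obtain ⟨n, hn⟩ : ∃ n, Nat.find hex = n + 1 := by
    refine Nat.exists_eq_succ_of_ne_zero fun h => ?_
    have h1 := Nat.find_spec hex
    rw [h] at h1
    exact absurd (h1.trans hy.2) (not_lt.2 (antitone_bpre_add d (Nat.zero_le n0)))
  have hn1 : bpre 3 d (n + 1) + 1 / 3 ^ (n + 1) < y := hn ▸ Nat.find_spec hex
  have hn2 : y ≤ bpre 3 d n + 1 / 3 ^ n := not_lt.1 (Nat.find_min hex (by omega))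
  have hnn : n0 ≤ n := by
    by_contra hlt
    exact absurd (hn1.trans hy.2) (not_lt.2 (antitone_bpre_add d (by omega : n + 1 ≤ n0)))
  have hp : (0 : ℝ) < 3 ^ n := by positivity
  have hdn : d n = false := by
    by_contra h
    rw [Bool.not_eq_false] at h
    rw [bpre_succ, h, if_pos rfl] at hn1
    have : bpre 3 d n + (3 - 1) / 3 ^ (n + 1) + 1 / 3 ^ (n + 1) = bpre 3 d n + 1 / 3 ^ n := by
      rw [pow_succ]; field_simp; ring
    linarith
  rw [bpre_succ, hdn] at hn1
  simp only [Bool.false_eq_true, if_false, zero_div, add_zero] at hn1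
  set v := (y - bpre 3 d n) * 3 ^ n with hv
  have hyv : y = bpre 3 d n + v / 3 ^ n := by rw [hv]; field_simp; ring
  have hv1 : 1 / 3 ≤ v := by
    have : 1 / 3 ^ (n + 1) * 3 ^ n ≤ v := by rw [hv]; gcongr; linarith
    refine le_trans (le_of_eq ?_) this
    rw [pow_succ]; field_simp
  have hv2 : v ≤ 1 := by
    have : v ≤ 1 / 3 ^ n * 3 ^ n := by rw [hv]; gcongr; linarith
    refine this.trans (le_of_eq ?_)
    field_simp
  obtain ⟨hrun, hslope⟩ := hn0 n hnn
  have hrun' : ∃ i, d (n + 1 + i) = false := hrun.imp fun i h => h.2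
  have hr : Nat.find hrun' ≤ ρ n := by
    obtain ⟨i, hi, hi'⟩ := hrun
    exact (Nat.find_min' hrun' hi').trans hi
  obtain ⟨ψ, τ, heq, hψ, hτ, hψ0, hτ0⟩ := phi_sub_phi_of_gap (d := fun i => d (n + i))
    (r := Nat.find hrun') hA hdn
    (fun i hi => by
      have := Nat.find_min hrun' hi
      rw [Bool.not_eq_false] at this
      rw [show n + (i + 1) = n + 1 + i by omega]; exact this)
    (by
      have := Nat.find_spec hrun'
      rw [show n + (Nat.find hrun' + 1) = n + 1 + Nat.find hrun' by omega]; exact this) hv1 hv2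
  have hB := hslope _ hr ψ τ hψ hτ hψ0 hτ0
  have hdiff : phi y - phi z = wa ^ n * (wa ^ (Nat.find hrun' + 1) * ψ + τ) := by
    rw [← heq, hyv, phi_bpre_add d n v (by linarith) hv2, hz, bsum_eq_bpre_add hb d n,
      phi_bpre_add d n _ (bsum_nonneg hb _) (bsum_le_one hb _)]
    ring
  rw [← map_sub, hdiff]
  have hyz : y - z ≤ 1 / 3 ^ n := by
    have := bpre_le_bsum hb d n
    linarith
  have hyz0 : 0 ≤ y - z := by linarith [hy.1]
  calc B * (y - z) ≤ max B 0 * (1 / 3 ^ n) := by gcongr; exact le_max_left _ _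
    _ = max B 0 / 3 ^ n := by ring
    _ ≤ _ := by rw [div_le_iff₀ hp, mul_comm _ (3 ^ n)]; exact hB

theorem derivPInf_iff {f : ℝ → ℝ} {x : ℝ} (hx : x ∈ Ioo (0 : ℝ) 1) :
    derivPInf f x ↔ Tendsto (fun y => (f y - f x) / (y - x)) (𝓝[≠] x) atTop := by
  have : 𝓝[Icc 0 1 \ {x}] x = 𝓝[≠] x := by
    rw [sdiff_eq, inter_comm, nhdsWithin_inter_of_mem']
    exact nhdsWithin_le_nhds (Icc_mem_nhds hx.1 hx.2)
  rw [derivPInf, this]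

theorem derivMInf_iff {f : ℝ → ℝ} {x : ℝ} (hx : x ∈ Ioo (0 : ℝ) 1) :
    derivMInf f x ↔ Tendsto (fun y => (f y - f x) / (y - x)) (𝓝[≠] x) atBot := by
  have : 𝓝[Icc 0 1 \ {x}] x = 𝓝[≠] x := by
    rw [sdiff_eq, inter_comm, nhdsWithin_inter_of_mem']
    exact nhdsWithin_le_nhds (Icc_mem_nhds hx.1 hx.2)
  rw [derivMInf, this]

theorem Mfun_half_eq (j : ℕ) (x : ℝ) :
    Mfun j (1 / 2) x = j.factorial * PowerSeries.coeff j (phi x) := by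
  rw [coeff_phi]; field_simp

/-- Codes along which runs of equal digits at position `n` have length at most `ρ n`. -/
def ShortRuns (ρ : ℕ → ℕ) (d : ℕ → Bool) : Prop :=
  ∀ᶠ n in atTop, (∃ i ≤ ρ n, d (n + 1 + i) = false) ∧ ∃ i ≤ ρ n, d (n + 1 + i) = true

theorem ShortRuns.not {ρ : ℕ → ℕ} {d : ℕ → Bool} (h : ShortRuns ρ d) :
    ShortRuns ρ fun i => !d i := by
  filter_upwards [h] with n hn
  simpa using hn.symm

theorem ShortRuns.bsum_mem_Ioo {ρ : ℕ → ℕ} {d : ℕ → Bool} (h : ShortRuns ρ d) {b : ℝ}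
    (hb : 1 < b) : bsum b d ∈ Ioo (0 : ℝ) 1 := by
  obtain ⟨n, ⟨i, -, hi⟩, ⟨i', -, hi'⟩⟩ := h.exists
  refine ⟨?_, bsum_lt_one hb hi⟩
  have := bsum_lt_one hb (d := fun i => !d i) (i := n + 1 + i') (by simp [hi'])
  rw [bsum_not hb] at this
  linarith

theorem ShortRuns.derivPInf {j : ℕ} {ρ : ℕ → ℕ} (hS : SlopeGrows j ρ) {d : ℕ → Bool}
    (h : ShortRuns ρ d) : derivPInf (Mfun j (1 / 2)) (bsum 3 d) := by
  have hb : (1 : ℝ) < 3 := by norm_num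
  have hz := h.bsum_mem_Ioo hb
  rw [derivPInf_iff hz, ← nhdsLT_sup_nhdsGT, tendsto_sup]
  have hright : ∀ B, ∀ᶠ y in 𝓝[>] (bsum 3 d),
      B ≤ (Mfun j (1 / 2) y - Mfun j (1 / 2) (bsum 3 d)) / (y - bsum 3 d) := by
    intro B
    filter_upwards [eventually_le_coeff_phi_sub hS (h.mono fun n hn => hn.1) (B / j.factorial),
      self_mem_nhdsWithin] with y hy hyz
    have hyz' : 0 < y - bsum 3 d := sub_pos.2 hyz
    rw [le_div_iff₀ hyz', Mfun_half_eq, Mfun_half_eq, ← mul_sub]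
    have hf : (0 : ℝ) < j.factorial := by positivity
    rw [div_mul_eq_mul_div, div_le_iff₀ hf] at hy
    linarith
  refine ⟨tendsto_atTop.2 fun B => ?_, tendsto_atTop.2 hright⟩
  have hleft := eventually_le_coeff_phi_sub hS (d := fun i => !d i) (h.not.mono fun n hn => hn.1) (B / j.factorial)
  rw [bsum_not hb] at hleft
  have hmap : Tendsto (fun y : ℝ => 1 - y) (𝓝[<] (bsum 3 d)) (𝓝[>] (1 - bsum 3 d)) := by
    refine tendsto_nhdsWithin_of_tendsto_nhds_of_eventually_within _ ?_ ?_
    · exact ((continuous_const.sub continuous_id).tendsto _).mono_left nhdsWithin_le_nhds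
    · filter_upwards [self_mem_nhdsWithin] with y hy
      simp only [mem_Ioi, mem_Iio] at hy ⊢; linarith
  filter_upwards [hmap.eventually hleft, Ioo_mem_nhdsLT hz.1] with y hy hyz
  have hyz' : y - bsum 3 d < 0 := sub_neg.2 hyz.2
  have hf : (0 : ℝ) < j.factorial := by positivity
  rw [le_div_iff_of_neg hyz', Mfun_half_eq, Mfun_half_eq, ← mul_sub]
  rw [phi_one_sub hyz.1.le (by linarith [hyz.2, hz.2]), phi_one_sub hz.1.le hz.2.le, map_sub, map_sub,
    div_mul_eq_mul_div, div_le_iff₀ hf] at hy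
  linarith

theorem Mfun_succ_branch_mid_sub (j : ℕ) {y z : ℝ} (hy : y ∈ Icc (0 : ℝ) 1)
    (hz : z ∈ Icc (0 : ℝ) 1) :
    Mfun (j + 1) (1 / 2) ((1 + y) / 3) - Mfun (j + 1) (1 / 2) ((1 + z) / 3) =
      -2 * (j + 1) * (Mfun j (1 / 2) y - Mfun j (1 / 2) z) := by
  simp only [Mfun_half_eq]
  rw [phi_branch_mid hy.1 hy.2, phi_branch_mid hz.1 hz.2, map_add, map_add, coeff_wb_mul_succ,
    coeff_wb_mul_succ, Nat.factorial_succ]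
  push_cast
  ring

theorem branch_mid_mem_Ioo {z : ℝ} (hz : z ∈ Ioo (0 : ℝ) 1) : (1 + z) / 3 ∈ Ioo (0 : ℝ) 1 :=
  ⟨by linarith [hz.1], by linarith [hz.2]⟩

theorem slope_branch_mid_eventuallyEq (j : ℕ) {z : ℝ} (hz : z ∈ Ioo (0 : ℝ) 1) :
    (fun y => (Mfun (j + 1) (1 / 2) y - Mfun (j + 1) (1 / 2) ((1 + z) / 3)) / (y - (1 + z) / 3))
      =ᶠ[𝓝[≠] ((1 + z) / 3)] fun y => (-(6 * (j + 1)) : ℝ) *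
        ((Mfun j (1 / 2) (3 * y - 1) - Mfun j (1 / 2) z) / ((3 * y - 1) - z)) := by
  have hmem : Ioo (1 / 3 : ℝ) (2 / 3) ∈ 𝓝[≠] ((1 + z) / 3) :=
    mem_nhdsWithin_of_mem_nhds (Ioo_mem_nhds (by linarith [hz.1]) (by linarith [hz.2]))
  filter_upwards [hmem, self_mem_nhdsWithin] with y hy hyz
  have e : y = (1 + (3 * y - 1)) / 3 := by ring
  have hne : y - (1 + z) / 3 ≠ 0 := sub_ne_zero.2 hyz
  have hne' : 3 * y - 1 - z ≠ 0 := fun h => hne (by linarith)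
  have h := Mfun_succ_branch_mid_sub j (y := 3 * y - 1) (z := z)
    ⟨by linarith [hy.1], by linarith [hy.2]⟩ ⟨hz.1.le, hz.2.le⟩
  rw [← e] at h
  rw [h, show y - (1 + z) / 3 = (3 * y - 1 - z) / 3 by ring]
  field_simp
  ring

theorem tendsto_branch_mid_inv (z : ℝ) :
    Tendsto (fun y : ℝ => 3 * y - 1) (𝓝[≠] ((1 + z) / 3)) (𝓝[≠] z) := by
  refine tendsto_nhdsWithin_of_tendsto_nhds_of_eventually_within _ ?_ ?_
  · have : Tendsto (fun y : ℝ => 3 * y - 1) (𝓝 ((1 + z) / 3)) (𝓝 (3 * ((1 + z) / 3) - 1)) :=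
      ((continuous_const.mul continuous_id).sub continuous_const).tendsto _
    rw [show 3 * ((1 + z) / 3) - 1 = z by ring] at this
    exact this.mono_left nhdsWithin_le_nhds
  · filter_upwards [self_mem_nhdsWithin] with y hy h
    simp only [mem_singleton_iff] at h
    exact hy (by simp only [mem_singleton_iff]; linarith)

theorem derivPInf.branch_mid {j : ℕ} {z : ℝ} (hz : z ∈ Ioo (0 : ℝ) 1)
    (h : derivPInf (Mfun j (1 / 2)) z) : derivMInf (Mfun (j + 1) (1 / 2)) ((1 + z) / 3) := by
  rw [derivMInf_iff (branch_mid_mem_Ioo hz)]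
  rw [derivPInf_iff hz] at h
  refine Tendsto.congr' (slope_branch_mid_eventuallyEq j hz).symm ?_
  have hpos : (-(6 * (j + 1)) : ℝ) < 0 := by linarith [(Nat.cast_nonneg j : (0 : ℝ) ≤ j)]
  exact Tendsto.const_mul_atTop_of_neg hpos (h.comp (tendsto_branch_mid_inv z))

theorem derivMInf.branch_mid {j : ℕ} {z : ℝ} (hz : z ∈ Ioo (0 : ℝ) 1)
    (h : derivMInf (Mfun j (1 / 2)) z) : derivPInf (Mfun (j + 1) (1 / 2)) ((1 + z) / 3) := by
  rw [derivPInf_iff (branch_mid_mem_Ioo hz)]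
  rw [derivMInf_iff hz] at h
  refine Tendsto.congr' (slope_branch_mid_eventuallyEq j hz).symm ?_
  have hpos : (-(6 * (j + 1)) : ℝ) < 0 := by linarith [(Nat.cast_nonneg j : (0 : ℝ) ≤ j)]
  exact Tendsto.const_mul_atBot_of_neg hpos (h.comp (tendsto_branch_mid_inv z))

/-- The point whose ternary expansion is `l` ones followed by the expansion of `z`. -/
noncomputable def prependOnes (l : ℕ) (z : ℝ) : ℝ := (fun z => (1 + z) / 3)^[l] z

theorem prependOnes_succ (l : ℕ) (z : ℝ) : prependOnes (l + 1) z = (1 + prependOnes l z) / 3 :=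
  Function.iterate_succ_apply' _ _ _

theorem prependOnes_mem_Ioo (l : ℕ) {z : ℝ} (hz : z ∈ Ioo (0 : ℝ) 1) :
    prependOnes l z ∈ Ioo (0 : ℝ) 1 := by
  induction l with
  | zero => exact hz
  | succ l ih => rw [prependOnes_succ]; exact branch_mid_mem_Ioo ih

theorem derivPInf.prependOnes {j : ℕ} {z : ℝ} (hz : z ∈ Ioo (0 : ℝ) 1)
    (h : derivPInf (Mfun j (1 / 2)) z) (l : ℕ) :
    (Even l → derivPInf (Mfun (j + l) (1 / 2)) (prependOnes l z)) ∧
      (Odd l → derivMInf (Mfun (j + l) (1 / 2)) (prependOnes l z)) := by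
  induction l with
  | zero => exact ⟨fun _ => h, fun h => absurd h (by decide)⟩
  | succ l ih =>
    rw [prependOnes_succ]
    refine ⟨fun hl => ?_, fun hl => ?_⟩
    · exact (ih.2 (by rwa [Nat.even_add_one, Nat.not_even_iff_odd] at hl)).branch_mid
        (prependOnes_mem_Ioo l hz)
    · exact (ih.1 (by rwa [Nat.odd_add_one, Nat.not_odd_iff_even] at hl)).branch_mid
        (prependOnes_mem_Ioo l hz)

theorem exists_lipschitzWith_leftInverse_prependOnes (l : ℕ) :
    ∃ g : ℝ → ℝ, LipschitzWith (3 ^ l) g ∧ ∀ z, g (prependOnes l z) = z := by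
  refine ⟨(fun y => 3 * y - 1)^[l], LipschitzWith.iterate ?_ l, ?_⟩
  · refine LipschitzWith.of_dist_le_mul fun x y => ?_
    rw [Real.dist_eq, Real.dist_eq, show 3 * x - 1 - (3 * y - 1) = 3 * (x - y) by ring, abs_mul]
    simp
  · exact Function.LeftInverse.iterate (fun z => by ring) l

theorem lCount_prependOnes (l : ℕ) {z : ℝ} (hz : z ∈ Ioo (0 : ℝ) 1) (n : ℕ) :
    lCount (prependOnes l z) (n + l) = lCount z n + l := by
  induction l with
  | zero => rfl
  | succ l ih =>
    have h := prependOnes_mem_Ioo l hz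
    have := lCount_branch (d := 1) h.1.le h.2 (by norm_num) (n + l)
    rw [prependOnes_succ, ← add_assoc, ← add_assoc, ← ih]
    simpa using this

theorem iSup_lCount_eq_iff {x : ℝ} {l : ℕ} :
    (⨆ n, (lCount x n : ℝ≥0∞)) = l ↔ ∀ᶠ n in atTop, lCount x n = l := by
  have hmono : Monotone fun n => (lCount x n : ℝ≥0∞) :=
    fun m n h => Nat.cast_le.2 (lCount_mono x h)
  constructor
  · intro h
    have hle : ∀ n, lCount x n ≤ l := fun n => by
      have := le_iSup (fun n => (lCount x n : ℝ≥0∞)) n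
      rw [h] at this
      exact_mod_cast this
    by_contra hcon
    have hlt : ∀ n, lCount x n < l := by
      intro n
      refine lt_of_le_of_ne (hle n) fun hn => hcon ?_
      filter_upwards [eventually_ge_atTop n] with m hm
      exact le_antisymm (hle m) (hn ▸ lCount_mono x hm)
    have hl : 1 ≤ l := by have := hlt 0; omega
    have : (⨆ n, (lCount x n : ℝ≥0∞)) ≤ ((l - 1 : ℕ) : ℝ≥0∞) :=
      iSup_le fun n => by exact_mod_cast (by have := hlt n; omega : lCount x n ≤ l - 1)
    rw [h] at this
    have : l ≤ l - 1 := by exact_mod_cast this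
    omega
  · intro h
    exact tendsto_nhds_unique (tendsto_atTop_iSup hmono)
      (tendsto_const_nhds.congr' (h.mono fun n hn => by simp only [hn]))

theorem lCount_bsum {d : ℕ → Bool} (hd : ∃ᶠ n in atTop, d n = false) (n : ℕ) :
    lCount (bsum 3 d) n = 0 := by
  have hb : (1 : ℝ) < 3 := by norm_num
  induction n generalizing d with
  | zero => exact lCount_zero _
  | succ n ih =>
    have hd' : ∃ᶠ n in atTop, d (n + 1) = false := by
      rw [frequently_atTop] at hd ⊢
      intro a
      obtain ⟨b, hb, h⟩ := hd (a + 1)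
      exact ⟨b - 1, by omega, by rwa [Nat.sub_add_cancel (by omega)]⟩
    obtain ⟨i, hi⟩ := hd'.exists
    have h0 := bsum_nonneg hb fun i => d (i + 1)
    have h1 := bsum_lt_one hb (d := fun i => d (i + 1)) hi
    rw [bsum_succ hb]
    cases d 0
    · have := lCount_branch (d := 0) h0 h1 (by norm_num) n
      rw [ih hd'] at this
      simpa using this
    · have := lCount_branch (d := 2) h0 h1 (by norm_num) n
      rw [ih hd'] at this
      simpa [show (3 : ℝ) - 1 = 2 by norm_num] using this

theorem ShortRuns.frequently_false {ρ : ℕ → ℕ} {d : ℕ → Bool} (h : ShortRuns ρ d) :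
    ∃ᶠ n in atTop, d n = false := by
  refine frequently_atTop.2 fun n => ?_
  obtain ⟨m, hm, ⟨i, -, hi⟩, -⟩ := ((eventually_ge_atTop n).and h).exists
  exact ⟨m + 1 + i, by omega, hi⟩

theorem ShortRuns.prependOnes_mem_FInf {j : ℕ} {ρ : ℕ → ℕ} (hS : SlopeGrows j ρ) {d : ℕ → Bool}
    (h : ShortRuns ρ d) (l : ℕ) : prependOnes l (bsum 3 d) ∈ FInf (j + l) l := by
  have hz := h.bsum_mem_Ioo (b := 3) (by norm_num)
  have hx := prependOnes_mem_Ioo l hz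
  refine ⟨⟨hx.1.le, hx.2.le⟩, iSup_lCount_eq_iff.2 ?_, ?_⟩
  · filter_upwards [eventually_ge_atTop l] with n hn
    have := lCount_prependOnes l hz (n - l)
    rwa [Nat.sub_add_cancel hn, lCount_bsum h.frequently_false, zero_add] at this
  · have := (h.derivPInf hS).prependOnes hz l
    rcases Nat.even_or_odd l with hl | hl
    · exact Or.inl (this.1 hl)
    · exact Or.inr (this.2 hl)

theorem exists_holderOnWith_image {ι : Type*} {E : Set ι} {p q : ι → ℝ} {C r : NNReal}
    (hr : 0 < r)
    (h : ∀ i ∈ E, ∀ j ∈ E, |q i - q j| ≤ C * |p i - p j| ^ (r : ℝ)) :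
    ∃ f : ℝ → ℝ, HolderOnWith C r f (p '' E) ∧ f '' (p '' E) = q '' E := by
  classical
  have hr' : (r : ℝ) ≠ 0 := by exact_mod_cast hr.ne'
  let f : ℝ → ℝ := fun x => if hx : ∃ i ∈ E, p i = x then q hx.choose else 0
  have hf : ∀ i ∈ E, f (p i) = q i := by
    intro i hi
    have hx : ∃ j ∈ E, p j = p i := ⟨i, hi, rfl⟩
    have h1 := h _ hx.choose_spec.1 i hi
    rw [hx.choose_spec.2, sub_self, abs_zero, Real.zero_rpow hr', mul_zero] at h1
    simp only [f, dif_pos hx]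
    exact sub_eq_zero.1 (abs_eq_zero.1 (le_antisymm h1 (abs_nonneg _)))
  refine ⟨f, ?_, ?_⟩
  · rintro _ ⟨i, hi, rfl⟩ _ ⟨j, hj, rfl⟩
    rw [hf i hi, hf j hj, edist_dist, edist_dist, Real.dist_eq, Real.dist_eq,
      ENNReal.ofReal_rpow_of_nonneg (abs_nonneg _) r.coe_nonneg, ← ENNReal.ofReal_coe_nnreal,
      ← ENNReal.ofReal_mul C.coe_nonneg]
    exact ENNReal.ofReal_le_ofReal (h i hi j hj)
  · rw [image_image]
    exact image_congr hf

theorem exists_first_difference {d d' : ℕ → Bool} (h : d ≠ d') :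
    ∃ n, (∀ i < n, d i = d' i) ∧ d n ≠ d' n := by
  classical
  have hex : ∃ n, d n ≠ d' n := Function.ne_iff.1 h
  exact ⟨Nat.find hex, fun i hi => not_not.1 (Nat.find_min hex hi), Nat.find_spec hex⟩

theorem logb_three_two_pos : 0 < Real.logb 3 2 := Real.logb_pos (by norm_num) (by norm_num)

theorem one_div_three_pow_rpow (n : ℕ) (c : ℝ) :
    ((1 : ℝ) / 3 ^ n) ^ (Real.logb 3 2 * c) = 2 ^ (-(n * c)) := by
  have h3 : (3 : ℝ) ^ Real.logb 3 2 = 2 := Real.rpow_logb (by norm_num) (by norm_num) (by norm_num)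
  have h : (2 : ℝ) ^ (-(n * c)) = ((3 : ℝ) ^ Real.logb 3 2) ^ (-(n * c)) := by rw [h3]
  rw [h, ← Real.rpow_mul (by norm_num), one_div, ← Real.rpow_natCast,
    ← Real.rpow_neg (by norm_num), ← Real.rpow_mul (by norm_num)]
  congr 1
  ring

theorem one_div_three_pow_rpow_logb (n : ℕ) :
    ((1 : ℝ) / 3 ^ n) ^ Real.logb 3 2 = 1 / 2 ^ n := by
  have := one_div_three_pow_rpow n 1
  rw [mul_one, mul_one] at this
  rw [this, Real.rpow_neg (by norm_num), Real.rpow_natCast, one_div]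

theorem abs_bsum_two_sub_le (d d' : ℕ → Bool) :
    |bsum 2 d - bsum 2 d'| ≤ 2 * |bsum 3 d - bsum 3 d'| ^ Real.logb 3 2 := by
  rcases eq_or_ne d d' with rfl | h
  · simp [Real.zero_rpow logb_three_two_pos.ne']
  obtain ⟨n, hn, hn'⟩ := exists_first_difference h
  calc |bsum 2 d - bsum 2 d'| ≤ 1 / 2 ^ n := abs_bsum_sub_le (by norm_num) hn
    _ = 2 * ((1 : ℝ) / 3 ^ (n + 1)) ^ Real.logb 3 2 := by
      rw [one_div_three_pow_rpow_logb, pow_succ]; field_simp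
    _ ≤ _ := by
      gcongr
      · exact logb_three_two_pos.le
      · exact one_div_le_abs_bsum_sub hn hn'

/-- Insert the block `false, true` after every `R` entries of a code. -/
def spread (R : ℕ) (e : ℕ → Bool) (p : ℕ) : Bool :=
  if p % (R + 2) < R then e (R * (p / (R + 2)) + p % (R + 2)) else p % (R + 2) == R + 1

theorem shortRuns_spread (R : ℕ) (e : ℕ → Bool) : ShortRuns (fun _ => R + 2) (spread R e) := by
  have hex : ∀ m c, c < R + 2 → ∃ i ≤ R + 2, (m + i) % (R + 2) = c := by
    intro m c hc
    have hm := Nat.mod_lt m (by omega : 0 < R + 2)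
    rcases le_or_gt (m % (R + 2)) c with h | h
    · refine ⟨c - m % (R + 2), by omega, ?_⟩
      rw [Nat.add_mod, Nat.mod_eq_of_lt (by omega : c - m % (R + 2) < R + 2),
        Nat.add_sub_cancel' h, Nat.mod_eq_of_lt hc]
    · refine ⟨c + (R + 2) - m % (R + 2), by omega, ?_⟩
      rw [Nat.add_mod, Nat.mod_eq_of_lt (by omega : c + (R + 2) - m % (R + 2) < R + 2),
        show m % (R + 2) + (c + (R + 2) - m % (R + 2)) = c + (R + 2) by omega, Nat.add_mod_right,
        Nat.mod_eq_of_lt hc]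
  refine Eventually.of_forall fun n => ⟨?_, ?_⟩
  · obtain ⟨i, hi, h⟩ := hex (n + 1) R (by omega)
    exact ⟨i, hi, by simp [spread, h]⟩
  · obtain ⟨i, hi, h⟩ := hex (n + 1) (R + 1) (by omega)
    exact ⟨i, hi, by simp [spread, h]⟩

theorem abs_bsum_two_sub_le_spread {R : ℕ} (hR : 0 < R) (d d' : ℕ → Bool) :
    |bsum 2 d - bsum 2 d'| ≤
      2 * |bsum 3 (spread R d) - bsum 3 (spread R d')| ^ (Real.logb 3 2 * (R / (R + 2))) := by
  have hc : (0 : ℝ) < R / (R + 2) := by positivity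
  have hs := mul_pos logb_three_two_pos hc
  rcases eq_or_ne d d' with rfl | h
  · simp [Real.zero_rpow hs.ne']
  obtain ⟨m, hm, hm'⟩ := exists_first_difference h
  have hi := Nat.mod_lt m hR
  set t := m / R with ht
  set i := m % R with hi'
  have hmt : R * t + i = m := Nat.div_add_mod m R
  set n := (R + 2) * t + i with hn
  have hn1 : n % (R + 2) = i := by rw [hn, Nat.mul_add_mod, Nat.mod_eq_of_lt (by omega)]
  have hn2 : n / (R + 2) = t := by
    rw [hn, Nat.mul_add_div (by omega), Nat.div_eq_of_lt (by omega), add_zero]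
  have hdiff : |bsum 3 (spread R d) - bsum 3 (spread R d')| ≥ 1 / 3 ^ (n + 1) := by
    refine one_div_le_abs_bsum_sub (fun p hp => ?_) ?_
    · unfold spread
      split_ifs with hlt
      · refine hm _ ?_
        have h1 := Nat.div_add_mod p (R + 2)
        have h2 : p / (R + 2) ≤ t := hn2 ▸ Nat.div_le_div_right hp.le
        rcases h2.lt_or_eq with h2 | h2
        · have : R * (p / (R + 2) + 1) ≤ R * t := Nat.mul_le_mul_left _ h2
          rw [mul_add] at this
          omega
        · rw [h2] at h1 ⊢
          omega
      · rfl
    · unfold spread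
      rw [hn1, hn2, if_pos hi, if_pos hi, hmt]
      exact hm'
  calc |bsum 2 d - bsum 2 d'| ≤ 1 / 2 ^ m := abs_bsum_sub_le (by norm_num) hm
    _ ≤ 2 * ((1 : ℝ) / 3 ^ (n + 1)) ^ (Real.logb 3 2 * (R / (R + 2))) := by
      rw [one_div_three_pow_rpow]
      have e1 : (1 : ℝ) / 2 ^ m = 2 * 2 ^ (-((m : ℝ) + 1)) := by
        rw [Real.rpow_neg (by norm_num), Real.rpow_add (by norm_num), Real.rpow_natCast,
          Real.rpow_one]
        field_simp
      rw [e1]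
      gcongr
      · norm_num
      rw [mul_div_assoc', div_le_iff₀ (by positivity)]
      have e2 : (m : ℝ) = R * t + i := by rw [← hmt]; push_cast; ring
      have e3 : (n : ℝ) = (R + 2) * t + i := by rw [hn]; push_cast; ring
      push_cast
      rw [e2, e3]
      nlinarith [(Nat.cast_nonneg i : (0 : ℝ) ≤ i)]
    _ ≤ _ := by
      gcongr

theorem image_bsum_two_superset : Icc (0 : ℝ) 1 ⊆ bsum 2 '' univ := fun _ ht =>
  let ⟨d, hd⟩ := surjOn_bsum_two ht
  ⟨d, trivial, hd⟩

theorem ofReal_le_dimH_spread {R : ℕ} (hR : 0 < R) :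
    ENNReal.ofReal (Real.logb 3 2 * (R / (R + 2))) ≤
      dimH ((fun e => bsum 3 (spread R e)) '' univ) := by
  have hs : 0 < Real.logb 3 2 * (R / (R + 2)) := mul_pos logb_three_two_pos (by positivity)
  obtain ⟨f, hf, hf'⟩ := exists_holderOnWith_image (E := univ) (C := 2)
    (r := (Real.logb 3 2 * (R / (R + 2))).toNNReal) (p := fun e => bsum 3 (spread R e))
    (q := bsum 2) (Real.toNNReal_pos.2 hs) (fun d _ d' _ => by
      rw [Real.coe_toNNReal _ hs.le]
      exact abs_bsum_two_sub_le_spread hR d d')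
  have h1 := hf.dimH_image_le (Real.toNNReal_pos.2 hs)
  have h2 : dimH (Icc (0 : ℝ) 1) = 1 := by
    have := Real.dimH_of_nonempty_interior (s := Icc (0 : ℝ) 1) (by
      rw [interior_Icc]; exact nonempty_Ioo.2 one_pos)
    simpa using this
  have h3 := (dimH_mono image_bsum_two_superset).trans (hf' ▸ h1)
  rw [h2, ENNReal.le_div_iff_mul_le (Or.inl (by simpa using hs)) (Or.inl ENNReal.coe_ne_top),
    one_mul] at h3
  exact h3

theorem le_dimH_of_spread_subset {S : Set ℝ} (l : ℕ)
    (h : ∀ R e, prependOnes l (bsum 3 (spread R e)) ∈ S) :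
    ENNReal.ofReal (Real.logb 3 2) ≤ dimH S := by
  obtain ⟨g, hg, hg'⟩ := exists_lipschitzWith_leftInverse_prependOnes l
  have hR : ∀ R : ℕ, 0 < R → ENNReal.ofReal (Real.logb 3 2 * (R / (R + 2))) ≤ dimH S := by
    intro R hR
    refine (ofReal_le_dimH_spread hR).trans (le_trans (dimH_mono ?_) (hg.dimH_image_le S))
    rintro _ ⟨e, -, rfl⟩
    exact ⟨_, h R e, hg' _⟩
  have hlim : Tendsto (fun R : ℕ => ENNReal.ofReal (Real.logb 3 2 * (R / (R + 2)))) atTop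
      (𝓝 (ENNReal.ofReal (Real.logb 3 2 * 1))) := by
    refine (ENNReal.continuous_ofReal.tendsto _).comp (Tendsto.const_mul _ ?_)
    exact tendsto_natCast_div_add_atTop (2 : ℝ)
  rw [mul_one] at hlim
  exact le_of_tendsto hlim ((eventually_gt_atTop 0).mono hR)

/-- Points of `[0,1]` whose binary digits from position `n + 1` on start with a constant run of
length `n / 4 + 1`. -/
def longRunSet (n : ℕ) : Set ℝ :=
  ⋃ p ∈ Finset.range (2 ^ (n + 1)),
    Icc ((p : ℝ) / 2 ^ (n + 1)) ((p + (1 / 2) ^ (n / 4 + 1)) / 2 ^ (n + 1)) ∪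
    Icc ((p + 1 - (1 / 2) ^ (n / 4 + 1)) / 2 ^ (n + 1)) (((p : ℝ) + 1) / 2 ^ (n + 1))

theorem volume_longRunSet_le (n : ℕ) :
    volume (longRunSet n) ≤ ENNReal.ofReal ((1 / 2) ^ (n / 4)) := by
  have h1 : ∀ p : ℕ, volume (Icc ((p : ℝ) / 2 ^ (n + 1)) ((p + (1 / 2) ^ (n / 4 + 1)) / 2 ^ (n + 1)) ∪
      Icc ((p + 1 - (1 / 2) ^ (n / 4 + 1)) / 2 ^ (n + 1)) (((p : ℝ) + 1) / 2 ^ (n + 1))) ≤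
      ENNReal.ofReal ((1 / 2) ^ (n / 4) / 2 ^ (n + 1)) := by
    intro p
    refine (measure_union_le _ _).trans ?_
    rw [Real.volume_Icc, Real.volume_Icc, ← sub_div, ← sub_div, add_sub_cancel_left,
      sub_sub_cancel, ← ENNReal.ofReal_add (by positivity) (by positivity)]
    refine ENNReal.ofReal_le_ofReal (le_of_eq ?_)
    rw [pow_succ]; ring
  refine (measure_biUnion_finset_le _ _).trans ((Finset.sum_le_sum fun p _ => h1 p).trans ?_)
  rw [Finset.sum_const, Finset.card_range, nsmul_eq_mul, ← ENNReal.ofReal_natCast,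
    ← ENNReal.ofReal_mul (by positivity)]
  refine ENNReal.ofReal_le_ofReal (le_of_eq ?_)
  push_cast
  field_simp

theorem summable_half_pow_div_four : Summable fun n : ℕ => ((1 : ℝ) / 2) ^ (n / 4) := by
  refine Summable.of_nonneg_of_le (fun n => by positivity) (fun n => ?_)
    ((summable_geometric_of_lt_one (r := (9 / 10 : ℝ)) (by norm_num) (by norm_num)).mul_left
      ((10 / 9) ^ 3))
  have hn : n ≤ 4 * (n / 4) + 3 := by omega
  calc ((1 : ℝ) / 2) ^ (n / 4) ≤ ((9 / 10) ^ 4) ^ (n / 4) := by gcongr; norm_num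
    _ = (10 / 9) ^ 3 * (9 / 10) ^ (4 * (n / 4) + 3) := by rw [← pow_mul, pow_add]; ring
    _ ≤ _ := by
      gcongr ?_ * ?_
      exact pow_le_pow_of_le_one (by norm_num) (by norm_num) hn

theorem exists_bpre_two_eq (d : ℕ → Bool) (n : ℕ) :
    ∃ p : ℕ, p < 2 ^ n ∧ bpre 2 d n = (p : ℝ) / 2 ^ n := by
  induction n with
  | zero => exact ⟨0, by simp, by simp⟩
  | succ n ih =>
    obtain ⟨p, hp, h⟩ := ih
    refine ⟨2 * p + if d n then 1 else 0, by rw [pow_succ]; split_ifs <;> omega, ?_⟩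
    rw [bpre_succ, h, pow_succ]
    split_ifs
    · push_cast; field_simp; ring
    · push_cast; field_simp

theorem bsum_two_le_of_run {d : ℕ → Bool} {r : ℕ} (h : ∀ i < r, d i = false) :
    bsum 2 d ≤ (1 / 2) ^ r := by
  have h1 := abs_bsum_sub_le (b := 2) one_lt_two (d := d) (d' := fun _ => false) h
  have h2 : bsum 2 (fun _ => false) = 0 := by simp [bsum]
  rw [h2, sub_zero, abs_of_nonneg (bsum_nonneg one_lt_two _)] at h1
  rwa [one_div_pow]

theorem mem_longRunSet_of_false {d : ℕ → Bool} {n : ℕ} (h : ∀ i ≤ n / 4, d (n + 1 + i) = false) :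
    bsum 2 d ∈ longRunSet n := by
  obtain ⟨p, hp, hpe⟩ := exists_bpre_two_eq d (n + 1)
  refine mem_iUnion₂.2 ⟨p, Finset.mem_range.2 hp, Or.inl ?_⟩
  have h1 := bsum_nonneg one_lt_two fun i => d (n + 1 + i)
  have h2 := bsum_two_le_of_run (d := fun i => d (n + 1 + i)) (r := n / 4 + 1)
    fun i hi => h i (by omega)
  rw [bsum_eq_bpre_add one_lt_two d (n + 1), hpe, ← add_div]
  constructor <;> gcongr
  linarith

theorem mem_longRunSet_of_true {d : ℕ → Bool} {n : ℕ} (h : ∀ i ≤ n / 4, d (n + 1 + i) = true) :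
    bsum 2 d ∈ longRunSet n := by
  obtain ⟨p, hp, hpe⟩ := exists_bpre_two_eq d (n + 1)
  refine mem_iUnion₂.2 ⟨p, Finset.mem_range.2 hp, Or.inr ?_⟩
  have h1 := bsum_le_one one_lt_two fun i => d (n + 1 + i)
  have h2 := bsum_two_le_of_run (d := fun i => !d (n + 1 + i)) (r := n / 4 + 1)
    fun i hi => by rw [h i (by omega)]; rfl
  rw [bsum_not one_lt_two] at h2
  rw [bsum_eq_bpre_add one_lt_two d (n + 1), hpe, ← add_div]
  constructor <;> gcongr
  linarith

theorem one_le_volume_shortRuns :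
    1 ≤ volume (bsum 2 '' {d | ShortRuns (fun n => n / 4) d}) := by
  have hfin : ∑' n, volume (longRunSet n) ≠ ∞ := by
    refine ne_top_of_le_ne_top ?_ (ENNReal.tsum_le_tsum volume_longRunSet_le)
    rw [← ENNReal.ofReal_tsum_of_nonneg (fun n => by positivity) summable_half_pow_div_four]
    exact ENNReal.ofReal_ne_top
  have hae := ae_eventually_notMem hfin
  have : (1 : ℝ≥0∞) = volume (Icc (0 : ℝ) 1) := by simp
  rw [this]
  refine measure_mono_ae ?_
  filter_upwards [hae] with t ht ht01
  obtain ⟨d, rfl⟩ := surjOn_bsum_two ht01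
  refine ⟨d, ?_, rfl⟩
  filter_upwards [ht] with n hn
  constructor
  · by_contra! hcon
    exact hn (mem_longRunSet_of_true fun i hi => by simpa using hcon i hi)
  · by_contra! hcon
    exact hn (mem_longRunSet_of_false fun i hi => by simpa using hcon i hi)

theorem hausdorffMeasure_pos_of_shortRuns_subset {S : Set ℝ} (l : ℕ)
    (h : ∀ d, ShortRuns (fun n => n / 4) d → prependOnes l (bsum 3 d) ∈ S) :
    0 < μH[Real.logb 3 2] S := by
  have hs := logb_three_two_pos
  obtain ⟨f, hf, hf'⟩ := exists_holderOnWith_image (E := {d | ShortRuns (fun n => n / 4) d})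
    (C := 2) (r := (Real.logb 3 2).toNNReal) (p := bsum 3) (q := bsum 2)
    (Real.toNNReal_pos.2 hs) (fun d _ d' _ => by
      rw [Real.coe_toNNReal _ hs.le]
      exact abs_bsum_two_sub_le d d')
  have h1 := hf.hausdorffMeasure_image_le (Real.toNNReal_pos.2 hs) zero_le_one
  rw [hf', hausdorffMeasure_real, mul_one, Real.coe_toNNReal _ hs.le] at h1
  obtain ⟨g, hg, hg'⟩ := exists_lipschitzWith_leftInverse_prependOnes l
  have h2 := hg.hausdorffMeasure_image_le hs.le S
  have h3 : bsum 3 '' {d | ShortRuns (fun n => n / 4) d} ⊆ g '' S := by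
    rintro _ ⟨d, hd, rfl⟩
    exact ⟨_, h d hd, hg' _⟩
  rw [pos_iff_ne_zero]
  intro h0
  rw [h0, mul_zero] at h2
  have h4 : μH[Real.logb 3 2] (bsum 3 '' {d | ShortRuns (fun n => n / 4) d}) = 0 :=
    le_antisymm ((measure_mono h3).trans h2) zero_le
  rw [h4, mul_zero] at h1
  exact absurd (one_le_volume_shortRuns.trans h1) (by simp)

/-- Extension of a finite word by `false`. -/
def extendWord {n : ℕ} (w : Fin n → Bool) (i : ℕ) : Bool := if h : i < n then w ⟨i, h⟩ else false

theorem extendWord_restrict {n : ℕ} (d : ℕ → Bool) {i : ℕ} (hi : i < n) :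
    extendWord (fun j : Fin n => d j) i = d i := by simp [extendWord, hi]

theorem ofReal_rpow_logb_three_two (n : ℕ) :
    ENNReal.ofReal (1 / 3 ^ n) ^ Real.logb 3 2 = ENNReal.ofReal (1 / 2 ^ n) := by
  rw [ENNReal.ofReal_rpow_of_nonneg (by positivity) logb_three_two_pos.le,
    one_div_three_pow_rpow_logb]

theorem hausdorffMeasure_range_bsum_le_one : μH[Real.logb 3 2] (bsum 3 '' univ) ≤ 1 := by
  have hb : (1 : ℝ) < 3 := by norm_num
  let t : ∀ n : ℕ, (Fin n → Bool) → Set ℝ :=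
    fun n w => bsum 3 '' {d | ∀ i : Fin n, d i = w i}
  have ht : ∀ n w, Metric.ediam (t n w) ≤ ENNReal.ofReal (1 / 3 ^ n) := by
    intro n w
    refine Metric.ediam_le ?_
    rintro _ ⟨d, hd, rfl⟩ _ ⟨d', hd', rfl⟩
    rw [edist_dist, Real.dist_eq]
    exact ENNReal.ofReal_le_ofReal (abs_bsum_sub_le hb fun i hi =>
      (hd ⟨i, hi⟩).trans (hd' ⟨i, hi⟩).symm)
  have hr : Tendsto (fun n : ℕ => ENNReal.ofReal (1 / 3 ^ n)) atTop (𝓝 0) := by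
    have : Tendsto (fun n : ℕ => ((1 : ℝ) / 3) ^ n) atTop (𝓝 0) :=
      tendsto_pow_atTop_nhds_zero_of_lt_one (by norm_num) (by norm_num)
    simp only [one_div_pow] at this
    rw [← ENNReal.ofReal_zero]
    exact (ENNReal.continuous_ofReal.tendsto 0).comp this
  refine (Measure.hausdorffMeasure_le_liminf_sum _ _ _ hr t (Eventually.of_forall ht)
    (Eventually.of_forall fun n => ?_)).trans ?_
  · rintro _ ⟨d, -, rfl⟩
    exact mem_iUnion.2 ⟨fun i => d i, d, fun i => rfl, rfl⟩
  · refine liminf_le_of_le (by isBoundedDefault) fun b hbn => ?_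
    obtain ⟨n, hn⟩ := hbn.exists
    refine hn.trans ((Finset.sum_le_sum fun w _ =>
      ENNReal.rpow_le_rpow (ht n w) logb_three_two_pos.le).trans ?_)
    rw [ofReal_rpow_logb_three_two, Finset.sum_const, Finset.card_univ, Fintype.card_pi,
      Finset.prod_const, Fintype.card_bool, Finset.card_univ, Fintype.card_fin, nsmul_eq_mul,
      ← ENNReal.ofReal_natCast, ← ENNReal.ofReal_mul (by positivity)]
    push_cast
    rw [mul_one_div_cancel (by positivity), ENNReal.ofReal_one]

theorem lipschitzWith_add_div (a : ℝ) (n : ℕ) :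
    LipschitzWith (1 / 3 ^ n) fun z : ℝ => a + z / 3 ^ n := by
  refine LipschitzWith.of_dist_le_mul fun x y => le_of_eq ?_
  rw [Real.dist_eq, Real.dist_eq, add_sub_add_left_eq_sub, ← sub_div, abs_div,
    abs_of_pos (by positivity : (0 : ℝ) < 3 ^ n)]
  push_cast
  ring

theorem hausdorffMeasure_image_add_div_le (a : ℝ) (n : ℕ) (S : Set ℝ) :
    μH[Real.logb 3 2] ((fun z : ℝ => a + z / 3 ^ n) '' S) ≤
      ENNReal.ofReal (1 / 2 ^ n) * μH[Real.logb 3 2] S := by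
  refine ((lipschitzWith_add_div a n).hausdorffMeasure_image_le logb_three_two_pos.le S).trans
    (le_of_eq ?_)
  rw [← ofReal_rpow_logb_three_two]
  congr 2
  rw [← ENNReal.ofReal_coe_nnreal]
  congr 1

/-- Codes in which no `false` at position `n` is followed by `log₂ (N + n) + c` times `true`. -/
def NoLongGap (c N : ℕ) : Set (ℕ → Bool) :=
  {d | ∀ n, ¬ (d n = false ∧ ∀ i < Nat.log 2 (N + n) + c, d (n + 1 + i) = true)}

/-- The word `false, true, …, true` of length `L`. -/
def gapWord (L : ℕ) (i : Fin L) : Bool := decide (i.1 ≠ 0)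

theorem image_noLongGap_subset (c N : ℕ) :
    bsum 3 '' NoLongGap c N ⊆
      ⋃ u ∈ (Finset.univ.erase (gapWord (Nat.log 2 N + c + 1)) :
        Finset (Fin (Nat.log 2 N + c + 1) → Bool)),
        (fun z : ℝ => bpre 3 (extendWord u) (Nat.log 2 N + c + 1) + z / 3 ^ (Nat.log 2 N + c + 1)) ''
          (bsum 3 '' NoLongGap c (N + (Nat.log 2 N + c + 1))) := by
  rintro _ ⟨d, hd, rfl⟩
  set L := Nat.log 2 N + c + 1 with hL
  refine mem_iUnion₂.2 ⟨fun i : Fin L => d i, ?_, bsum 3 (fun i => d (L + i)),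
    ⟨fun i => d (L + i), ?_, rfl⟩, ?_⟩
  · rw [Finset.mem_erase]
    refine ⟨fun h => hd 0 ⟨?_, fun i hi => ?_⟩, Finset.mem_univ _⟩
    · have := congrFun h ⟨0, by omega⟩
      simpa [gapWord] using this
    · rw [add_zero] at hi
      have := congrFun h ⟨i + 1, by omega⟩
      rw [show 0 + 1 + i = i + 1 by omega]
      simpa [gapWord] using this
  · intro n hn
    refine hd (L + n) ⟨hn.1, fun i hi => ?_⟩
    rw [show L + n + 1 + i = L + (n + 1 + i) by omega]
    exact hn.2 i (by rwa [add_assoc])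
  · simp only
    rw [bsum_eq_bpre_add (by norm_num) d L]
    congr 1
    exact bpre_congr fun i hi => extendWord_restrict d hi

theorem hausdorffMeasure_noLongGap_le (c N : ℕ) :
    μH[Real.logb 3 2] (bsum 3 '' NoLongGap c N) ≤
      ENNReal.ofReal (1 - 1 / 2 ^ (Nat.log 2 N + c + 1)) *
        μH[Real.logb 3 2] (bsum 3 '' NoLongGap c (N + (Nat.log 2 N + c + 1))) := by
  refine (measure_mono (image_noLongGap_subset c N)).trans
    ((measure_biUnion_finset_le _ _).trans ?_)
  set L := Nat.log 2 N + c + 1 with hL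
  refine (Finset.sum_le_sum fun u _ => hausdorffMeasure_image_add_div_le _ L _).trans ?_
  rw [Finset.sum_const, Finset.card_erase_of_mem (Finset.mem_univ _), Finset.card_univ,
    Fintype.card_pi, Finset.prod_const, Fintype.card_bool, Finset.card_univ, Fintype.card_fin,
    nsmul_eq_mul, ← mul_assoc, ← ENNReal.ofReal_natCast, ← ENNReal.ofReal_mul (by positivity)]
  refine le_of_eq ?_
  congr 2
  rw [Nat.cast_sub Nat.one_le_two_pow]
  push_cast
  field_simp

theorem potential_step (c : ℕ) {M : ℕ} (hM : 1 ≤ M) :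
    (1 - 1 / 2 ^ (Nat.log 2 M + c + 1)) *
        (1 + Real.log (M + (Nat.log 2 M + c + 1 : ℕ))) ^ ((1 : ℝ) / (2 ^ (c + 1) * (c + 3))) ≤
      (1 + Real.log M) ^ ((1 : ℝ) / (2 ^ (c + 1) * (c + 3))) := by
  set L := Nat.log 2 M + c + 1 with hL
  set κ : ℝ := 1 / (2 ^ (c + 1) * (c + 3)) with hκ
  have hM' : (1 : ℝ) ≤ M := by exact_mod_cast hM
  have hlog : 0 ≤ Real.log M := Real.log_nonneg hM'
  have hL0 : (0 : ℝ) ≤ L := by positivity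
  have hκ0 : 0 ≤ κ := by positivity
  have hκ1 : κ ≤ 1 := by
    rw [hκ, div_le_one (by positivity)]
    have : (1 : ℝ) ≤ 2 ^ (c + 1) := one_le_pow₀ (by norm_num)
    have h2 : (0 : ℝ) ≤ c := by positivity
    nlinarith
  have h2L : (1 : ℝ) ≤ 2 ^ (c + 1) * (M * (1 / 2 ^ L)) := by
    have h1 : (2 : ℝ) ^ Nat.log 2 M ≤ M := by exact_mod_cast Nat.pow_log_le_self 2 (by omega)
    rw [mul_one_div, mul_div_assoc', le_div_iff₀ (by positivity), one_mul, hL, add_assoc,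
      pow_add 2 (Nat.log 2 M), mul_comm]
    exact mul_le_mul_of_nonneg_left h1 (by positivity)
  have hLle : (L : ℝ) ≤ (c + 3) * (1 + Real.log M) := by
    have h1 : (Nat.log 2 M : ℝ) ≤ Real.log M / Real.log 2 := by
      rw [le_div_iff₀ (Real.log_pos one_lt_two), ← Real.log_pow]
      refine Real.log_le_log (by positivity) ?_
      exact_mod_cast Nat.pow_log_le_self 2 (by omega)
    have h2 : Real.log M / Real.log 2 ≤ 2 * Real.log M := by
      rw [div_le_iff₀ (Real.log_pos one_lt_two)]
      have := Real.log_two_gt_d9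
      nlinarith
    have h3 : (0 : ℝ) ≤ c := by positivity
    rw [hL]; push_cast
    nlinarith
  have hM0 : (0 : ℝ) < M := by linarith
  have hstep : Real.log (M + L) ≤ Real.log M + L / M := by
    have : (M : ℝ) + L = M * (1 + L / M) := by field_simp
    rw [this, Real.log_mul (by positivity) (by positivity)]
    have := Real.log_le_sub_one_of_pos (by positivity : (0 : ℝ) < 1 + L / M)
    linarith
  have hpos : (0 : ℝ) < 1 + Real.log M := by linarith
  set s := L / M / (1 + Real.log M) with hs
  have hs0 : 0 ≤ s := by positivity
  have hratio : 1 + Real.log (M + L) ≤ (1 + Real.log M) * (1 + s) := by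
    have : (1 + Real.log M) * s = L / M := by rw [hs]; field_simp
    rw [mul_add, this]; linarith
  have hlogML : 0 ≤ Real.log (M + L) := Real.log_nonneg (by linarith)
  have hbern : (1 + s) ^ κ ≤ 1 + κ * s :=
    rpow_one_add_le_one_add_mul_self (by linarith) hκ0 hκ1
  have hκs : κ * s ≤ 1 / 2 ^ L := by
    have h1 : s ≤ (c + 3) / M := by
      rw [hs, div_le_iff₀ hpos, div_mul_eq_mul_div]
      gcongr
    calc κ * s ≤ κ * ((c + 3) / M) := by gcongr
      _ = 1 / (2 ^ (c + 1) * M) := by rw [hκ]; field_simp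
      _ ≤ 1 / 2 ^ L := by
        rw [div_le_iff₀ (by positivity)]
        linarith
  have hL1 : (1 : ℝ) / 2 ^ L ≤ 1 := by
    rw [div_le_one (by positivity)]; exact one_le_pow₀ (by norm_num)
  have hε0 : (0 : ℝ) ≤ 1 / 2 ^ L := by positivity
  calc (1 - 1 / 2 ^ L) * (1 + Real.log (M + L)) ^ κ
      ≤ (1 - 1 / 2 ^ L) * ((1 + Real.log M) * (1 + s)) ^ κ := by
        gcongr
    _ = (1 + Real.log M) ^ κ * ((1 - 1 / 2 ^ L) * (1 + s) ^ κ) := by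
        rw [Real.mul_rpow hpos.le (by linarith)]; ring
    _ ≤ (1 + Real.log M) ^ κ * ((1 - 1 / 2 ^ L) * (1 + 1 / 2 ^ L)) := by
        gcongr
        linarith
    _ ≤ (1 + Real.log M) ^ κ * 1 := by
        gcongr
        nlinarith
    _ = _ := mul_one _

theorem eq_zero_of_log_gap_recursion {c : ℕ} {h : ℕ → ℝ} (h0 : ∀ M, 0 ≤ h M) (h1 : ∀ M, h M ≤ 1)
    (hrec : ∀ M, h M ≤ (1 - 1 / 2 ^ (Nat.log 2 M + c + 1)) * h (M + (Nat.log 2 M + c + 1)))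
    {M : ℕ} (hM : 1 ≤ M) : h M = 0 := by
  set κ : ℝ := 1 / (2 ^ (c + 1) * (c + 3)) with hκ
  have hκ0 : 0 < κ := by positivity
  let E : ℕ → ℝ := fun M => (1 + Real.log M) ^ κ
  have hE : ∀ M, 1 ≤ M → 0 < E M := fun M hM =>
    Real.rpow_pos_of_pos (by have := Real.log_nonneg (x := M) (by exact_mod_cast hM); linarith) _
  have hiter : ∀ K : ℕ, ∃ M' ≥ K, 1 ≤ M' ∧ h M * E M' ≤ E M * h M' := by
    intro K
    induction K with
    | zero => exact ⟨M, Nat.zero_le _, hM, (mul_comm _ _).le⟩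
    | succ K ih =>
      obtain ⟨M', hK, hM', hle⟩ := ih
      set L := Nat.log 2 M' + c + 1 with hL
      refine ⟨M' + L, by omega, by omega, ?_⟩
      have hp := potential_step c hM'
      have hp' : (1 - 1 / 2 ^ L) * E (M' + L) ≤ E M' := by
        simp only [E]; push_cast [hL] at hp ⊢; exact hp
      have hr := hrec M'
      have hε : (0 : ℝ) < 1 - 1 / 2 ^ L := by
        rw [sub_pos, div_lt_one (by positivity)]
        exact one_lt_pow₀ (by norm_num) (by omega)
      have a1 : h M * ((1 - 1 / 2 ^ L) * E (M' + L)) ≤ E M * ((1 - 1 / 2 ^ L) * h (M' + L)) :=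
        calc _ ≤ h M * E M' := mul_le_mul_of_nonneg_left hp' (h0 M)
          _ ≤ E M * h M' := hle
          _ ≤ _ := mul_le_mul_of_nonneg_left hr (hE M hM).le
      refine le_of_mul_le_mul_left ?_ hε
      linarith
  by_contra hne
  have hpos : 0 < h M := lt_of_le_of_ne (h0 M) (Ne.symm hne)
  have hlim : Tendsto (fun n : ℕ => h M * E n) atTop atTop := by
    refine Tendsto.const_mul_atTop hpos ((tendsto_rpow_atTop hκ0).comp ?_)
    exact tendsto_atTop_add_const_left _ _ (Real.tendsto_log_atTop.comp tendsto_natCast_atTop_atTop)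
  obtain ⟨K, hK⟩ := eventually_atTop.1 (hlim.eventually_gt_atTop (E M))
  obtain ⟨M', hM'K, hM', hle⟩ := hiter K
  have := mul_le_mul_of_nonneg_left (h1 M') (hE M hM).le
  linarith [hK M' hM'K]

theorem hausdorffMeasure_noLongGap (c : ℕ) {N : ℕ} (hN : 1 ≤ N) :
    μH[Real.logb 3 2] (bsum 3 '' NoLongGap c N) = 0 := by
  have hle : ∀ M, μH[Real.logb 3 2] (bsum 3 '' NoLongGap c M) ≤ 1 := fun M =>
    (measure_mono (image_mono (subset_univ _))).trans hausdorffMeasure_range_bsum_le_one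
  have hfin : ∀ M, μH[Real.logb 3 2] (bsum 3 '' NoLongGap c M) ≠ ∞ := fun M =>
    ne_top_of_le_ne_top ENNReal.one_ne_top (hle M)
  have := eq_zero_of_log_gap_recursion (c := c)
    (h := fun M => (μH[Real.logb 3 2] (bsum 3 '' NoLongGap c M)).toReal)
    (fun M => ENNReal.toReal_nonneg) (fun M => ENNReal.toReal_mono ENNReal.one_ne_top (hle M))
    (fun M => by
      have h := ENNReal.toReal_mono (ENNReal.mul_ne_top ENNReal.ofReal_ne_top (hfin _))
        (hausdorffMeasure_noLongGap_le c M)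
      rwa [ENNReal.toReal_mul, ENNReal.toReal_ofReal] at h
      rw [sub_nonneg, div_le_one (by positivity)]
      exact one_le_pow₀ (by norm_num)) hN
  exact (ENNReal.toReal_eq_zero_iff _).1 this |>.resolve_right (hfin N)

theorem exists_floor_three_pow_succ {x : ℝ} (hx : x ≠ 1) (n : ℕ) :
    tDigit x n < 3 ∧ (⌊(3 : ℝ) ^ (n + 1) * x⌋ : ℝ) = 3 * ⌊(3 : ℝ) ^ n * x⌋ + tDigit x n := by
  set u := Int.fract ((3 : ℝ) ^ n * x) with hu
  have hu0 : 0 ≤ u := Int.fract_nonneg _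
  have hu1 : u < 1 := Int.fract_lt_one _
  have e : (3 : ℝ) ^ (n + 1) * x = ((3 * ⌊(3 : ℝ) ^ n * x⌋ : ℤ) : ℝ) + 3 * u := by
    have := Int.floor_add_fract ((3 : ℝ) ^ n * x)
    rw [← hu] at this
    push_cast
    rw [pow_succ]; linear_combination (-3) * this
  have e2 : ⌊(3 : ℝ) ^ (n + 1) * x⌋ = 3 * ⌊(3 : ℝ) ^ n * x⌋ + ⌊3 * u⌋ := by
    rw [e, Int.floor_intCast_add]
  have f0 : 0 ≤ ⌊3 * u⌋ := Int.floor_nonneg.2 (by linarith)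
  have f3 : ⌊3 * u⌋ < 3 := Int.floor_lt.2 (by push_cast; linarith)
  have ht : (tDigit x n : ℤ) = ⌊3 * u⌋ := by
    rw [tDigit, if_neg hx, e2, add_sub_cancel_left, Int.toNat_of_nonneg f0]
  refine ⟨by omega, ?_⟩
  rw [e2, ← ht]
  push_cast
  ring

theorem fract_eq_digit_add {x : ℝ} (hx : x ≠ 1) (n : ℕ) :
    Int.fract ((3 : ℝ) ^ n * x) = (tDigit x n + Int.fract ((3 : ℝ) ^ (n + 1) * x)) / 3 := by
  have h := (exists_floor_three_pow_succ hx n).2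
  have h1 := Int.floor_add_fract ((3 : ℝ) ^ n * x)
  have h2 := Int.floor_add_fract ((3 : ℝ) ^ (n + 1) * x)
  rw [pow_succ] at h h2 ⊢
  linarith

theorem phi_cylinder {x : ℝ} (hx : x ∈ Ico (0 : ℝ) 1) (n : ℕ) :
    ∀ v : ℝ, 0 ≤ v → v ≤ 1 → phi (⌊(3 : ℝ) ^ n * x⌋ / 3 ^ n + v / 3 ^ n) =
      phi (⌊(3 : ℝ) ^ n * x⌋ / 3 ^ n) + wa ^ (n - lCount x n) * wb ^ lCount x n * phi v := by
  induction n with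
  | zero =>
    intro v _ _
    have : ⌊(3 : ℝ) ^ 0 * x⌋ = 0 := by
      rw [Int.floor_eq_zero_iff, pow_zero, one_mul]; exact hx
    simp only [this]
    simp [phi_zero]
  | succ n ih =>
    intro v h0 h1
    obtain ⟨ht, hfl⟩ := exists_floor_three_pow_succ hx.2.ne n
    have ht' : (tDigit x n : ℝ) ≤ 2 := by exact_mod_cast Nat.le_of_lt_succ ht
    have ht0 : (0 : ℝ) ≤ tDigit x n := by positivity
    have e : ∀ v : ℝ, (⌊(3 : ℝ) ^ (n + 1) * x⌋ : ℝ) / 3 ^ (n + 1) + v / 3 ^ (n + 1) =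
        ⌊(3 : ℝ) ^ n * x⌋ / 3 ^ n + ((tDigit x n + v) / 3) / 3 ^ n := by
      intro v; rw [hfl, pow_succ]; field_simp; ring
    have e0 : (⌊(3 : ℝ) ^ (n + 1) * x⌋ : ℝ) / 3 ^ (n + 1) =
        ⌊(3 : ℝ) ^ n * x⌋ / 3 ^ n + ((tDigit x n + 0) / 3) / 3 ^ n := by
      rw [← e, zero_div, add_zero]
    have hl := lCount_le x n
    rw [e, e0, ih _ (by positivity) (by linarith), ih _ (by positivity) (by linarith),
      phi_branch h0 h1 ht, phi_branch le_rfl zero_le_one ht, phi_zero, lCount_succ]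
    split_ifs with h
    · rw [show n + 1 - (lCount x n + 1) = n - lCount x n by omega, pow_succ wb]
      ring
    · rw [add_zero, show n + 1 - lCount x n = n - lCount x n + 1 by omega, pow_succ wa]
      ring

theorem coeff_wa_pow_mul_wb_pow_mul (k M l : ℕ) (U : PowerSeries ℝ) :
    PowerSeries.coeff k (wa ^ M * wb ^ l * U) =
      if l ≤ k then (-2) ^ l * PowerSeries.coeff (k - l) (wa ^ M * U) else 0 := by
  have : wa ^ M * wb ^ l * U =
      PowerSeries.C ((-2 : ℝ) ^ l) * (PowerSeries.X ^ l * (wa ^ M * U)) := by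
    rw [wb, mul_pow, map_pow]; ring
  rw [this, PowerSeries.coeff_C_mul, PowerSeries.coeff_X_pow_mul']
  split_ifs
  · rfl
  · rw [mul_zero]

theorem coeff_wa_pow_pos {M i : ℕ} (h : i ≤ M) : 0 < PowerSeries.coeff i (wa ^ M) := by
  have h1 := two_pow_mul_coeff_wa_pow M i
  have h2 : (0 : ℝ) < M.choose i := by exact_mod_cast Nat.choose_pos h
  have h3 : 0 < (2 : ℝ) ^ M * PowerSeries.coeff i (wa ^ M) := by rw [h1]; positivity
  exact pos_of_mul_pos_right h3 (by positivity)

/-- Near `x`, the `k`-th coefficient of `phi` lies strictly on the side of its value at `x`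
prescribed by the sign `ε`. -/
def StrictAt (k : ℕ) (ε x : ℝ) : Prop :=
  ∃ δ > 0, ∀ y ∈ Icc (0 : ℝ) 1, |y - x| < δ →
    (x < y → 0 < ε * (PowerSeries.coeff k (phi y) - PowerSeries.coeff k (phi x))) ∧
    (y < x → 0 < ε * (PowerSeries.coeff k (phi x) - PowerSeries.coeff k (phi y)))

theorem strictAt_of_eventually {k : ℕ} {ε x : ℝ}
    (h : ∀ᶠ y in 𝓝[Icc 0 1 \ {x}] x,
      0 < ε * ((Mfun k (1 / 2) y - Mfun k (1 / 2) x) / (y - x))) : StrictAt k ε x := by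
  obtain ⟨δ, hδ, hball⟩ := Metric.mem_nhdsWithin_iff.1 h
  refine ⟨δ, hδ, fun y hy hyx => ?_⟩
  have hf : (0 : ℝ) < k.factorial := by positivity
  have key : y ≠ x → 0 < ε * ((k.factorial * (PowerSeries.coeff k (phi y) -
      PowerSeries.coeff k (phi x))) / (y - x)) := by
    intro hne
    have := hball ⟨by rwa [Metric.mem_ball, Real.dist_eq], hy, hne⟩
    simp only [mem_ofPred_eq, Mfun_half_eq, ← mul_sub] at this
    exact this
  constructor
  · intro hlt
    have h1 : 0 < y - x := by linarith
    have := mul_pos (key hlt.ne') h1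
    rw [mul_assoc, div_mul_cancel₀ _ h1.ne'] at this
    rw [mul_left_comm] at this
    exact pos_of_mul_pos_right this hf.le
  · intro hlt
    have h1 : 0 < x - y := by linarith
    have := mul_pos (key hlt.ne) h1
    have h2 : y - x ≠ 0 := by intro h; linarith
    have e : ε * ((k.factorial * (PowerSeries.coeff k (phi y) - PowerSeries.coeff k (phi x))) /
        (y - x)) * (x - y) = k.factorial * (ε * (PowerSeries.coeff k (phi x) -
          PowerSeries.coeff k (phi y))) := by
      field_simp; ring
    rw [e] at this
    exact pos_of_mul_pos_right this hf.le

theorem derivPInf.strictAt {k : ℕ} {x : ℝ} (h : derivPInf (Mfun k (1 / 2)) x) :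
    StrictAt k 1 x :=
  strictAt_of_eventually <| (h.eventually_gt_atTop 0).mono fun y hy => by rwa [one_mul]

theorem derivMInf.strictAt {k : ℕ} {x : ℝ} (h : derivMInf (Mfun k (1 / 2)) x) :
    StrictAt k (-1) x :=
  strictAt_of_eventually <| (h.eventually_lt_atBot 0).mono fun y hy => by linarith

theorem cylinder_left_add_fract {x : ℝ} (n : ℕ) :
    (⌊(3 : ℝ) ^ n * x⌋ : ℝ) / 3 ^ n + Int.fract ((3 : ℝ) ^ n * x) / 3 ^ n = x := by
  rw [← add_div, Int.floor_add_fract]; field_simp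

theorem cylinder_mem_Icc {x : ℝ} (hx : x ∈ Ico (0 : ℝ) 1) (n : ℕ) {v : ℝ} (hv : v ∈ Icc (0 : ℝ) 1) :
    (⌊(3 : ℝ) ^ n * x⌋ : ℝ) / 3 ^ n + v / 3 ^ n ∈ Icc (0 : ℝ) 1 := by
  have h3 : (0 : ℝ) < 3 ^ n := by positivity
  have h0 : 0 ≤ ⌊(3 : ℝ) ^ n * x⌋ := Int.floor_nonneg.2 (mul_nonneg h3.le hx.1)
  have h1 : ⌊(3 : ℝ) ^ n * x⌋ < 3 ^ n := Int.floor_lt.2 (by push_cast; nlinarith [hx.2])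
  have h0' : (0 : ℝ) ≤ ⌊(3 : ℝ) ^ n * x⌋ := by exact_mod_cast h0
  have h1' : (⌊(3 : ℝ) ^ n * x⌋ : ℝ) + 1 ≤ 3 ^ n := by exact_mod_cast h1
  rw [← add_div]
  refine ⟨div_nonneg (by linarith [hv.1]) h3.le, ?_⟩
  rw [div_le_one h3]; linarith [hv.2]

theorem StrictAt.eventually_pos {k : ℕ} {ε x : ℝ} (hx : x ∈ Ico (0 : ℝ) 1) (h : StrictAt k ε x) :
    ∀ᶠ n in atTop, 0 < ε * PowerSeries.coeff k (wa ^ (n - lCount x n) * wb ^ lCount x n * 1) ∧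
      ∀ v ∈ Icc (0 : ℝ) 1, Int.fract ((3 : ℝ) ^ n * x) < v →
        0 < ε * PowerSeries.coeff k (wa ^ (n - lCount x n) * wb ^ lCount x n *
          (phi v - phi (Int.fract ((3 : ℝ) ^ n * x)))) := by
  obtain ⟨δ, hδ, hδ'⟩ := h
  have hlim : Tendsto (fun n : ℕ => ((1 : ℝ) / 3) ^ n) atTop (𝓝 0) :=
    tendsto_pow_atTop_nhds_zero_of_lt_one (by norm_num) (by norm_num)
  filter_upwards [hlim.eventually_lt_const hδ] with n hn
  rw [one_div_pow] at hn
  have h3 : (0 : ℝ) < 3 ^ n := by positivity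
  set u := Int.fract ((3 : ℝ) ^ n * x) with hu
  have hu0 : 0 ≤ u := Int.fract_nonneg _
  have hu1 : u < 1 := Int.fract_lt_one _
  have hux : (⌊(3 : ℝ) ^ n * x⌋ : ℝ) / 3 ^ n + u / 3 ^ n = x := cylinder_left_add_fract n
  have hphix := phi_cylinder hx n u hu0 hu1.le
  rw [hux] at hphix
  have hright : ∀ v ∈ Icc (0 : ℝ) 1, u < v →
      0 < ε * PowerSeries.coeff k (wa ^ (n - lCount x n) * wb ^ lCount x n * (phi v - phi u)) := by
    intro v hv huv
    have hyx : (⌊(3 : ℝ) ^ n * x⌋ : ℝ) / 3 ^ n + v / 3 ^ n - x = (v - u) / 3 ^ n := by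
      rw [sub_div]; linarith
    have := (hδ' _ (cylinder_mem_Icc hx n hv) (by
      rw [hyx, abs_of_pos (div_pos (by linarith) h3)]
      refine lt_of_le_of_lt ?_ hn
      gcongr
      linarith [hv.2])).1 (by
        rw [← sub_pos, hyx]; exact div_pos (by linarith) h3)
    rw [phi_cylinder hx n v hv.1 hv.2, hphix, ← map_sub] at this
    convert this using 3
    ring
  refine ⟨?_, hright⟩
  have h1 := hright 1 ⟨zero_le_one, le_rfl⟩ hu1
  have h2 : 0 ≤ ε * PowerSeries.coeff k (wa ^ (n - lCount x n) * wb ^ lCount x n * phi u) := by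
    rcases hu0.eq_or_lt with hu0 | hu0
    · rw [← hu0, phi_zero, mul_zero, map_zero, mul_zero]
    have hyx : x - (⌊(3 : ℝ) ^ n * x⌋ : ℝ) / 3 ^ n = u / 3 ^ n := by linarith
    have hm := cylinder_mem_Icc hx n (v := 0) ⟨le_rfl, zero_le_one⟩
    rw [zero_div, add_zero] at hm
    have := (hδ' _ hm (by
      rw [abs_sub_comm, hyx, abs_of_pos (div_pos hu0 h3)]
      refine lt_of_le_of_lt ?_ hn
      gcongr)).2 (by
        rw [← sub_pos, hyx]; exact div_pos hu0 h3)
    rw [hphix, map_add, add_sub_cancel_left] at this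
    exact this.le
  rw [phi_one, mul_sub, map_sub, mul_sub] at h1
  linarith

theorem StrictAt.exists_lCount {k : ℕ} {ε x : ℝ} (hx : x ∈ Ico (0 : ℝ) 1) (h : StrictAt k ε x) :
    ∃ l ≤ k, (∀ᶠ n in atTop, lCount x n = l) := by
  have hle : ∀ᶠ n in atTop, lCount x n ≤ k := by
    filter_upwards [h.eventually_pos hx] with n hn
    by_contra hlt
    have := hn.1
    rw [coeff_wa_pow_mul_wb_pow_mul, if_neg hlt, mul_zero] at this
    exact lt_irrefl _ this
  obtain ⟨N, hN⟩ := eventually_atTop.1 hle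
  have hall : ∀ n, lCount x n ≤ k := fun n =>
    (lCount_mono x (le_max_left n N)).trans (hN _ (le_max_right n N))
  have hbdd : BddAbove (range (lCount x)) := ⟨k, by rintro _ ⟨n, rfl⟩; exact hall n⟩
  obtain ⟨n₀, hn₀⟩ := Nat.sSup_mem (range_nonempty (lCount x)) hbdd
  refine ⟨lCount x n₀, hall n₀, eventually_atTop.2 ⟨n₀, fun n hn => le_antisymm ?_ (lCount_mono x hn)⟩⟩
  rw [hn₀]
  exact le_csSup hbdd ⟨n, rfl⟩

theorem StrictAt.sign {k l : ℕ} {ε x : ℝ} (hx : x ∈ Ico (0 : ℝ) 1) (h : StrictAt k ε x)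
    (hl : ∀ᶠ n in atTop, lCount x n = l) : 0 < ε * (-2) ^ l := by
  obtain ⟨n, ⟨⟨hpos, -⟩, hn⟩, hge⟩ :=
    (((h.eventually_pos hx).and hl).and (eventually_ge_atTop (k + l))).exists
  rw [coeff_wa_pow_mul_wb_pow_mul, hn, mul_one] at hpos
  split_ifs at hpos with hlk
  · rw [← mul_assoc] at hpos
    exact pos_of_mul_pos_left hpos (coeff_wa_pow_pos (by omega)).le
  · simp at hpos

/-- The positions of the digit `2` in the ternary expansion of `x` after the first `N` digits. -/
noncomputable def tailWord (x : ℝ) (N i : ℕ) : Bool := decide (tDigit x (N + i) = 2)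

theorem eventually_tDigit_ne_one {x : ℝ} {l : ℕ} (hl : ∀ᶠ n in atTop, lCount x n = l) :
    ∃ N, ∀ n ≥ N, tDigit x n ≠ 1 := by
  obtain ⟨N, hN⟩ := eventually_atTop.1 hl
  refine ⟨N, fun n hn h => ?_⟩
  have h1 := lCount_succ x n
  rw [hN n hn, hN (n + 1) (by omega), if_pos h] at h1
  omega

theorem fract_eq_bsum_tailWord {x : ℝ} (hx : x ≠ 1) {N : ℕ} (h : ∀ n ≥ N, tDigit x n ≠ 1) :
    Int.fract ((3 : ℝ) ^ N * x) = bsum 3 (tailWord x N) := by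
  have hb : (1 : ℝ) < 3 := by norm_num
  have key : ∀ n N', N ≤ N' →
      |Int.fract ((3 : ℝ) ^ N' * x) - bsum 3 (tailWord x N')| ≤ (1 / 3) ^ n := by
    intro n
    induction n with
    | zero =>
      intro N' _
      rw [pow_zero, abs_le]
      constructor <;>
        linarith [Int.fract_nonneg ((3 : ℝ) ^ N' * x), Int.fract_lt_one ((3 : ℝ) ^ N' * x),
          bsum_nonneg hb (tailWord x N'), bsum_le_one hb (tailWord x N')]
    | succ n ih =>
      intro N' hN'
      have hd : (tDigit x N' : ℝ) = if tailWord x N' 0 then 3 - 1 else 0 := by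
        have h3 := (exists_floor_three_pow_succ hx N').1
        have h1 := h N' hN'
        rcases (by omega : tDigit x N' = 0 ∨ tDigit x N' = 2) with h | h <;>
          simp [tailWord, h]
        norm_num
      have ht : (fun i => tailWord x N' (i + 1)) = tailWord x (N' + 1) := by
        funext i
        simp only [tailWord]
        rw [show N' + (i + 1) = N' + 1 + i by ring]
      have := ih (N' + 1) (by omega)
      rw [fract_eq_digit_add hx, bsum_succ hb, ht, hd, ← sub_div, add_sub_add_left_eq_sub, abs_div,
        abs_of_pos (by norm_num : (0 : ℝ) < 3), pow_succ (1 / 3 : ℝ)]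
      linarith
  have hlim : Tendsto (fun n : ℕ => ((1 : ℝ) / 3) ^ n) atTop (𝓝 0) :=
    tendsto_pow_atTop_nhds_zero_of_lt_one (by norm_num) (by norm_num)
  have := ge_of_tendsto' hlim fun n => key n N le_rfl
  exact sub_eq_zero.1 (abs_nonpos_iff.1 this)

theorem two_mul_log_two_le (n : ℕ) : 2 * Nat.log 2 n ≤ n := by
  rcases Nat.eq_zero_or_pos n with rfl | hn
  · simp
  have h1 : 2 ^ Nat.log 2 n ≤ n := Nat.pow_log_le_self 2 hn.ne'
  generalize Nat.log 2 n = m at h1 ⊢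
  rcases m with _ | m
  · omega
  · have := Nat.lt_two_pow_self (n := m)
    rw [pow_succ] at h1
    omega

theorem exists_eventually_not_gap {k l : ℕ} (hlk : l < k) :
    ∃ c : ℕ, ∀ ε x : ℝ, x ∈ Ico (0 : ℝ) 1 → StrictAt k ε x →
      (∀ᶠ n in atTop, lCount x n = l) →
      ∀ᶠ n in atTop, ¬ (tDigit x n = 0 ∧ ∀ i < Nat.log 2 n + c, tDigit x (n + 1 + i) = 2) := by
  obtain ⟨A, hA0, hA⟩ := exists_abs_coeff_phi_le k
  obtain ⟨j, rfl⟩ : ∃ j, k = j + 1 + l := ⟨k - l - 1, by omega⟩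
  obtain ⟨c, hc⟩ := exists_coeff_gap_neg j (A := 1 + A) (by linarith)
  refine ⟨c, fun ε x hx h hl => ?_⟩
  have hsign := h.sign hx hl
  obtain ⟨N, hN⟩ := eventually_tDigit_ne_one hl
  filter_upwards [h.eventually_pos hx, hl, eventually_ge_atTop N,
    eventually_ge_atTop (2 * (c + 1 + l) + 2 * j + 1)] with n hpos hln hnN hn
  rintro ⟨h0, h2⟩
  have hlog := two_mul_log_two_le n
  set r := Nat.log 2 n + c with hr
  have hu := fract_eq_digit_add hx.2.ne n
  rw [h0, Nat.cast_zero, zero_add] at hu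
  have hv1 : Int.fract ((3 : ℝ) ^ (n + 1) * x) < 1 := Int.fract_lt_one _
  have hv0 : 0 ≤ Int.fract ((3 : ℝ) ^ (n + 1) * x) := Int.fract_nonneg _
  have hphi := phi_branch_left hv0 hv1.le
  rw [← hu] at hphi
  have hrun : 1 - phi (Int.fract ((3 : ℝ) ^ (n + 1) * x)) =
      wa ^ r * (1 - phi (bsum 3 fun i => tailWord x (n + 1) (r + i))) := by
    rw [fract_eq_bsum_tailWord hx.2.ne fun m hm => hN m (by omega)]
    exact one_sub_phi_bsum_run fun i hi => by simp [tailWord, h2 i hi]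
  have h23 : phi (2 / 3) = wa + wb := by
    have := phi_branch_right (x := 0) le_rfl zero_le_one
    rwa [add_zero, phi_zero, mul_zero, add_zero] at this
  have hlt := hpos.2 (2 / 3) ⟨by norm_num, by norm_num⟩ (by rw [hu]; linarith)
  have e : phi (2 / 3) - phi (Int.fract ((3 : ℝ) ^ n * x)) =
      wb + wa ^ (r + 1) * (1 - phi (bsum 3 fun i => tailWord x (n + 1) (r + i))) := by
    rw [h23, hphi, pow_succ wa]
    linear_combination wa * hrun
  rw [e, coeff_wa_pow_mul_wb_pow_mul, if_pos (by omega), hln, Nat.add_sub_cancel, ← mul_assoc] at hlt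
  have hneg := hc (n - l) r (by omega) (by omega) (by
    have h1 : n < 2 ^ (Nat.log 2 n + 1) := Nat.lt_pow_succ_log_self one_lt_two n
    calc 2 ^ c * (n - l) ≤ 2 ^ c * 2 ^ (Nat.log 2 n + 1) := by gcongr; omega
      _ = 2 ^ (r + 1) := by rw [← pow_add]; congr 1; omega)
    (1 - phi (bsum 3 fun i => tailWord x (n + 1) (r + i))) (fun i hi => by
      rw [map_sub]
      exact (abs_sub _ _).trans (add_le_add (abs_coeff_one_le i) (hA i (by omega) _)))
  exact absurd hlt (mul_neg_of_pos_of_neg hsign hneg).not_gt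

theorem hausdorffMeasure_logb_singleton (x : ℝ) : μH[Real.logb 3 2] ({x} : Set ℝ) = 0 := by
  have := Measure.nullSingletonClass_hausdorff ℝ logb_three_two_pos
  exact measure_singleton x

theorem mem_Ico_zero_one_or_eq_one {x : ℝ} (hx : x ∈ Icc (0 : ℝ) 1) : x ∈ Ico (0 : ℝ) 1 ∨ x = 1 :=
  hx.2.lt_or_eq.imp (fun h => ⟨hx.1, h⟩) id

theorem eventually_lCount_of_mem_FInf {k l : ℕ} {x : ℝ} (hx : x ∈ FInf k l) :
    ∀ᶠ n in atTop, lCount x n = l := iSup_lCount_eq_iff.1 hx.2.1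

theorem exists_strictAt_of_mem_FInf {k l : ℕ} {x : ℝ} (hx : x ∈ FInf k l) : ∃ ε, StrictAt k ε x :=
  hx.2.2.elim (fun h => ⟨_, h.strictAt⟩) fun h => ⟨_, h.strictAt⟩

theorem mem_image_tailWord {x : ℝ} (hx : x ≠ 1) {N : ℕ} (h : ∀ n ≥ N, tDigit x n ≠ 1)
    {S : Set (ℕ → Bool)} (hS : tailWord x N ∈ S) :
    x ∈ ⋃ (N : ℕ) (m : ℤ), (fun z : ℝ => (m : ℝ) / 3 ^ N + z / 3 ^ N) '' (bsum 3 '' S) := by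
  refine mem_iUnion₂.2 ⟨N, ⌊(3 : ℝ) ^ N * x⌋, _, mem_image_of_mem _ hS, ?_⟩
  simp only [← fract_eq_bsum_tailWord hx h]
  exact cylinder_left_add_fract N

theorem hausdorffMeasure_FInf_of_lt {k l : ℕ} (hlk : l < k) :
    μH[Real.logb 3 2] (FInf k l) = 0 := by
  obtain ⟨c, hc⟩ := exists_eventually_not_gap hlk
  have hsub : FInf k l ⊆ {1} ∪ ⋃ N' : ℕ, ⋃ (N : ℕ) (m : ℤ),
      (fun z : ℝ => (m : ℝ) / 3 ^ N + z / 3 ^ N) '' (bsum 3 '' NoLongGap c (N' + 1)) := by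
    intro x hx
    rcases mem_Ico_zero_one_or_eq_one hx.1 with hx1 | rfl
    swap
    · exact Or.inl rfl
    right
    obtain ⟨ε, hε⟩ := exists_strictAt_of_mem_FInf hx
    have hl := eventually_lCount_of_mem_FInf hx
    obtain ⟨N₁, hN₁⟩ := eventually_tDigit_ne_one hl
    obtain ⟨N₂, hN₂⟩ := eventually_atTop.1 (hc ε x hx1 hε hl)
    have h1 : ∀ n ≥ N₁ + N₂ + 1, tDigit x n ≠ 1 := fun n hn => hN₁ n (by omega)
    refine mem_iUnion.2 ⟨N₁ + N₂, mem_image_tailWord hx1.2.ne h1 ?_⟩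
    rintro n ⟨hn, hrun⟩
    simp only [tailWord, decide_eq_false_iff_not] at hn
    simp only [tailWord, decide_eq_true_eq] at hrun
    refine hN₂ (N₁ + N₂ + 1 + n) (by omega) ⟨?_, fun i hi => ?_⟩
    · have := h1 (N₁ + N₂ + 1 + n) (by omega)
      have := (exists_floor_three_pow_succ hx1.2.ne (N₁ + N₂ + 1 + n)).1
      omega
    · rw [← hrun i hi]
      congr 1
      ring
  refine measure_mono_null hsub (measure_union_null (hausdorffMeasure_logb_singleton 1) ?_)
  refine measure_iUnion_null fun N' => measure_iUnion_null fun N => measure_iUnion_null fun m => ?_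
  refine le_antisymm ((hausdorffMeasure_image_add_div_le _ _ _).trans_eq ?_) zero_le
  rw [hausdorffMeasure_noLongGap c (by omega), mul_zero]

theorem dimH_range_bsum_le : dimH (bsum 3 '' univ) ≤ ENNReal.ofReal (Real.logb 3 2) := by
  refine dimH_le_of_hausdorffMeasure_ne_top ?_
  rw [Real.coe_toNNReal _ logb_three_two_pos.le]
  exact ne_top_of_le_ne_top ENNReal.one_ne_top hausdorffMeasure_range_bsum_le_one

theorem dimH_FInf_le (k l : ℕ) : dimH (FInf k l) ≤ ENNReal.ofReal (Real.logb 3 2) := by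
  have hsub : FInf k l ⊆ {1} ∪ ⋃ (N : ℕ) (m : ℤ),
      (fun z : ℝ => (m : ℝ) / 3 ^ N + z / 3 ^ N) '' (bsum 3 '' univ) := by
    intro x hx
    rcases mem_Ico_zero_one_or_eq_one hx.1 with hx1 | rfl
    swap
    · exact Or.inl rfl
    right
    obtain ⟨N, hN⟩ := eventually_tDigit_ne_one (eventually_lCount_of_mem_FInf hx)
    exact mem_image_tailWord hx1.2.ne hN (mem_univ _)
  refine (dimH_mono hsub).trans ?_
  rw [dimH_union, dimH_singleton]
  refine max_le zero_le ?_
  simp only [dimH_iUnion]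
  exact iSup₂_le fun N m => ((lipschitzWith_add_div _ N).dimH_image_le _).trans dimH_range_bsum_le

theorem le_dimH_FInf {k l : ℕ} (hlk : l < k) :
    ENNReal.ofReal (Real.logb 3 2) ≤ dimH (FInf k l) := by
  obtain ⟨j, rfl⟩ : ∃ j, k = j + 1 + l := ⟨k - l - 1, by omega⟩
  exact le_dimH_of_spread_subset l fun R e =>
    (shortRuns_spread R e).prependOnes_mem_FInf (slopeGrows_succ j (R + 2)) l

theorem hausdorffMeasure_FInf_self_pos (k : ℕ) : 0 < μH[Real.logb 3 2] (FInf k k) :=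
  hausdorffMeasure_pos_of_shortRuns_subset k fun d hd => by
    simpa using hd.prependOnes_mem_FInf slopeGrows_zero k

theorem dimH_FInf {k l : ℕ} (hlk : l ≤ k) :
    dimH (FInf k l) = ENNReal.ofReal (Real.logb 3 2) := by
  refine le_antisymm (dimH_FInf_le k l) ?_
  rcases hlk.lt_or_eq with h | rfl
  · exact le_dimH_FInf h
  · refine le_dimH_of_hausdorffMeasure_ne_zero ?_
    rw [Real.coe_toNNReal _ logb_three_two_pos.le]
    exact (hausdorffMeasure_FInf_self_pos l).ne'

theorem hausdorffMeasure_null_of_strictAt {k : ℕ} {ε : ℝ} (hk : ε * (-2) ^ k ≤ 0) {S : Set ℝ}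
    (hS : ∀ x ∈ S, x ∈ Ioo (0 : ℝ) 1 ∧ StrictAt k ε x ∧
      (derivPInf (Mfun k (1 / 2)) x ∨ derivMInf (Mfun k (1 / 2)) x)) :
    μH[Real.logb 3 2] S = 0 := by
  have hsub : S ⊆ ⋃ l : Fin k, FInf k l := by
    intro x hx
    obtain ⟨hx1, hε, hd⟩ := hS x hx
    obtain ⟨l, hlk, hl⟩ := hε.exists_lCount (Ioo_subset_Ico_self hx1)
    have hlt : l < k := hlk.lt_of_ne fun h =>
      (hε.sign (Ioo_subset_Ico_self hx1) hl).not_ge (by rwa [h])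
    exact mem_iUnion.2 ⟨⟨l, hlt⟩, Ioo_subset_Icc_self hx1, iSup_lCount_eq_iff.2 hl, hd⟩
  exact measure_mono_null hsub (measure_iUnion_null fun l => hausdorffMeasure_FInf_of_lt l.2)

theorem hausdorffMeasure_derivPInf_null {k : ℕ} (hk : Odd k) :
    μH[Real.logb 3 2] {x ∈ Ioo (0 : ℝ) 1 | derivPInf (Mfun k (1 / 2)) x} = 0 :=
  hausdorffMeasure_null_of_strictAt (ε := 1)
    (by rw [hk.neg_pow, one_mul, neg_nonpos]; positivity)
    fun _ hx => ⟨hx.1, hx.2.strictAt, Or.inl hx.2⟩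

theorem hausdorffMeasure_derivMInf_null {k : ℕ} (hk : Even k) :
    μH[Real.logb 3 2] {x ∈ Ioo (0 : ℝ) 1 | derivMInf (Mfun k (1 / 2)) x} = 0 :=
  hausdorffMeasure_null_of_strictAt (ε := -1)
    (by rw [hk.neg_pow, neg_one_mul, neg_nonpos]; positivity)
    fun _ hx => ⟨hx.1, hx.2.strictAt, Or.inr hx.2⟩

theorem infinite_deriv_prependOnes {k : ℕ} {d : ℕ → Bool} (hd : ShortRuns (fun n => n / 4) d) :
    prependOnes k (bsum 3 d) ∈ Ioo (0 : ℝ) 1 ∧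
      (Even k → derivPInf (Mfun k (1 / 2)) (prependOnes k (bsum 3 d))) ∧
      (Odd k → derivMInf (Mfun k (1 / 2)) (prependOnes k (bsum 3 d))) := by
  have hz := ShortRuns.bsum_mem_Ioo (b := 3) hd (by norm_num)
  have := derivPInf.prependOnes hz (ShortRuns.derivPInf slopeGrows_zero hd) k
  rw [zero_add] at this
  exact ⟨prependOnes_mem_Ioo k hz, this⟩

theorem hausdorffMeasure_derivPInf_pos {k : ℕ} (hk : Even k) :
    0 < μH[Real.logb 3 2] {x ∈ Ioo (0 : ℝ) 1 | derivPInf (Mfun k (1 / 2)) x} :=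
  hausdorffMeasure_pos_of_shortRuns_subset k fun _ hd =>
    ⟨(infinite_deriv_prependOnes hd).1, (infinite_deriv_prependOnes hd).2.1 hk⟩

theorem hausdorffMeasure_derivMInf_pos {k : ℕ} (hk : Odd k) :
    0 < μH[Real.logb 3 2] {x ∈ Ioo (0 : ℝ) 1 | derivMInf (Mfun k (1 / 2)) x} :=
  hausdorffMeasure_pos_of_shortRuns_subset k fun _ hd =>
    ⟨(infinite_deriv_prependOnes hd).1, (infinite_deriv_prependOnes hd).2.2 hk⟩

/-- for `a = 1/2`, `k ≥ 1`, `s = log₃ 2`: `dim_H F^∞_{k,l} = s` for `l ≤ k`;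
`ℋ^s(F^∞_{k,l}) = 0` for `l < k` and `ℋ^s(F^∞_{k,k}) > 0`; consequently
`ℋ^s(D^{+∞}) > 0`, `ℋ^s(D^{-∞}) = 0` for even `k`, and the reverse for odd `k`. -/
theorem stmt16 (k : ℕ) (hk : 1 ≤ k) :
    (∀ l ≤ k, dimH (FInf k l) = ENNReal.ofReal (Real.logb 3 2)) ∧
    (∀ l < k, μH[Real.logb 3 2] (FInf k l) = 0) ∧
    0 < μH[Real.logb 3 2] (FInf k k) ∧
    (Even k →
      0 < μH[Real.logb 3 2] {x ∈ Set.Ioo (0:ℝ) 1 | derivPInf (Mfun k (1/2)) x} ∧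
      μH[Real.logb 3 2] {x ∈ Set.Ioo (0:ℝ) 1 | derivMInf (Mfun k (1/2)) x} = 0) ∧
    (Odd k →
      0 < μH[Real.logb 3 2] {x ∈ Set.Ioo (0:ℝ) 1 | derivMInf (Mfun k (1/2)) x} ∧
      μH[Real.logb 3 2] {x ∈ Set.Ioo (0:ℝ) 1 | derivPInf (Mfun k (1/2)) x} = 0) := by
  exact ⟨fun l hl => dimH_FInf hl, fun l hl => hausdorffMeasure_FInf_of_lt hl,
    hausdorffMeasure_FInf_self_pos k,
    fun h => ⟨hausdorffMeasure_derivPInf_pos h, hausdorffMeasure_derivMInf_null h⟩,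
    fun h => ⟨hausdorffMeasure_derivMInf_pos h, hausdorffMeasure_derivPInf_null h⟩⟩
end

section
/- Let a ∈ (1/2, 1), k ≥ 1, and let x ∈ (0,1) be such that l := sup_n l_n(x) < ∞ (the ternary expansion of x contains finitely many 1's). Define L_a⁺(x) := limsup_{n→∞} Σ_{j=1}^∞ a^j·δ₂(x_{n+j}), where δ₂(ξ) = 1 if ξ = 2 and δ₂(ξ) = 0 otherwise. If L_a⁺(x) < 1, then M_{k,a} has an infinite right derivative at x, namely (M_{k,a})'₊(x) = (−1)^l·∞. Conversely, if M_{k,a} has an infinite right derivative at x, then L_a⁺(x) ≤ 1, and the right derivative equals (−1)^l·∞. -/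
open Filter Topology MeasureTheory Set
open scoped ENNReal

/-- `f` has right derivative `+∞` at `x` (difference quotients over `y ∈ [0,1]`, `y > x`). -/
def rderivPInf (f : ℝ → ℝ) (x : ℝ) : Prop :=
  Tendsto (fun y => (f y - f x) / (y - x)) (𝓝[Set.Icc 0 1 ∩ Set.Ioi x] x) atTop

/-- `f` has right derivative `-∞` at `x`. -/
def rderivMInf (f : ℝ → ℝ) (x : ℝ) : Prop :=
  Tendsto (fun y => (f y - f x) / (y - x)) (𝓝[Set.Icc 0 1 ∩ Set.Ioi x] x) atBot

/-- `L_a⁺(x) = limsup_n Σ_{j≥1} a^j δ₂(x_{n+j})`. -/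
noncomputable def LaPlus (a x : ℝ) : ℝ :=
  Filter.limsup
    (fun n : ℕ => ∑' j : ℕ, a ^ (j + 1) * (if tDigit x (n + j) = 2 then (1:ℝ) else 0))
    atTop

/-- The factor contributed by the digit `d` to the slope of the Okamoto function. -/
def digitWeight {R : Type*} [CommRing R] (b : R) (d : ℕ) : R := if d = 1 then 1 - 2 * b else b

/-- The increment contributed by the digit `d` to the Okamoto function. -/
def digitOffset {R : Type*} [CommRing R] (b : R) (d : ℕ) : R :=
  if d = 0 then 0 else if d = 1 then b else 1 - b

/-- The `n`-th term of the series defining the Okamoto function on digit sequences. -/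
def okamotoTerm {R : Type*} [CommRing R] (b : R) (D : ℕ → ℕ) (n : ℕ) : R :=
  (∏ i ∈ Finset.range n, digitWeight b (D i)) * digitOffset b (D n)

/-- The Okamoto function as a function of the digit sequence. -/
noncomputable def okamotoSum {R : Type*} [CommRing R] [TopologicalSpace R]
    (b : R) (D : ℕ → ℕ) : R := ∑' n, okamotoTerm b D n

/-- The digit sequence `D` with its first `n` digits removed. -/
def digitShift (D : ℕ → ℕ) (n : ℕ) : ℕ → ℕ := fun i => D (n + i)

/-- The sequence of `m` digits `2` followed by zeros. -/
def leadingTwos (m : ℕ) : ℕ → ℕ := fun i => if i < m then 2 else 0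

lemma prod_digitWeight {R : Type*} [CommRing R] (b : R) (D : ℕ → ℕ) (n : ℕ) :
    ∏ i ∈ Finset.range n, digitWeight b (D i) =
      b ^ (n - ((Finset.range n).filter (fun i => D i = 1)).card) *
        (1 - 2 * b) ^ ((Finset.range n).filter (fun i => D i = 1)).card := by
  unfold digitWeight
  rw [Finset.prod_ite, Finset.prod_const, Finset.prod_const, mul_comm]
  congr 2
  have := Finset.card_filter_add_card_filter_not (s := Finset.range n) (fun i => D i = 1)
  rw [Finset.card_range] at this
  omega

lemma okamoto_eq_okamotoSum (b x : ℝ) : Okamoto b x = okamotoSum b (tDigit x) := by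
  unfold Okamoto okamotoSum okamotoTerm
  refine tsum_congr fun n => ?_
  rw [prod_digitWeight]
  rfl

section Norm

variable {𝕜 : Type*} [NormedField 𝕜] {b : 𝕜} {ρ : ℝ}

lemma norm_okamotoTerm_le (hρ : ρ < 1) (h1 : ‖b‖ ≤ ρ) (h2 : ‖1 - 2 * b‖ ≤ ρ) (D : ℕ → ℕ) (n : ℕ) :
    ‖okamotoTerm b D n‖ ≤ ρ ^ n * 2 := by
  have hρ0 : 0 ≤ ρ := (norm_nonneg b).trans h1
  unfold okamotoTerm
  rw [norm_mul]
  refine mul_le_mul ?_ ?_ (norm_nonneg _) (by positivity)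
  · rw [norm_prod]
    calc _ ≤ ∏ i ∈ Finset.range n, ρ := by
          refine Finset.prod_le_prod (fun _ _ => norm_nonneg _) fun i _ => ?_
          unfold digitWeight
          split_ifs <;> assumption
      _ = _ := by simp
  · unfold digitOffset
    split_ifs
    · simp
    · linarith
    · have := norm_sub_le (1 : 𝕜) b
      rw [norm_one] at this
      linarith

lemma summable_pow_mul_two (hρ0 : 0 ≤ ρ) (hρ : ρ < 1) : Summable fun n : ℕ => ρ ^ n * 2 :=
  (summable_geometric_of_lt_one hρ0 hρ).mul_right 2

lemma norm_okamotoSum_le (hρ : ρ < 1) (h1 : ‖b‖ ≤ ρ) (h2 : ‖1 - 2 * b‖ ≤ ρ) (D : ℕ → ℕ) :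
    ‖okamotoSum b D‖ ≤ (1 - ρ)⁻¹ * 2 := by
  have hρ0 : 0 ≤ ρ := (norm_nonneg b).trans h1
  exact tsum_of_norm_bounded ((hasSum_geometric_of_lt_one hρ0 hρ).mul_right 2)
    (norm_okamotoTerm_le hρ h1 h2 D)

variable [CompleteSpace 𝕜]

lemma summable_okamotoTerm (hρ : ρ < 1) (h1 : ‖b‖ ≤ ρ) (h2 : ‖1 - 2 * b‖ ≤ ρ) (D : ℕ → ℕ) :
    Summable (okamotoTerm b D) :=
  .of_norm_bounded (summable_pow_mul_two ((norm_nonneg b).trans h1) hρ)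
    (norm_okamotoTerm_le hρ h1 h2 D)

lemma okamotoSum_eq_sum_add (hρ : ρ < 1) (h1 : ‖b‖ ≤ ρ) (h2 : ‖1 - 2 * b‖ ≤ ρ)
    (D : ℕ → ℕ) (n : ℕ) :
    okamotoSum b D = ∑ i ∈ Finset.range n, okamotoTerm b D i +
      (∏ i ∈ Finset.range n, digitWeight b (D i)) * okamotoSum b (digitShift D n) := by
  have hs := summable_okamotoTerm hρ h1 h2 D
  unfold okamotoSum
  rw [← hs.sum_add_tsum_nat_add n, ← tsum_mul_left]
  congr 1
  refine tsum_congr fun i => ?_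
  simp only [okamotoTerm, digitShift]
  rw [add_comm i n, Finset.prod_range_add, mul_assoc]

lemma okamotoSum_sub_okamotoSum (hρ : ρ < 1) (h1 : ‖b‖ ≤ ρ) (h2 : ‖1 - 2 * b‖ ≤ ρ)
    {D E : ℕ → ℕ} {n : ℕ} (h : ∀ i < n, D i = E i) :
    okamotoSum b E - okamotoSum b D = (∏ i ∈ Finset.range n, digitWeight b (D i)) *
      (okamotoSum b (digitShift E n) - okamotoSum b (digitShift D n)) := by
  rw [okamotoSum_eq_sum_add hρ h1 h2 D n, okamotoSum_eq_sum_add hρ h1 h2 E n]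
  have e1 : ∏ i ∈ Finset.range n, digitWeight b (E i) =
      ∏ i ∈ Finset.range n, digitWeight b (D i) :=
    Finset.prod_congr rfl fun i hi => by rw [h i (Finset.mem_range.1 hi)]
  have e2 : ∑ i ∈ Finset.range n, okamotoTerm b E i = ∑ i ∈ Finset.range n, okamotoTerm b D i := by
    refine Finset.sum_congr rfl fun i hi => ?_
    rw [Finset.mem_range] at hi
    unfold okamotoTerm
    rw [h i hi]
    congr 1
    exact Finset.prod_congr rfl fun j hj => by rw [h j ((Finset.mem_range.1 hj).trans hi)]
  rw [e1, e2]
  ring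

end Norm

lemma okamotoSum_ofReal (b : ℝ) (D : ℕ → ℕ) : okamotoSum (b : ℂ) D = (okamotoSum b D : ℝ) := by
  unfold okamotoSum
  rw [Complex.ofReal_tsum]
  refine tsum_congr fun n => ?_
  unfold okamotoTerm
  push_cast
  congr 1
  · refine Finset.prod_congr rfl fun i _ => ?_
    unfold digitWeight
    split_ifs <;> push_cast <;> rfl
  · unfold digitOffset
    split_ifs <;> push_cast <;> rfl

section Values

variable {a : ℝ}

lemma okamotoSum_step (ha : 1 / 2 < a) (ha' : a < 1) (D : ℕ → ℕ) :
    okamotoSum a D = digitOffset a (D 0) + digitWeight a (D 0) * okamotoSum a (digitShift D 1) := by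
  have h1 : ‖a‖ ≤ a := by rw [Real.norm_eq_abs, abs_of_pos (by linarith)]
  have h2 : ‖1 - 2 * a‖ ≤ a := by rw [Real.norm_eq_abs, abs_le]; constructor <;> linarith
  rw [okamotoSum_eq_sum_add ha' h1 h2 D 1]
  simp [okamotoTerm]

lemma sum_okamotoTerm_mem_Icc (ha : 1 / 2 < a) (ha' : a < 1) (n : ℕ) (D : ℕ → ℕ) :
    ∑ i ∈ Finset.range n, okamotoTerm a D i ∈ Icc (0 : ℝ) 1 := by
  induction n generalizing D with
  | zero => simp
  | succ n ih =>
    have h := ih (digitShift D 1)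
    have e : ∑ i ∈ Finset.range (n + 1), okamotoTerm a D i = digitOffset a (D 0) +
        digitWeight a (D 0) * ∑ i ∈ Finset.range n, okamotoTerm a (digitShift D 1) i := by
      rw [Finset.sum_range_succ', Finset.mul_sum, add_comm]
      congr 1
      · simp [okamotoTerm]
      · refine Finset.sum_congr rfl fun i _ => ?_
        simp only [okamotoTerm, digitShift]
        rw [Finset.prod_range_succ', add_comm 1 i]
        simp only [add_comm 1]
        ring
    rw [e]
    obtain ⟨h0, h1⟩ := h
    unfold digitOffset digitWeight
    split_ifs <;> constructor <;> first | omega | nlinarith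

lemma okamotoSum_mem_Icc (ha : 1 / 2 < a) (ha' : a < 1) (D : ℕ → ℕ) :
    okamotoSum a D ∈ Icc (0 : ℝ) 1 := by
  have h1 : ‖a‖ ≤ a := by rw [Real.norm_eq_abs, abs_of_pos (by linarith)]
  have h2 : ‖1 - 2 * a‖ ≤ a := by rw [Real.norm_eq_abs, abs_le]; constructor <;> linarith
  exact isClosed_Icc.mem_of_tendsto (summable_okamotoTerm ha' h1 h2 D).hasSum.tendsto_sum_nat
    (Eventually.of_forall fun n => sum_okamotoTerm_mem_Icc ha ha' n D)

lemma one_sub_le_okamotoSum (ha : 1 / 2 < a) (ha' : a < 1) {D : ℕ → ℕ} (hD : D 0 ≠ 0) :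
    1 - a ≤ okamotoSum a D := by
  rw [okamotoSum_step ha ha' D]
  obtain ⟨h0, h1⟩ := okamotoSum_mem_Icc ha ha' (digitShift D 1)
  unfold digitOffset digitWeight
  rw [if_neg hD]
  split_ifs <;> nlinarith

lemma okamotoSum_le_of_zero (ha : 1 / 2 < a) (ha' : a < 1) {D : ℕ → ℕ} (hD : D 0 = 0) :
    okamotoSum a D ≤ a := by
  rw [okamotoSum_step ha ha' D, hD]
  obtain ⟨h0, h1⟩ := okamotoSum_mem_Icc ha ha' (digitShift D 1)
  simp [digitOffset, digitWeight]
  nlinarith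

lemma okamotoSum_leadingTwos (ha : 1 / 2 < a) (ha' : a < 1) (m : ℕ) :
    okamotoSum a (leadingTwos m) = 1 - a ^ m := by
  induction m with
  | zero => simp [okamotoSum, okamotoTerm, leadingTwos, digitOffset]
  | succ m ih =>
    have e : digitShift (leadingTwos (m + 1)) 1 = leadingTwos m := by
      funext i
      simp [digitShift, leadingTwos, add_comm 1 i]
    rw [okamotoSum_step ha ha', e, ih]
    simp [leadingTwos, digitOffset, digitWeight]
    ring

lemma okamotoSum_of_ne_one (ha : 1 / 2 < a) (ha' : a < 1) {D : ℕ → ℕ} (h0 : D 0 = 0)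
    (h : ∀ n, D n = 0 ∨ D n = 2) :
    okamotoSum a D = (1 - a) * ∑' j : ℕ, a ^ (j + 1) * (if D (1 + j) = 2 then (1 : ℝ) else 0) := by
  rw [okamotoSum_step ha ha', h0]
  simp only [digitOffset, digitWeight, okamotoSum, okamotoTerm, if_true, zero_add, zero_ne_one,
    if_false]
  rw [← tsum_mul_left, ← tsum_mul_left]
  refine tsum_congr fun j => ?_
  have e : ∏ i ∈ Finset.range j, (if digitShift D 1 i = 1 then 1 - 2 * a else a) = a ^ j := by
    rw [Finset.prod_congr rfl (g := fun _ => a), Finset.prod_const, Finset.card_range]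
    intro i _
    rw [if_neg]
    rcases h (1 + i) with h | h <;> simp [digitShift, h]
  rw [e]
  rcases h (1 + j) with h | h <;> simp [digitShift, h]
  ring

end Values

lemma norm_le_of_mem_ball {a : ℝ} (ha : 1 / 2 < a) (ha' : a < 1) {z : ℂ}
    (hz : z ∈ Metric.ball (a : ℂ) ((1 - a) / 4)) :
    ‖z‖ ≤ (1 + a) / 2 ∧ ‖1 - 2 * z‖ ≤ (1 + a) / 2 := by
  rw [mem_ball_iff_norm] at hz
  have e1 : ‖(a : ℂ)‖ = a := by rw [Complex.norm_real, Real.norm_eq_abs, abs_of_pos (by linarith)]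
  have e2 : ‖(1 - 2 * a : ℂ)‖ = 2 * a - 1 := by
    have : (1 - 2 * a : ℂ) = ((1 - 2 * a : ℝ) : ℂ) := by push_cast; rfl
    rw [this, Complex.norm_real, Real.norm_eq_abs, abs_of_neg (by linarith)]
    ring
  constructor
  · have := norm_add_le (z - a) (a : ℂ)
    rw [sub_add_cancel] at this
    linarith
  · have := norm_sub_le (1 - 2 * a : ℂ) (2 * (z - a))
    have e : (1 - 2 * a : ℂ) - 2 * (z - a) = 1 - 2 * z := by ring
    rw [e, e2, norm_mul, Complex.norm_ofNat] at this
    linarith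

lemma ofReal_mem_ball {a b r : ℝ} : (b : ℂ) ∈ Metric.ball (a : ℂ) r ↔ b ∈ Metric.ball a r := by
  rw [Metric.mem_ball, Metric.mem_ball, Complex.dist_of_im_eq (by simp)]
  simp

lemma norm_le_of_mem_ball_real {a : ℝ} (ha : 1 / 2 < a) (ha' : a < 1) {b : ℝ}
    (hb : b ∈ Metric.ball a ((1 - a) / 4)) :
    ‖b‖ ≤ (1 + a) / 2 ∧ ‖1 - 2 * b‖ ≤ (1 + a) / 2 := by
  have h := norm_le_of_mem_ball ha ha' (ofReal_mem_ball.2 hb)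
  refine ⟨by simpa using h.1, ?_⟩
  have e : (1 - 2 * b : ℂ) = ((1 - 2 * b : ℝ) : ℂ) := by push_cast; rfl
  rw [← Complex.norm_real, ← e]
  exact h.2

lemma differentiableOn_okamotoSum {a : ℝ} (ha : 1 / 2 < a) (ha' : a < 1) (D : ℕ → ℕ) :
    DifferentiableOn ℂ (fun z => okamotoSum z D) (Metric.ball (a : ℂ) ((1 - a) / 4)) := by
  refine Complex.differentiableOn_tsum_of_summable_norm
    (summable_pow_mul_two (ρ := (1 + a) / 2) (by linarith) (by linarith)) (fun n => ?_)
    Metric.isOpen_ball fun n z hz => ?_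
  · refine Differentiable.differentiableOn ?_
    unfold okamotoTerm
    refine Differentiable.mul (Differentiable.fun_finsetProd fun i _ => ?_) ?_
    · unfold digitWeight
      split_ifs <;> fun_prop
    · unfold digitOffset
      split_ifs <;> fun_prop
  · obtain ⟨h1, h2⟩ := norm_le_of_mem_ball ha ha' hz
    exact norm_okamotoTerm_le (by linarith) h1 h2 D n

section RealRestriction

variable {G : ℂ → ℂ} {f : ℝ → ℝ} {a r : ℝ}

lemma iteratedDeriv_eq_re (hG : DifferentiableOn ℂ G (Metric.ball (a : ℂ) r))
    (hf : ∀ b ∈ Metric.ball a r, f b = (G b).re) (j : ℕ) :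
    ∀ b ∈ Metric.ball a r, iteratedDeriv j f b = (iteratedDeriv j G b).re := by
  induction j with
  | zero => simpa using hf
  | succ j ih =>
    intro b hb
    have hGb : AnalyticAt ℂ G b := hG.analyticAt (Metric.isOpen_ball.mem_nhds (ofReal_mem_ball.2 hb))
    have hd : DifferentiableAt ℂ (iteratedDeriv j G) b := by
      rw [iteratedDeriv_eq_iterate]
      exact (hGb.iterated_deriv j).differentiableAt
    rw [iteratedDeriv_succ, iteratedDeriv_succ]
    have hev : iteratedDeriv j f =ᶠ[𝓝 b] fun b => (iteratedDeriv j G b).re :=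
      Filter.eventually_of_mem (Metric.isOpen_ball.mem_nhds hb) ih
    rw [hev.deriv_eq]
    exact hd.hasDerivAt.real_of_complex.deriv

lemma contDiffAt_of_eq_re (hr : 0 < r) (hG : DifferentiableOn ℂ G (Metric.ball (a : ℂ) r))
    (hf : ∀ b ∈ Metric.ball a r, f b = (G b).re) (k : ℕ) : ContDiffAt ℝ k f a := by
  have hGa : AnalyticAt ℂ G a :=
    hG.analyticAt (Metric.isOpen_ball.mem_nhds (Metric.mem_ball_self hr))
  exact (hGa.contDiffAt.real_of_complex).congr_of_eventuallyEq
    (Filter.eventually_of_mem (Metric.ball_mem_nhds a hr) hf)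

lemma abs_iteratedDeriv_le_of_eq_re (hr : 0 < r)
    (hG : DifferentiableOn ℂ G (Metric.ball (a : ℂ) r))
    (hf : ∀ b ∈ Metric.ball a r, f b = (G b).re) {C : ℝ}
    (hC : ∀ z ∈ Metric.ball (a : ℂ) r, ‖G z‖ ≤ C) (j : ℕ) :
    |iteratedDeriv j f a| ≤ j.factorial * C / (r / 2) ^ j := by
  rw [iteratedDeriv_eq_re hG hf j a (Metric.mem_ball_self hr)]
  refine (Complex.abs_re_le_norm _).trans ?_
  have hsub : Metric.closedBall (a : ℂ) (r / 2) ⊆ Metric.ball (a : ℂ) r :=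
    Metric.closedBall_subset_ball (by linarith)
  refine Complex.norm_iteratedDeriv_le_of_forall_mem_sphere_norm_le j (by linarith) ?_
    fun z hz => hC z (hsub (Metric.sphere_subset_closedBall hz))
  exact (hG.mono hsub).diffContOnCl_ball subset_rfl

end RealRestriction

lemma contDiffAt_okamotoSum {a : ℝ} (ha : 1 / 2 < a) (ha' : a < 1) (k : ℕ) (D : ℕ → ℕ) :
    ContDiffAt ℝ k (fun b => okamotoSum b D) a :=
  contDiffAt_of_eq_re (by linarith) (differentiableOn_okamotoSum ha ha' D)
    (fun b _ => by rw [okamotoSum_ofReal, Complex.ofReal_re]) k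

lemma exists_bound_iteratedDeriv {a : ℝ} (ha : 1 / 2 < a) (ha' : a < 1) (k l : ℕ) :
    ∃ B > 0, ∀ D E : ℕ → ℕ,
      ContDiffAt ℝ k (fun b : ℝ => (2 * b - 1) ^ l * (okamotoSum b E - okamotoSum b D)) a ∧
      ∀ j ≤ k, |iteratedDeriv j
        (fun b : ℝ => (2 * b - 1) ^ l * (okamotoSum b E - okamotoSum b D)) a| ≤ B := by
  set r := (1 - a) / 4 with hr
  set ρ := (1 + a) / 2 with hρ
  have hr0 : 0 < r := by rw [hr]; linarith
  have hρ1 : ρ < 1 := by rw [hρ]; linarith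
  set C := (1 - ρ)⁻¹ * 2 + (1 - ρ)⁻¹ * 2 with hCdef
  have hC0 : 0 < C := by
    have : 0 < (1 - ρ)⁻¹ := inv_pos.2 (by linarith)
    positivity
  refine ⟨∑ j ∈ Finset.range (k + 1), (j.factorial * C / (r / 2) ^ j), ?_, fun D E => ?_⟩
  · exact Finset.sum_pos (fun j _ => by positivity) (by simp)
  · have hG : DifferentiableOn ℂ
        (fun z : ℂ => (2 * z - 1) ^ l * (okamotoSum z E - okamotoSum z D))
        (Metric.ball (a : ℂ) r) := by
      refine DifferentiableOn.mul (by fun_prop) ?_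
      exact (differentiableOn_okamotoSum ha ha' E).sub (differentiableOn_okamotoSum ha ha' D)
    have hf : ∀ b ∈ Metric.ball a r, (2 * b - 1) ^ l * (okamotoSum b E - okamotoSum b D) =
        ((2 * (b : ℂ) - 1) ^ l * (okamotoSum (b : ℂ) E - okamotoSum (b : ℂ) D)).re := by
      intro b _
      rw [okamotoSum_ofReal, okamotoSum_ofReal, ← Complex.ofReal_re
        ((2 * b - 1) ^ l * (okamotoSum b E - okamotoSum b D))]
      push_cast
      rfl
    have hC : ∀ z ∈ Metric.ball (a : ℂ) r,
        ‖(2 * z - 1) ^ l * (okamotoSum z E - okamotoSum z D)‖ ≤ C := by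
      intro z hz
      obtain ⟨h1, h2⟩ := norm_le_of_mem_ball ha ha' hz
      rw [norm_mul, norm_pow, norm_sub_rev, ← one_mul C]
      refine mul_le_mul (pow_le_one₀ (norm_nonneg _) (h2.trans hρ1.le)) ?_ (norm_nonneg _)
        zero_le_one
      exact (norm_sub_le _ _).trans
        (add_le_add (norm_okamotoSum_le hρ1 h1 h2 E) (norm_okamotoSum_le hρ1 h1 h2 D))
    refine ⟨contDiffAt_of_eq_re hr0 hG hf k, fun j hj => ?_⟩
    refine (abs_iteratedDeriv_le_of_eq_re hr0 hG hf hC j).trans ?_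
    exact Finset.single_le_sum (f := fun j : ℕ => (j.factorial * C / (r / 2) ^ j))
      (fun j _ => by positivity) (Finset.mem_range.2 (by omega))

lemma descFactorial_mul_le {i k m : ℕ} (hik : i < k) (hkm : k ≤ m) :
    m.descFactorial i * (m - k + 1) ≤ m.descFactorial k := by
  induction k, hik using Nat.le_induction with
  | base =>
    rw [Nat.descFactorial_succ, mul_comm]
    exact Nat.mul_le_mul_right _ (by omega)
  | succ k hik ih =>
    have h := ih (by omega)
    rw [Nat.descFactorial_succ]
    calc _ ≤ m.descFactorial i * (m - k + 1) := Nat.mul_le_mul_left _ (by omega)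
      _ ≤ m.descFactorial k := h
      _ ≤ _ := Nat.le_mul_of_pos_left _ (by omega)

lemma exists_le_iteratedDeriv_pow_mul {a : ℝ} (ha : 0 < a) (ha' : a < 1) (k : ℕ) {B : ℝ}
    (_hB : 0 < B) {ε : ℝ} (hε : 0 < ε) :
    ∃ N : ℕ, ∀ m ≥ N, ∀ H : ℝ → ℝ, ContDiffAt ℝ k H a →
      (∀ j ≤ k, |iteratedDeriv j H a| ≤ B) → ε ≤ H a →
      ε / 2 * a ^ m ≤ iteratedDeriv k (fun b => b ^ m * H b) a := by
  obtain ⟨N, hN⟩ := exists_nat_gt (k * 2 ^ k * B / a ^ k / (ε / 2))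
  refine ⟨N + k, fun m hm H hH hHB hHε => ?_⟩
  have hkm : k ≤ m := by omega
  set F : ℝ := (m.descFactorial k : ℝ) with hF
  have hF1 : 1 ≤ F := by
    rw [hF]
    exact_mod_cast Nat.pos_of_ne_zero (by rw [Ne, Nat.descFactorial_eq_zero_iff_lt]; omega)
  have hmk : (0 : ℝ) < (m - k : ℕ) + 1 := by positivity
  rw [iteratedDeriv_fun_mul (f := fun b => b ^ m) (by fun_prop) hH, Finset.sum_range_succ]
  simp only [iteratedDeriv_pow, Nat.choose_self, Nat.cast_one, one_mul, Nat.sub_self,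
    iteratedDeriv_zero]
  have hterm : ∀ i ∈ Finset.range k, -(2 ^ k * (F / ((m - k : ℕ) + 1)) * (a ^ (m - k)) * B) ≤
      (k.choose i : ℝ) * (m.descFactorial i * a ^ (m - i)) * iteratedDeriv (k - i) H a := by
    intro i hi
    rw [Finset.mem_range] at hi
    refine neg_le_of_abs_le ?_
    rw [abs_mul, abs_of_nonneg (by positivity : (0 : ℝ) ≤
      (k.choose i : ℝ) * (m.descFactorial i * a ^ (m - i)))]
    refine mul_le_mul ?_ (hHB _ (by omega)) (abs_nonneg _) (by positivity)
    rw [mul_assoc]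
    refine mul_le_mul ?_ (mul_le_mul ?_ ?_ (by positivity) (by positivity)) (by positivity)
      (by positivity)
    · exact_mod_cast Nat.choose_le_two_pow k i
    · rw [le_div_iff₀ hmk, hF]
      exact_mod_cast descFactorial_mul_le hi hkm
    · exact pow_le_pow_of_le_one ha.le ha'.le (by omega)
  have hsum := Finset.card_nsmul_le_sum _ _ _ hterm
  rw [Finset.card_range, nsmul_eq_mul] at hsum
  have hNm : (N : ℝ) ≤ (m - k : ℕ) + 1 := by exact_mod_cast (by omega : N ≤ m - k + 1)
  have hsmall : k * 2 ^ k * B / ((m - k : ℕ) + 1) ≤ ε / 2 := by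
    rw [div_div, div_lt_iff₀ (by positivity)] at hN
    rw [div_le_iff₀ hmk]
    have h1 : a ^ k * (ε / 2) ≤ ε / 2 :=
      mul_le_of_le_one_left (by positivity) (pow_le_one₀ ha.le ha'.le)
    have h2 : (N : ℝ) * (a ^ k * (ε / 2)) ≤ ((m - k : ℕ) + 1) * (ε / 2) :=
      mul_le_mul hNm h1 (by positivity) hmk.le
    linarith
  have hpow : a ^ m ≤ F * a ^ (m - k) :=
    (pow_le_pow_of_le_one ha.le ha'.le (by omega : m - k ≤ m)).trans
      (le_mul_of_one_le_left (by positivity) hF1)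
  have hP : 0 < F * a ^ (m - k) := by positivity
  have hlead : F * a ^ (m - k) * ε ≤ F * a ^ (m - k) * H a := mul_le_mul_of_nonneg_left hHε hP.le
  have hrest : F * a ^ (m - k) * (k * 2 ^ k * B / ((m - k : ℕ) + 1)) ≤
      F * a ^ (m - k) * (ε / 2) := mul_le_mul_of_nonneg_left hsmall hP.le
  have hmain := mul_le_mul_of_nonneg_left hpow (by positivity : 0 ≤ ε / 2)
  have e : (k : ℝ) * -(2 ^ k * (F / ((m - k : ℕ) + 1)) * (a ^ (m - k)) * B) =
      -(F * a ^ (m - k) * (k * 2 ^ k * B / ((m - k : ℕ) + 1))) := by ring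
  rw [e] at hsum
  linarith

/-- If two digit sequences agree up to the place `n`, with `l` ones among the common digits,
and their tails have Okamoto values at distance at least `ε`, then the difference of their `k`-th
derivatives in the parameter has the sign `(-1) ^ l` and size at least of order `a ^ n`. -/
lemma exists_le_iteratedDeriv_okamotoSum_sub {a : ℝ} (ha : 1 / 2 < a) (ha' : a < 1) (k l : ℕ)
    {ε : ℝ} (hε : 0 < ε) :
    ∃ c > 0, ∃ N : ℕ, ∀ n ≥ N, ∀ D E : ℕ → ℕ, (∀ i < n, D i = E i) →
      ((Finset.range n).filter (fun i => D i = 1)).card = l →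
      ε ≤ okamotoSum a (digitShift E n) - okamotoSum a (digitShift D n) →
      c * a ^ n ≤ (-1) ^ l * (iteratedDeriv k (fun b => okamotoSum b E) a -
        iteratedDeriv k (fun b => okamotoSum b D) a) := by
  obtain ⟨B, hB, hBound⟩ := exists_bound_iteratedDeriv ha ha' k l
  have hpos : 0 < (2 * a - 1) ^ l := pow_pos (by linarith) l
  obtain ⟨N, hN⟩ := exists_le_iteratedDeriv_pow_mul (by linarith) ha' k hB (mul_pos hpos hε)
  refine ⟨(2 * a - 1) ^ l * ε / 2, by positivity, N + l, fun n hn D E hDE hl hgap => ?_⟩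
  obtain ⟨hcd, hb⟩ := hBound (digitShift D n) (digitShift E n)
  have key := hN (n - l) (by omega) _ hcd hb (mul_le_mul_of_nonneg_left hgap hpos.le)
  have hev : (fun b : ℝ => b ^ (n - l) * ((2 * b - 1) ^ l *
      (okamotoSum b (digitShift E n) - okamotoSum b (digitShift D n)))) =ᶠ[𝓝 a]
      fun b => (-1) ^ l * (okamotoSum b E - okamotoSum b D) := by
    filter_upwards [Metric.ball_mem_nhds a (by linarith : 0 < (1 - a) / 4)] with b hb
    obtain ⟨h1, h2⟩ := norm_le_of_mem_ball_real ha ha' hb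
    rw [okamotoSum_sub_okamotoSum (by linarith) h1 h2 hDE, prod_digitWeight, hl]
    have e : (2 * b - 1) ^ l = (-1) ^ l * (1 - 2 * b) ^ l := by rw [← mul_pow]; ring
    rw [e]
    ring
  rw [hev.iteratedDeriv_eq, iteratedDeriv_const_mul_field, iteratedDeriv_fun_sub
    (contDiffAt_okamotoSum ha ha' k E) (contDiffAt_okamotoSum ha ha' k D)] at key
  refine le_trans (mul_le_mul_of_nonneg_left ?_ (by positivity)) key
  exact pow_le_pow_of_le_one (by linarith) ha'.le (by omega)

section Digits

variable {x y : ℝ}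

lemma three_mul_floor_le (x : ℝ) (n : ℕ) :
    3 * ⌊(3 : ℝ) ^ n * x⌋ ≤ ⌊(3 : ℝ) ^ (n + 1) * x⌋ ∧
      ⌊(3 : ℝ) ^ (n + 1) * x⌋ ≤ 3 * ⌊(3 : ℝ) ^ n * x⌋ + 2 := by
  have h1 := Int.floor_le ((3 : ℝ) ^ n * x)
  have h2 := Int.lt_floor_add_one ((3 : ℝ) ^ n * x)
  have e : (3 : ℝ) ^ (n + 1) * x = 3 * (3 ^ n * x) := by ring
  constructor
  · rw [Int.le_floor, e]
    push_cast
    linarith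
  · rw [← Int.lt_add_one_iff, Int.floor_lt, e]
    push_cast
    linarith

lemma tDigit_eq_floor_sub (hx : x < 1) (n : ℕ) :
    (tDigit x n : ℤ) = ⌊(3 : ℝ) ^ (n + 1) * x⌋ - 3 * ⌊(3 : ℝ) ^ n * x⌋ := by
  unfold tDigit
  rw [if_neg hx.ne, Int.toNat_of_nonneg]
  have := (three_mul_floor_le x n).1
  omega

lemma tDigit_le_two (hx : x < 1) (n : ℕ) : tDigit x n ≤ 2 := by
  have h := tDigit_eq_floor_sub hx n
  have := (three_mul_floor_le x n).2
  omega

lemma floor_pow_mul_eq_of_le {n i : ℕ} (h : ⌊(3 : ℝ) ^ n * x⌋ = ⌊(3 : ℝ) ^ n * y⌋) (hi : i ≤ n) :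
    ⌊(3 : ℝ) ^ i * x⌋ = ⌊(3 : ℝ) ^ i * y⌋ := by
  induction n, hi using Nat.le_induction with
  | base => exact h
  | succ n hin ih =>
    apply ih
    have h1 := three_mul_floor_le x n
    have h2 := three_mul_floor_le y n
    omega

lemma tDigit_eq_of_floor_eq (hx : x < 1) (hy : y < 1) {n : ℕ}
    (h : ⌊(3 : ℝ) ^ n * x⌋ = ⌊(3 : ℝ) ^ n * y⌋) {i : ℕ} (hi : i < n) :
    tDigit x i = tDigit y i := by
  have h1 := tDigit_eq_floor_sub hx i
  have h2 := tDigit_eq_floor_sub hy i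
  have h3 := floor_pow_mul_eq_of_le h hi.le
  have h4 := floor_pow_mul_eq_of_le (i := i + 1) h hi
  omega

lemma sub_le_pow_of_floor_eq {n : ℕ} (h : ⌊(3 : ℝ) ^ n * x⌋ = ⌊(3 : ℝ) ^ n * y⌋) :
    y - x ≤ (1 / 3) ^ n := by
  have h1 := Int.floor_le ((3 : ℝ) ^ n * x)
  have h2 := Int.lt_floor_add_one ((3 : ℝ) ^ n * y)
  rw [← h] at h2
  rw [one_div, inv_pow, ← one_div, le_div_iff₀ (by positivity)]
  linarith

lemma exists_first_tDigit_lt (hx : 0 ≤ x) (hxy : x < y) (hy : y < 1) :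
    ∃ n : ℕ, ⌊(3 : ℝ) ^ n * x⌋ = ⌊(3 : ℝ) ^ n * y⌋ ∧ tDigit x n < tDigit y n := by
  classical
  have hex : ∃ n : ℕ, ⌊(3 : ℝ) ^ n * x⌋ ≠ ⌊(3 : ℝ) ^ n * y⌋ := by
    by_contra! hall
    obtain ⟨n, hn⟩ := exists_pow_lt_of_lt_one (sub_pos.2 hxy) (by norm_num : (1 / 3 : ℝ) < 1)
    have := sub_le_pow_of_floor_eq (hall n)
    linarith
  obtain ⟨n, hn⟩ : ∃ n, Nat.find hex = n + 1 := by
    refine Nat.exists_eq_succ_of_ne_zero fun h0 => ?_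
    have := Nat.find_spec hex
    rw [h0] at this
    refine this ?_
    rw [pow_zero, one_mul, one_mul, Int.floor_eq_zero_iff.2 ⟨hx, hxy.trans hy⟩,
      Int.floor_eq_zero_iff.2 ⟨hx.trans hxy.le, hy⟩]
  have hne := Nat.find_spec hex
  rw [hn] at hne
  have heq : ⌊(3 : ℝ) ^ n * x⌋ = ⌊(3 : ℝ) ^ n * y⌋ :=
    not_not.1 (Nat.find_min hex (by omega : n < Nat.find hex))
  refine ⟨n, heq, ?_⟩
  have hle : ⌊(3 : ℝ) ^ (n + 1) * x⌋ ≤ ⌊(3 : ℝ) ^ (n + 1) * y⌋ :=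
    Int.floor_le_floor (mul_le_mul_of_nonneg_left hxy.le (by positivity))
  have h1 := tDigit_eq_floor_sub (hxy.trans hy) n
  have h2 := tDigit_eq_floor_sub hy n
  omega

lemma floor_pow_mul_one_sub_of_le {j m : ℕ} (h : j ≤ m) :
    ⌊(3 : ℝ) ^ j * (1 - (1 / 3) ^ m)⌋ = 3 ^ j - 1 := by
  obtain ⟨t, rfl⟩ := Nat.exists_eq_add_of_le h
  have e : (3 : ℝ) ^ j * (1 - (1 / 3) ^ (j + t)) = 3 ^ j - (1 / 3) ^ t := by
    rw [pow_add, mul_sub, ← mul_assoc, ← mul_pow]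
    norm_num
  have h1 : ((1 : ℝ) / 3) ^ t ≤ 1 := pow_le_one₀ (by norm_num) (by norm_num)
  have h2 : (0 : ℝ) < (1 / 3) ^ t := by positivity
  rw [e, Int.floor_eq_iff]
  push_cast
  constructor <;> linarith

lemma floor_pow_mul_one_sub_of_ge {m t : ℕ} :
    ⌊(3 : ℝ) ^ (m + t) * (1 - (1 / 3) ^ m)⌋ = 3 ^ (m + t) - 3 ^ t := by
  have e : (3 : ℝ) ^ (m + t) * (1 - (1 / 3) ^ m) = ((3 ^ (m + t) - 3 ^ t : ℤ) : ℝ) := by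
    push_cast
    rw [pow_add, mul_sub, mul_one, mul_right_comm, ← mul_pow]
    norm_num
  rw [e, Int.floor_intCast]

lemma exists_digitShift_eq_leadingTwos (hx : x < 1) {n : ℕ} (hn : tDigit x n = 0)
    {m : ℕ} (hm : 1 ≤ m) :
    ∃ y, x < y ∧ y < 1 ∧ y - x ≤ (1 / 3) ^ n ∧ (∀ i < n, tDigit x i = tDigit y i) ∧
      digitShift (tDigit y) n = leadingTwos m := by
  set A := ⌊(3 : ℝ) ^ n * x⌋ with hA
  set z : ℝ := 1 - (1 / 3) ^ m with hz
  have hz1 : z < 1 := by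
    have : (0 : ℝ) < (1 / 3) ^ m := by positivity
    linarith
  have hz2 : 2 / 3 ≤ z := by
    have : ((1 : ℝ) / 3) ^ m ≤ (1 / 3) ^ 1 :=
      pow_le_pow_of_le_one (by norm_num) (by norm_num) hm
    linarith
  have h3 : (0 : ℝ) < 3 ^ n := by positivity
  set y : ℝ := (A + z) / 3 ^ n with hy
  have hy3 : (3 : ℝ) ^ n * y = A + z := by rw [hy]; field_simp
  have hfl : ∀ j : ℕ, ⌊(3 : ℝ) ^ (n + j) * y⌋ = 3 ^ j * A + ⌊(3 : ℝ) ^ j * z⌋ := by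
    intro j
    rw [pow_add, mul_right_comm, hy3]
    have : ((A : ℝ) + z) * 3 ^ j = ((3 ^ j * A : ℤ) : ℝ) + 3 ^ j * z := by push_cast; ring
    rw [this, Int.floor_intCast_add]
  have hfn : ⌊(3 : ℝ) ^ n * x⌋ = ⌊(3 : ℝ) ^ n * y⌋ := by
    have := hfl 0
    simp only [add_zero, pow_zero, one_mul] at this
    rw [this, Int.floor_eq_zero_iff.2 ⟨by linarith, hz1⟩, add_zero]
  have hxy : x < y := by
    have hd := tDigit_eq_floor_sub hx n
    rw [hn] at hd
    have h1 := Int.lt_floor_add_one ((3 : ℝ) ^ (n + 1) * x)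
    have h2 : ⌊(3 : ℝ) ^ (n + 1) * x⌋ = 3 * A := by push_cast at hd; linarith
    rw [h2] at h1
    push_cast at h1
    rw [pow_succ] at h1
    refine lt_of_mul_lt_mul_left (a := (3 : ℝ) ^ n) ?_ h3.le
    rw [hy3]
    linarith
  have hy1 : y < 1 := by
    have hA1 : A < 3 ^ n := by
      rw [hA, Int.floor_lt]
      push_cast
      nlinarith
    have hA2 : (A : ℝ) + 1 ≤ 3 ^ n := by exact_mod_cast hA1
    rw [hy, div_lt_one h3]
    linarith
  refine ⟨y, hxy, hy1, sub_le_pow_of_floor_eq hfn, fun i hi => tDigit_eq_of_floor_eq hx hy1 hfn hi,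
    funext fun j => ?_⟩
  have hd := tDigit_eq_floor_sub hy1 (n + j)
  rw [add_assoc, hfl, hfl] at hd
  unfold digitShift leadingTwos
  split_ifs with hj
  · rw [floor_pow_mul_one_sub_of_le hj.le, floor_pow_mul_one_sub_of_le (j := j + 1) hj] at hd
    zify
    rw [hd]
    ring
  · obtain ⟨t, rfl⟩ := Nat.exists_eq_add_of_le (not_lt.1 hj)
    rw [floor_pow_mul_one_sub_of_ge, add_assoc m t 1, floor_pow_mul_one_sub_of_ge] at hd
    zify
    rw [hd]
    ring

lemma not_eventually_tDigit_eq_two (hx : x < 1) (N : ℕ) : ∃ n ≥ N, tDigit x n ≠ 2 := by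
  by_contra! h
  have hstep : ∀ t : ℕ, 1 - Int.fract ((3 : ℝ) ^ (N + t) * x) =
      3 ^ t * (1 - Int.fract ((3 : ℝ) ^ N * x)) := by
    intro t
    induction t with
    | zero => simp
    | succ t ih =>
      have hd := tDigit_eq_floor_sub hx (N + t)
      rw [h _ (by omega)] at hd
      have hd' : ((2 : ℕ) : ℝ) = ⌊(3 : ℝ) ^ (N + t + 1) * x⌋ - 3 * ⌊(3 : ℝ) ^ (N + t) * x⌋ := by
        exact_mod_cast hd
      rw [pow_succ (3 : ℝ) t, mul_right_comm, ← ih]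
      unfold Int.fract
      rw [← add_assoc]
      push_cast at hd'
      have e : (3 : ℝ) ^ (N + t + 1) * x = 3 * (3 ^ (N + t) * x) := by ring
      rw [← sub_eq_zero]
      linear_combination -e - hd'
  have hpos : 0 < 1 - Int.fract ((3 : ℝ) ^ N * x) := sub_pos.2 (Int.fract_lt_one _)
  obtain ⟨t, ht⟩ := pow_unbounded_of_one_lt (1 / (1 - Int.fract ((3 : ℝ) ^ N * x)))
    (by norm_num : (1 : ℝ) < 3)
  rw [div_lt_iff₀ hpos, ← hstep] at ht
  have := Int.fract_nonneg ((3 : ℝ) ^ (N + t) * x)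
  linarith

lemma exists_forall_tDigit_ne_one {l : ℕ} (hl : ∀ᶠ n in atTop, lCount x n = l) :
    ∃ N, ∀ n ≥ N, lCount x n = l ∧ tDigit x n ≠ 1 := by
  obtain ⟨N, hN⟩ := eventually_atTop.1 hl
  refine ⟨N, fun n hn => ⟨hN n hn, fun h1 => ?_⟩⟩
  have h2 := hN (n + 1) (by omega)
  have h3 := hN n hn
  unfold lCount at h2 h3
  rw [Finset.range_add_one, Finset.filter_insert, if_pos h1, Finset.card_insert_of_notMem (by simp),
    h3] at h2
  omega

end Digits

/-- The quantity `∑_{j ≥ 1} a ^ j δ₂(D (n + j))` whose upper limit is `LaPlus`. -/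
noncomputable def tailTwos (a : ℝ) (D : ℕ → ℕ) (n : ℕ) : ℝ :=
  ∑' j : ℕ, a ^ (j + 1) * (if D (n + j) = 2 then (1 : ℝ) else 0)

section TailTwos

variable {a : ℝ}

lemma summable_tailTwos (ha : 0 ≤ a) (ha' : a < 1) (D : ℕ → ℕ) (n : ℕ) :
    Summable fun j : ℕ => a ^ (j + 1) * (if D (n + j) = 2 then (1 : ℝ) else 0) := by
  refine Summable.of_nonneg_of_le (fun j => by split_ifs <;> positivity) (fun j => ?_)
    ((summable_geometric_of_lt_one ha ha').mul_left a)
  rw [pow_succ']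
  split_ifs
  · simp
  · rw [mul_zero]
    positivity

lemma tailTwos_nonneg (ha : 0 ≤ a) (D : ℕ → ℕ) (n : ℕ) : 0 ≤ tailTwos a D n :=
  tsum_nonneg fun j => by split_ifs <;> positivity

lemma tailTwos_le (ha : 0 ≤ a) (ha' : a < 1) (D : ℕ → ℕ) (n : ℕ) :
    tailTwos a D n ≤ a * (1 - a)⁻¹ := by
  refine (summable_tailTwos ha ha' D n).tsum_le_of_sum_le fun s => ?_
  refine le_trans (Finset.sum_le_sum (g := fun j => a * a ^ j) fun j _ => ?_) ?_
  · rw [pow_succ']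
    split_ifs
    · simp
    · rw [mul_zero]
      positivity
  · exact sum_le_hasSum s (fun j _ => by positivity)
      ((hasSum_geometric_of_lt_one ha ha').mul_left a)

lemma tailTwos_eq (ha : 0 ≤ a) (ha' : a < 1) (D : ℕ → ℕ) (n : ℕ) :
    tailTwos a D n = a * ((if D n = 2 then 1 else 0) + tailTwos a D (n + 1)) := by
  unfold tailTwos
  rw [(summable_tailTwos ha ha' D n).tsum_eq_zero_add, mul_add, ← tsum_mul_left]
  congr 1
  · simp
  · refine tsum_congr fun j => ?_
    rw [add_right_comm n 1 j, ← add_assoc, pow_succ']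
    ring

/-- Passing backwards over a digit `2` does not decrease `tailTwos`. -/
lemma tailTwos_succ_le (ha : 0 ≤ a) (ha' : a < 1) {D : ℕ → ℕ} {n : ℕ} (h : D n = 2) :
    tailTwos a D (n + 1) ≤ tailTwos a D n := by
  have h1 := tailTwos_le ha ha' D (n + 1)
  rw [← div_eq_mul_inv, le_div_iff₀ (by linarith)] at h1
  rw [tailTwos_eq ha ha' D n, if_pos h]
  linarith

lemma exists_zero_digit_lt_tailTwos (ha : 0 ≤ a) (ha' : a < 1) {D : ℕ → ℕ} {q : ℝ} {N : ℕ}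
    (hD : ∀ n ≥ N, D n = 0 ∨ D n = 2) (hN : D N = 0) (t : ℕ)
    (ht : q < tailTwos a D (N + t + 1)) : ∃ m ≥ N, D m = 0 ∧ q < tailTwos a D (m + 1) := by
  induction t with
  | zero => exact ⟨N, le_rfl, hN, ht⟩
  | succ t ih =>
    rcases hD (N + (t + 1)) (by omega) with h | h
    · exact ⟨_, by omega, h, ht⟩
    · exact ih (ht.trans_le (tailTwos_succ_le ha ha' h))

lemma okamotoSum_digitShift (ha : 1 / 2 < a) (ha' : a < 1) {D : ℕ → ℕ} {n : ℕ} (h0 : D n = 0)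
    (h : ∀ i ≥ n, D i = 0 ∨ D i = 2) :
    okamotoSum a (digitShift D n) = (1 - a) * tailTwos a D (n + 1) := by
  rw [okamotoSum_of_ne_one ha ha' (D := digitShift D n) h0 fun i => h _ (by omega)]
  refine congrArg _ (tsum_congr fun j => ?_)
  rw [show digitShift D n (1 + j) = D (n + 1 + j) from congrArg D (add_assoc n 1 j).symm]

end TailTwos

lemma frequently_nhdsWithin_right {x : ℝ} (hx0 : 0 ≤ x) {P : ℝ → Prop}
    (h : ∃ᶠ n : ℕ in atTop, ∃ y, x < y ∧ y < 1 ∧ y - x ≤ (1 / 3) ^ n ∧ P y) :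
    ∃ᶠ y in 𝓝[Icc 0 1 ∩ Ioi x] x, P y := by
  intro hev
  obtain ⟨δ, hδ, hsub⟩ := Metric.mem_nhdsWithin_iff.1 hev
  have hpow : ∀ᶠ n : ℕ in atTop, ((1 : ℝ) / 3) ^ n < δ :=
    (tendsto_pow_atTop_nhds_zero_of_lt_one (by norm_num) (by norm_num)).eventually_lt_const hδ
  obtain ⟨n, ⟨y, hxy, hy1, hyn, hP⟩, hn⟩ := (h.and_eventually hpow).exists
  refine hsub ⟨?_, ⟨⟨by linarith, hy1.le⟩, hxy⟩⟩ hP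
  rw [Metric.mem_ball, Real.dist_eq, abs_of_pos (by linarith)]
  linarith

lemma eventually_floor_eq_right {x : ℝ} (hx : x < 1) (N : ℕ) :
    ∀ᶠ y in 𝓝[Icc 0 1 ∩ Ioi x] x,
      x < y ∧ y < 1 ∧ ⌊(3 : ℝ) ^ N * x⌋ = ⌊(3 : ℝ) ^ N * y⌋ := by
  have h3 : (0 : ℝ) < 3 ^ N := by positivity
  have hlt : x < (⌊(3 : ℝ) ^ N * x⌋ + 1) / 3 ^ N := by
    rw [lt_div_iff₀ h3, mul_comm]
    exact Int.lt_floor_add_one _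
  filter_upwards [self_mem_nhdsWithin, nhdsWithin_le_nhds (Iio_mem_nhds hx),
    nhdsWithin_le_nhds (Iio_mem_nhds hlt)] with y hy hy1 hy2
  have hxy : x < y := hy.2
  refine ⟨hxy, hy1, Eq.symm (Int.floor_eq_iff.2 ⟨?_, ?_⟩)⟩
  · exact (Int.floor_le _).trans (mul_le_mul_of_nonneg_left hxy.le h3.le)
  · rw [mem_Iio, lt_div_iff₀ h3] at hy2
    linarith

lemma rderiv_of_tendsto_sign_mul {f : ℝ → ℝ} {x : ℝ} {l : ℕ}
    (h : Tendsto (fun y => (-1) ^ l * ((f y - f x) / (y - x))) (𝓝[Icc 0 1 ∩ Ioi x] x) atTop) :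
    if Even l then rderivPInf f x else rderivMInf f x := by
  split_ifs with hl
  · simpa only [rderivPInf, hl.neg_one_pow, one_mul] using h
  · rw [Nat.not_even_iff_odd] at hl
    simpa only [rderivMInf, hl.neg_one_pow, neg_one_mul, tendsto_neg_atTop_iff] using h

lemma tendsto_sign_mul_of_rderiv {f : ℝ → ℝ} {x : ℝ} (l : ℕ)
    (h : rderivPInf f x ∨ rderivMInf f x) :
    Tendsto (fun y => (-1) ^ l * ((f y - f x) / (y - x))) (𝓝[Icc 0 1 ∩ Ioi x] x) atTop ∨
      Tendsto (fun y => (-1) ^ l * ((f y - f x) / (y - x))) (𝓝[Icc 0 1 ∩ Ioi x] x) atBot := by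
  rcases neg_one_pow_eq_or ℝ l with hl | hl
  · simpa only [rderivPInf, rderivMInf, hl, one_mul] using h
  · simpa only [rderivPInf, rderivMInf, hl, neg_one_mul, tendsto_neg_atTop_iff,
      tendsto_neg_atBot_iff] using h.symm

lemma Mfun_eq (k : ℕ) (a x : ℝ) :
    Mfun k a x = iteratedDeriv k (fun b => okamotoSum b (tDigit x)) a := by
  simp only [Mfun, okamoto_eq_okamotoSum]

section Main

variable {k l : ℕ} {a x : ℝ}

lemma tendsto_sign_mul_of_LaPlus_lt_one (ha : 1 / 2 < a) (ha' : a < 1) (hx : x ∈ Ioo (0 : ℝ) 1)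
    (hl : ∀ᶠ n in atTop, lCount x n = l) (hL : LaPlus a x < 1) :
    Tendsto (fun y => (-1) ^ l * ((Mfun k a y - Mfun k a x) / (y - x)))
      (𝓝[Icc 0 1 ∩ Ioi x] x) atTop := by
  have ha0 : 0 ≤ a := by linarith
  obtain ⟨q, hLq, hq⟩ := exists_between hL
  have hev : ∀ᶠ n in atTop, tailTwos a (tDigit x) n < q :=
    eventually_lt_of_limsup_lt hLq
      (isBoundedUnder_of ⟨_, fun n => tailTwos_le ha0 ha' (tDigit x) n⟩)
  obtain ⟨N₁, hN₁⟩ := eventually_atTop.1 hev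
  obtain ⟨N₂, hN₂⟩ := exists_forall_tDigit_ne_one hl
  have hε : 0 < (1 - a) * (1 - q) := mul_pos (by linarith) (by linarith)
  obtain ⟨c, hc, N₃, hN₃⟩ := exists_le_iteratedDeriv_okamotoSum_sub ha ha' k l hε
  refine tendsto_atTop.2 fun K => ?_
  have hgrow : Tendsto (fun n : ℕ => c * (3 * a) ^ n) atTop atTop :=
    (tendsto_pow_atTop_atTop_of_one_lt (by linarith)).const_mul_atTop hc
  obtain ⟨N₄, hN₄⟩ := eventually_atTop.1 (tendsto_atTop.1 hgrow K)
  filter_upwards [eventually_floor_eq_right hx.2 (N₁ + N₂ + N₃ + N₄)] with y ⟨hxy, hy, hfl⟩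
  obtain ⟨n, hn, hlt⟩ := exists_first_tDigit_lt hx.1.le hxy hy
  have hnN : N₁ + N₂ + N₃ + N₄ ≤ n := by
    by_contra! hcon
    exact hlt.ne (tDigit_eq_of_floor_eq hx.2 hy hfl hcon)
  have hx0 : tDigit x n = 0 := by
    have h1 := (hN₂ n (by omega)).2
    have h2 := tDigit_le_two hy n
    omega
  have hdig : ∀ i ≥ n, tDigit x i = 0 ∨ tDigit x i = 2 := by
    intro i hi
    have h1 := (hN₂ i (by omega)).2
    have h2 := tDigit_le_two hx.2 i
    omega
  have hgap : (1 - a) * (1 - q) ≤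
      okamotoSum a (digitShift (tDigit y) n) - okamotoSum a (digitShift (tDigit x) n) := by
    rw [okamotoSum_digitShift ha ha' hx0 hdig]
    have h1 : 1 - a ≤ okamotoSum a (digitShift (tDigit y) n) :=
      one_sub_le_okamotoSum ha ha' (by simp only [digitShift, add_zero]; omega)
    have h2 := mul_le_mul_of_nonneg_left (hN₁ (n + 1) (by omega)).le (by linarith : 0 ≤ 1 - a)
    linarith
  have key := hN₃ n (by omega) (tDigit x) (tDigit y)
    (fun i hi => tDigit_eq_of_floor_eq hx.2 hy hn hi) (hN₂ n (by omega)).1 hgap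
  rw [← Mfun_eq, ← Mfun_eq] at key
  refine (hN₄ n (by omega)).trans ?_
  have hd : y - x ≤ (1 / 3) ^ n := sub_le_pow_of_floor_eq hn
  rw [← mul_div_assoc, le_div_iff₀ (sub_pos.2 hxy)]
  refine le_trans ?_ key
  calc c * (3 * a) ^ n * (y - x) ≤ c * (3 * a) ^ n * (1 / 3) ^ n :=
        mul_le_mul_of_nonneg_left hd (by positivity)
    _ = c * a ^ n := by
        rw [mul_assoc, ← mul_pow]
        congr 2
        ring

lemma frequently_sign_mul_pos (ha : 1 / 2 < a) (ha' : a < 1) (hx : x ∈ Ioo (0 : ℝ) 1)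
    (hl : ∀ᶠ n in atTop, lCount x n = l) :
    ∃ᶠ y in 𝓝[Icc 0 1 ∩ Ioi x] x,
      0 < (-1) ^ l * ((Mfun k a y - Mfun k a x) / (y - x)) := by
  obtain ⟨N₂, hN₂⟩ := exists_forall_tDigit_ne_one hl
  have hε : 0 < (1 - a) / 2 := by linarith
  obtain ⟨c, hc, N₃, hN₃⟩ := exists_le_iteratedDeriv_okamotoSum_sub ha ha' k l hε
  obtain ⟨m, hm⟩ := exists_pow_lt_of_lt_one hε ha'
  refine frequently_nhdsWithin_right hx.1.le (frequently_atTop.2 fun N => ?_)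
  obtain ⟨n, hn, hn2⟩ := not_eventually_tDigit_eq_two hx.2 (N + N₂ + N₃)
  have hx0 : tDigit x n = 0 := by
    have h1 := (hN₂ n (by omega)).2
    have h2 := tDigit_le_two hx.2 n
    omega
  obtain ⟨y, hxy, hy, hd, hpre, htail⟩ :=
    exists_digitShift_eq_leadingTwos hx.2 hx0 (by omega : 1 ≤ m + 1)
  refine ⟨n, by omega, y, hxy, hy, hd, ?_⟩
  have hgap : (1 - a) / 2 ≤
      okamotoSum a (digitShift (tDigit y) n) - okamotoSum a (digitShift (tDigit x) n) := by
    rw [htail, okamotoSum_leadingTwos ha ha']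
    have h1 : okamotoSum a (digitShift (tDigit x) n) ≤ a := okamotoSum_le_of_zero ha ha' hx0
    have h2 : a ^ (m + 1) ≤ a ^ m := pow_le_pow_of_le_one (by linarith) ha'.le (by omega)
    linarith
  have key := hN₃ n (by omega) (tDigit x) (tDigit y) hpre (hN₂ n (by omega)).1 hgap
  rw [← Mfun_eq, ← Mfun_eq] at key
  have hpos : 0 < c * a ^ n := mul_pos hc (pow_pos (by linarith) n)
  rw [← mul_div_assoc]
  exact div_pos (hpos.trans_le key) (sub_pos.2 hxy)

lemma frequently_sign_mul_neg (ha : 1 / 2 < a) (ha' : a < 1) (hx : x ∈ Ioo (0 : ℝ) 1)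
    (hl : ∀ᶠ n in atTop, lCount x n = l) (hL : 1 < LaPlus a x) :
    ∃ᶠ y in 𝓝[Icc 0 1 ∩ Ioi x] x,
      (-1) ^ l * ((Mfun k a y - Mfun k a x) / (y - x)) < 0 := by
  have ha0 : 0 ≤ a := by linarith
  obtain ⟨q, hq, hLq⟩ := exists_between hL
  have hfreq : ∃ᶠ n in atTop, q < tailTwos a (tDigit x) n :=
    frequently_lt_of_lt_limsup
      (isBoundedUnder_of ⟨0, fun n => tailTwos_nonneg ha0 (tDigit x) n⟩).isCoboundedUnder_le hLq
  obtain ⟨N₂, hN₂⟩ := exists_forall_tDigit_ne_one hl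
  have hε : 0 < (1 - a) * (q - 1) := mul_pos (by linarith) (by linarith)
  obtain ⟨c, hc, N₃, hN₃⟩ := exists_le_iteratedDeriv_okamotoSum_sub ha ha' k l hε
  refine frequently_nhdsWithin_right hx.1.le (frequently_atTop.2 fun N => ?_)
  have hdig : ∀ i ≥ N₂, tDigit x i = 0 ∨ tDigit x i = 2 := by
    intro i hi
    have h1 := (hN₂ i hi).2
    have h2 := tDigit_le_two hx.2 i
    omega
  obtain ⟨N₀, hN₀, hN₀2⟩ := not_eventually_tDigit_eq_two hx.2 (N + N₂ + N₃)
  obtain ⟨n', hn', hqn'⟩ := frequently_atTop.1 hfreq (N₀ + 1)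
  obtain ⟨t, rfl⟩ := Nat.exists_eq_add_of_le hn'
  rw [add_right_comm] at hqn'
  obtain ⟨n, hn, hx0, hqn⟩ := exists_zero_digit_lt_tailTwos ha0 ha'
    (fun i hi => hdig i (by omega)) ((hdig N₀ (by omega)).resolve_right hN₀2) t hqn'
  obtain ⟨y, hxy, hy, hd, hpre, htail⟩ :=
    exists_digitShift_eq_leadingTwos hx.2 hx0 le_rfl
  refine ⟨n, by omega, y, hxy, hy, hd, ?_⟩
  have hgap : (1 - a) * (q - 1) ≤
      okamotoSum a (digitShift (tDigit x) n) - okamotoSum a (digitShift (tDigit y) n) := by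
    rw [htail, okamotoSum_leadingTwos ha ha', pow_one,
      okamotoSum_digitShift ha ha' hx0 fun i hi => hdig i (by omega)]
    have := mul_le_mul_of_nonneg_left hqn.le (by linarith : 0 ≤ 1 - a)
    linarith
  have hcount : ((Finset.range n).filter (fun i => tDigit y i = 1)).card = l := by
    rw [← (hN₂ n (by omega)).1, lCount]
    refine congrArg Finset.card (Finset.filter_congr fun i hi => ?_)
    rw [hpre i (Finset.mem_range.1 hi)]
  have key := hN₃ n (by omega) (tDigit y) (tDigit x) (fun i hi => (hpre i hi).symm) hcount hgap
  rw [← Mfun_eq, ← Mfun_eq] at key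
  have hpos : 0 < c * a ^ n := mul_pos hc (pow_pos (by linarith) n)
  rw [← mul_div_assoc]
  exact div_neg_of_neg_of_pos (by linarith) (sub_pos.2 hxy)

end Main

/-- for `1/2 < a < 1`, `k ≥ 1`, and `x ∈ (0,1)` whose ternary expansion has
finitely many `1`s (say `l` of them in total): if `L_a⁺(x) < 1` then `M_{k,a}` has infinite
right derivative `(-1)^l·∞` at `x`; conversely, if `M_{k,a}` has an infinite right
derivative at `x`, then `L_a⁺(x) ≤ 1` and the right derivative equals `(-1)^l·∞`. -/
theorem stmt17 (k : ℕ) (hk : 1 ≤ k) (a : ℝ) (ha : 1/2 < a) (ha' : a < 1)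
    (x : ℝ) (hx : x ∈ Set.Ioo (0:ℝ) 1)
    (l : ℕ) (hl : ∀ᶠ n in atTop, lCount x n = l) :
    (LaPlus a x < 1 →
      (if Even l then rderivPInf (Mfun k a) x else rderivMInf (Mfun k a) x)) ∧
    ((rderivPInf (Mfun k a) x ∨ rderivMInf (Mfun k a) x) →
      LaPlus a x ≤ 1 ∧
      (if Even l then rderivPInf (Mfun k a) x else rderivMInf (Mfun k a) x)) := by
  refine ⟨fun hL => rderiv_of_tendsto_sign_mul
    (tendsto_sign_mul_of_LaPlus_lt_one ha ha' hx hl hL), fun h => ?_⟩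
  rcases tendsto_sign_mul_of_rderiv l h with h | h
  · refine ⟨not_lt.1 fun hL => ?_, rderiv_of_tendsto_sign_mul h⟩
    obtain ⟨y, hy1, hy2⟩ := ((frequently_sign_mul_neg (k := k) ha ha' hx hl hL).and_eventually
      (h.eventually_gt_atTop 0)).exists
    exact absurd hy1 hy2.not_gt
  · obtain ⟨y, hy1, hy2⟩ := ((frequently_sign_mul_pos (k := k) ha ha' hx hl).and_eventually
      (h.eventually_lt_atBot 0)).exists
    exact absurd hy1 hy2.not_gt
end
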